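/- Every set of 30 points in general position in the plane (no three collinear) has at least 9726 four-element subsets in convex position. -/

import Mathlib

/-- The determinant of two planar vectors; its sign tells on which open side of the
(directed) line with direction `u` a point lies. -/
def det2 (u v : ℝ × ℝ) : ℝ := u.1 * v.2 - u.2 * v.1

/-- The standard inner product on the plane; orthogonal projection onto a line with
direction `d` orders points by `dot2 d ·`. -/
def dot2 (u v : ℝ × ℝ) : ℝ := u.1 * v.1 + u.2 * v.2

/-- `P` is in general position: no three of its points are collinear. -/
def GenPos (P : Finset (ℝ × ℝ)) : Prop :=
  ∀ p ∈ P, ∀ q ∈ P, ∀ r ∈ P, p ≠ q → p ≠ r → q ≠ r →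
    ¬ Collinear ℝ ({p, q, r} : Set (ℝ × ℝ))

/-- The line through the two (distinct) points `p, q` of `P` is a `k`-edge of `P`: it
leaves exactly `k` points of `P` on one of its open sides. -/
def IsKEdge (P : Finset (ℝ × ℝ)) (k : ℕ) (p q : ℝ × ℝ) : Prop :=
  p ≠ q ∧
    ({x ∈ (P : Set (ℝ × ℝ)) | 0 < det2 (q - p) (x - p)}.ncard = k ∨
     {x ∈ (P : Set (ℝ × ℝ)) | det2 (q - p) (x - p) < 0}.ncard = k)

/-- `E_k(P)`: the number of `k`-edges of `P` (pairs of points of `P` whose line leaves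
exactly `k` points of `P` on one open side). -/
noncomputable def Ek (P : Finset (ℝ × ℝ)) (k : ℕ) : ℕ :=
  {e : Sym2 (ℝ × ℝ) | ∃ p ∈ P, ∃ q ∈ P, e = s(p, q) ∧ IsKEdge P k p q}.ncard

/-- `E_{≤k}(P) = Σ_{j=0}^{k} E_j(P)`: the number of `(≤ k)`-edges of `P`. -/
noncomputable def EleK (P : Finset (ℝ × ℝ)) (k : ℕ) : ℕ :=
  ∑ j ∈ Finset.range (k + 1), Ek P j

/-- Along the projection direction `d`, all points of `X` lie strictly between all the
points of `Y` and all the points of `Z` (the `Y`-block on one side, the `Z`-block on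
the other). -/
def ProjBetween (d : ℝ × ℝ) (X Y Z : Finset (ℝ × ℝ)) : Prop :=
  (∀ x ∈ X, ∀ y ∈ Y, ∀ z ∈ Z, dot2 d y < dot2 d x ∧ dot2 d x < dot2 d z) ∨
  (∀ x ∈ X, ∀ y ∈ Y, ∀ z ∈ Z, dot2 d z < dot2 d x ∧ dot2 d x < dot2 d y)

/-- `P` is 3-decomposable: it can be partitioned into three equal-sized sets `A, B, C`
such that some triangle `T = v₁v₂v₃` encloses `P` and the orthogonal projections of `P`
onto the lines of the three sides of `T` show `A` between `B` and `C` on one side, `B`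
between `C` and `A` on the second side, and `C` between `A` and `B` on the third side. -/
def PtSet3Decomposable (P : Finset (ℝ × ℝ)) : Prop :=
  ∃ A B C : Finset (ℝ × ℝ), ∃ v₁ v₂ v₃ : ℝ × ℝ,
    A ∪ B ∪ C = P ∧ Disjoint A B ∧ Disjoint A C ∧ Disjoint B C ∧
    A.card = B.card ∧ B.card = C.card ∧
    ¬ Collinear ℝ ({v₁, v₂, v₃} : Set (ℝ × ℝ)) ∧
    (P : Set (ℝ × ℝ)) ⊆ convexHull ℝ {v₁, v₂, v₃} ∧
    ProjBetween (v₂ - v₁) A B C ∧ ProjBetween (v₃ - v₂) B C A ∧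
    ProjBetween (v₁ - v₃) C A B
/-- A finite planar point set is in convex position if none of its points lies in the
convex hull of the others. -/
def ConvexPosition (s : Finset (ℝ × ℝ)) : Prop :=
  ∀ x ∈ s, x ∉ convexHull ℝ ((s.erase x : Finset (ℝ × ℝ)) : Set (ℝ × ℝ))

/-- `cr(P)`: the number of crossings in the rectilinear drawing of the complete graph
on `P`, i.e. the number of 4-element subsets of `P` in convex position. -/
noncomputable def crNum (P : Finset (ℝ × ℝ)) : ℕ :=
  {s : Finset (ℝ × ℝ) | s ⊆ P ∧ s.card = 4 ∧ ConvexPosition s}.ncard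

open Finset (Ico add_sum_erase card_eq_three card_eq_zero card_erase_of_mem card_image_of_injOn card_image_of_injective card_insert_of_notMem card_le_card card_le_card_of_injOn card_lt_card card_pos card_range card_sdiff_add_card_inter card_union_le card_union_of_disjoint eq_of_subset_of_card_le filter_eq_empty_iff filter_subset mem_Ico mem_erase mem_filter mem_image mem_insert mem_inter mem_of_mem_erase mem_powersetCard mem_product mem_range mem_sdiff mem_singleton mem_union mem_univ range sum_le_sum sum_range_succ univ)
set_option linter.all false
notation "om" => (by omega)

structure Sq (V : Type) where
  N : ℕ
  pos : ℕ → V → ℕ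
  u : ℕ → V
  v : ℕ → V
  inj : ∀ t x y, pos t x = pos t y → x = y
  lt : ∀ t x, pos t x < 30
  huv : ∀ t, pos t (v t) = pos t (u t) + 1
  hu : ∀ t, pos (t+1) (u t) = pos t (u t) + 1
  hv : ∀ t, pos (t+1) (v t) = pos t (u t)
  hx : ∀ t x, x ≠ u t → x ≠ v t → pos (t+1) x = pos t x
  flip : ∀ t x, pos (t+N) x + pos t x = 29
  btw : ∀ s r sk x y, s ≤ r → r ≤ sk → sk ≤ s + N → pos s x < pos s y → pos sk x < pos sk y →
    pos r x < pos r y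

notation "SF" => Sq (Fin 30)

namespace Sq
variable {V : Type} [Fintype V] [DecidableEq V] (S : Sq V) {U : Finset V}
local notation "ps" => pos S
local notation "NN" => N S
local notation "Uu" => u S
local notation "Vv" => v S
lemma ud (t) : Uu t ≠ Vv t := by
  intro h; have := S.huv t; rw [← h] at this; omega

lemma pos_ne {t x y} (h : x ≠ y) : ps t x ≠ ps t y := fun e => h (S.inj t x y e)

lemma bb (t x) : x = Uu t ∨ x = Vv t ∨ ps (t+1) x = ps t x := by
  by_cases h : x = Uu t
  · exact Or.inl h
  · by_cases ae : x = Vv t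
    · exact Or.inr (Or.inl ae)
    · exact Or.inr (Or.inr (S.hx t x h ae))

lemma step_iff (t x y) (h : ¬ (x = Uu t ∧ y = Vv t)) (ae : ¬ (x = Vv t ∧ y = Uu t)) :
    ps (t+1) x < ps (t+1) y ↔ ps t x < ps t y := by
  have eg := S.huv t
  have eb := S.hu t
  have eh := S.hv t
  have hxx := S.bb t x
  have hyy := S.bb t y
  have i1 := S.inj t x (Uu t)
  have i2 := S.inj t x (Vv t)
  have i3 := S.inj t y (Uu t)
  have i4 := S.inj t y (Vv t)
  grind

lemma step_eq (t x y) (h : ps t x < ps t y) (ae : ¬ ps (t+1) x < ps (t+1) y) :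
    x = Uu t ∧ y = Vv t := by
  by_contra hc
  by_cases ad : x = Vv t ∧ y = Uu t
  · have eg := S.huv t
    grind
  · exact ae ((S.step_iff t x y hc ad).2 h)

lemma flip_lt (t x y) : ps (t+NN) x < ps (t+NN) y ↔ ps t y < ps t x := by
  have := S.flip t x; have := S.flip t y; omega

lemma pos_2N (t x) : ps (t+NN+NN) x = ps t x := by
  have := S.flip t x; have := S.flip (t+NN) x; omega

lemma uN (t) : Uu (t+NN) = Vv t ∧ Vv (t+NN) = Uu t := by
  have h := S.step_eq (t+NN) (Vv t) (Uu t) ?_ ?_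
  · exact ⟨h.1.symm, h.2.symm⟩
  · rw [S.flip_lt]; have := S.huv t; omega
  · have : t + NN + 1 = t + 1 + NN := by ring
    rw [this, S.flip_lt, S.hu, S.hv]; omega

lemma swap_lt (t) : ps t (Uu t) < ps t (Vv t) := by have := S.huv t; omega
lemma swap_lt' (t) : ps (t+1) (Vv t) < ps (t+1) (Uu t) := by
  have := S.hu t; have := S.hv t; omega

lemma exists_swap (s sk x y) (h : s ≤ sk) (aa : ps s x < ps s y)
    (ad : ¬ ps sk x < ps sk y) : ∃ t, s ≤ t ∧ t < sk ∧ Uu t = x ∧ Vv t = y := by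
  induction sk, h using Nat.le_induction with
  | base => exact absurd aa ad
  | succ n hn ih =>
    by_cases hc : ps n x < ps n y
    · obtain ⟨a, b⟩ := S.step_eq n x y hc ad
      exact ⟨n, hn, om, a.symm, b.symm⟩
    · obtain ⟨t, a, b, c⟩ := ih hc
      exact ⟨t, a, om, c⟩

lemma Npos [Nonempty V] : 0 < NN := by
  rcases Nat.eq_zero_or_pos NN with h | h
  · have aa := S.flip 0 (Uu 0)
    have ad := S.flip 0 (Vv 0)
    rw [h] at aa ad
    have := S.huv 0
    simp at aa ad
    omega
  · exact h

lemma swap_unique (t tb : ℕ) (h : t < tb) (ae : tb < t + NN)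
    (hp : (Uu t = Uu tb ∧ Vv t = Vv tb) ∨ (Uu t = Vv tb ∧ Vv t = Uu tb)) : False := by
  rcases hp with ⟨a, b⟩ | ⟨a, b⟩
  · have aa := S.swap_lt t
    have ad := S.swap_lt' t
    have af := S.swap_lt tb
    rw [← a, ← b] at af
    have := S.btw t (t+1) tb _ _ om om om aa af
    omega
  · have aa := S.swap_lt' t
    have af := S.swap_lt tb
    have ag := S.swap_lt' tb
    rw [← a, ← b] at af ag
    have := S.btw (t+1) (tb) (t+NN) (Vv t) (Uu t) om om om aa ?_
    · have ah := S.btw tb (tb+1) (t+NN) (Vv t) (Uu t) om om om af ?_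
      · omega
      · rw [S.flip_lt]; exact S.swap_lt t
    · rw [S.flip_lt]; exact S.swap_lt t

def rk (U : Finset V) (t : ℕ) (x : V) : ℕ := (U.filter fun z => ps t z < ps t x).card

local notation "Rk" => rk S
lemma rk_lt_card {t x} (h : x ∈ U) : Rk U t x < U.card := by
  apply card_lt_card
  refine ⟨filter_subset _ _, fun hh => ?_⟩
  have := hh h
  simp at this

lemma rk_mono {t x y} (h : ps t x ≤ ps t y) : Rk U t x ≤ Rk U t y := by
  apply card_le_card
  intro z; simp only [mem_filter]; intro hz; exact ⟨hz.1, om⟩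

lemma rg {t x y} (hx : x ∈ U) (h : ps t x < ps t y) :
    Rk U t x < Rk U t y := by
  apply card_lt_card
  refine ⟨?_, fun hh => ?_⟩
  · intro z; simp only [mem_filter]; intro hz; exact ⟨hz.1, om⟩
  · have := hh (by simp only [mem_filter]; exact ⟨hx, h⟩ : x ∈ _)
    simp at this

lemma lt_of_rk {t x y} (h : Rk U t x < Rk U t y) : ps t x < ps t y := by
  by_contra hc
  have := S.rk_mono (U := U) (t := t) (x := y) (y := x) om
  omega

lemma rk_inj {t x y} (hx : x ∈ U) (hy : y ∈ U) (h : Rk U t x = Rk U t y) :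
    x = y := by
  apply S.inj t
  rcases lt_trichotomy (ps t x) (ps t y) with aa | aa | aa
  · have := S.rg hx aa; omega
  · exact aa
  · have := S.rg hy aa; omega

lemma rk_step {t x} (h : x ≠ Uu t) (ae : x ≠ Vv t) :
    Rk U (t+1) x = Rk U t x := by
  unfold rk; congr 1; ext z; simp only [mem_filter]
  rw [S.step_iff t z x (by tauto) (by tauto)]

lemma rj {t} : Rk U t (Vv t) = Rk U t (Uu t) + if Uu t ∈ U then 1 else 0 := by
  unfold rk
  have e := S.huv t
  split_ifs with h
  · have : (U.filter fun z => ps t z < ps t (Vv t)) =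
      insert (Uu t) (U.filter fun z => ps t z < ps t (Uu t)) := by
      ext z; simp only [mem_filter, mem_insert]
      have := S.inj t z (Uu t)
      constructor
      · rintro ⟨a, b⟩
        by_cases hz : z = Uu t
        · exact Or.inl hz
        · exact Or.inr ⟨a, by grind⟩
      · rintro (rfl | ⟨a, b⟩)
        · exact ⟨h, om⟩
        · exact ⟨a, om⟩
    rw [this, card_insert_of_notMem (by simp)]
  · rw [add_zero]; congr 1; ext z; simp only [mem_filter]
    have := S.inj t z (Uu t)
    constructor
    · rintro ⟨a, b⟩
      refine ⟨a, ?_⟩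
      by_cases hz : z = Uu t
      · subst hz; exact absurd a h
      · grind
    · rintro ⟨a, b⟩; exact ⟨a, om⟩

lemma rk_v' {t} : Rk U (t+1) (Vv t) = Rk U t (Uu t) := by
  unfold rk; congr 1; ext z; simp only [mem_filter]
  have e := S.huv t; have eb := S.hu t; have eh := S.hv t; have ej := S.bb t z
  grind

lemma rk_u' {t} : Rk U (t+1) (Uu t) = Rk U t (Uu t) + if Vv t ∈ U then 1 else 0 := by
  unfold rk
  have e := S.huv t; have eb := S.hu t; have eh := S.hv t
  split_ifs with h
  · have : (U.filter fun z => ps (t+1) z < ps (t+1) (Uu t)) =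
      insert (Vv t) (U.filter fun z => ps t z < ps t (Uu t)) := by
      ext z; simp only [mem_filter, mem_insert]
      have := S.inj t z (Uu t); have ej := S.bb t z
      grind
    rw [this, card_insert_of_notMem (by simp; omega)]
  · rw [add_zero]; congr 1; ext z; simp only [mem_filter]
    have := S.inj t z (Uu t); have ej := S.bb t z
    grind

lemma rk_flip {t x} (h : x ∈ U) : Rk U (t+NN) x + Rk U t x + 1 = U.card := by
  unfold rk
  have aa : (U.filter fun z => ps (t+NN) z < ps (t+NN) x) =
     (U.filter fun z => ps t x < ps t z) := by
    ext z; simp only [mem_filter, S.flip_lt]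
  have ad : (U.filter fun z => ¬ ps t z < ps t x) =
      insert x (U.filter fun z => ps t x < ps t z) := by
    ext z; simp only [mem_filter, mem_insert]
    have := S.inj t z x
    grind
  have af := Finset.card_filter_add_card_filter_not (s := U) (fun z => ps t z < ps t x)
  rw [ad, card_insert_of_notMem (by simp)] at af
  rw [aa]; omega

lemma rk_univ (hc : Fintype.card V = 30) (t x) : Rk univ t x = ps t x := by
  have him : univ.image (ps t) = range 30 := by
    apply eq_of_subset_of_card_le
    · intro i hi; simp only [mem_image] at hi; obtain ⟨z, -, rfl⟩ := hi
      simpa using S.lt t z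
    · rw [card_image_of_injective _ (fun x y h => S.inj t x y h)]; simp [hc]
  have : (univ.filter fun z => ps t z < ps t x).image (ps t) = range (ps t x) := by
    ext i; simp only [mem_image, mem_filter, mem_univ, true_and, mem_range]
    constructor
    · rintro ⟨z, hz, rfl⟩; exact hz
    · intro hi
      have hl := S.lt t x
      have : i ∈ univ.image (ps t) := by rw [him]; simp; omega
      simp only [mem_image] at this; obtain ⟨z, -, rfl⟩ := this
      exact ⟨z, hi, rfl⟩
  unfold rk
  rw [← card_image_of_injective _ (fun x y h => S.inj t x y h), this, card_range]

def L (U : Finset V) (K t : ℕ) : Finset V := U.filter fun x => Rk U t x < K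

local notation "Ls" => L S
lemma mem_L {K t x} : x ∈ Ls U K t ↔ x ∈ U ∧ Rk U t x < K := by
  simp [L]

lemma rk_image (U : Finset V) (t) : U.image (Rk U t) = range U.card := by
  apply eq_of_subset_of_card_le
  · intro i hi; simp only [mem_image] at hi; obtain ⟨z, hz, rfl⟩ := hi
    simpa using S.rk_lt_card hz
  · rw [card_image_of_injOn (fun x hx y hy h => S.rk_inj hx hy h)]; simp

lemma exists_rk {t i} (h : i < U.card) : ∃ x ∈ U, Rk U t x = i := by
  have : i ∈ U.image (Rk U t) := by rw [rk_image]; simpa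
  simpa using this

lemma card_L {K t} (h : K ≤ U.card) : (Ls U K t).card = K := by
  have : (Ls U K t).image (Rk U t) = range K := by
    ext i; simp only [mem_image, mem_range, mem_L]
    constructor
    · rintro ⟨x, ⟨_, hx⟩, rfl⟩; exact hx
    · intro hi; obtain ⟨x, hx, rfl⟩ := S.exists_rk (U := U) (t := t) (i := i) om
      exact ⟨x, ⟨hx, hi⟩, rfl⟩
  rw [← card_image_of_injOn (f := Rk U t), this, card_range]
  intro x hx y hy h
  simp only [Finset.mem_coe, mem_L] at hx hy
  exact S.rk_inj hx.1 hy.1 h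

lemma L_subset {K t} : Ls U K t ⊆ U := filter_subset _ _

def gate (U : Finset V) (K t : ℕ) : Prop := Uu t ∈ U ∧ Vv t ∈ U ∧ Rk U t (Uu t) + 1 = K

instance (U : Finset V) (K t : ℕ) : Decidable (S.gate U K t) := by unfold gate; infer_instance

lemma L_step_mem {K t x} (h : ¬ S.gate U K t) :
    x ∈ Ls U K (t+1) ↔ x ∈ Ls U K t := by
  simp only [mem_L]
  unfold gate at h
  by_cases aa : x = Uu t
  · subst aa; have := S.rk_u' (U := U) (t := t)
    split_ifs at this <;> grind
  · by_cases ad : x = Vv t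
    · subst ad; have := S.rk_v' (U := U) (t := t); have := S.rj (U := U) (t := t)
      split_ifs at this <;> grind
    · rw [S.rk_step aa ad]

lemma L_step_gate {K t} (h : S.gate U K t) :
    Ls U K (t+1) = insert (Vv t) ((Ls U K t).erase (Uu t)) := by
  obtain ⟨a, b, c⟩ := h
  ext x
  simp only [mem_L, mem_insert, mem_erase]
  have hne := S.ud t
  by_cases aa : x = Uu t
  · subst aa; have := S.rk_u' (U := U) (t := t)
    rw [if_pos b] at this; grind
  · by_cases ad : x = Vv t
    · subst ad; have := S.rk_v' (U := U) (t := t); grind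
    · rw [S.rk_step aa ad]; grind

def G (U : Finset V) (K s sk : ℕ) : ℕ := ((Ico s sk).filter fun t => S.gate U K t).card

lemma G_succ {K s sk} (h : s ≤ sk) :
    S.G U K s (sk+1) = S.G U K s sk + if S.gate U K sk then 1 else 0 := by
  unfold G
  rw [← Finset.insert_Ico_right_eq_Ico_add_one h, Finset.filter_insert]
  split_ifs with aa
  · rw [card_insert_of_notMem (by simp)]
  · rfl

lemma gate_lemma {K s sk} (h : s ≤ sk) :
    (Ls U K sk \ Ls U K s).card ≤ S.G U K s sk := by
  induction sk, h using Nat.le_induction with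
  | base => simp
  | succ n hn ih =>
    rw [S.G_succ hn]
    split_ifs with aa
    · rw [S.L_step_gate aa]
      refine le_trans (card_le_card (t := insert (Vv n) (Ls U K n \ Ls U K s)) ?_) ?_
      · intro x; simp only [mem_sdiff, mem_insert, mem_erase]; tauto
      · refine le_trans (Finset.card_insert_le _ _) om
    · have : Ls U K (n+1) = Ls U K n := by ext x; exact S.L_step_mem aa
      rw [this]; omega

lemma gate_lemma' {K s sk} (h : s ≤ sk) (hK : K ≤ U.card) :
    (Ls U K s \ Ls U K sk).card ≤ S.G U K s sk := by
  have aa := S.gate_lemma (U := U) (K := K) h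
  have ad := card_sdiff_add_card_inter (Ls U K s) (Ls U K sk)
  have af := card_sdiff_add_card_inter (Ls U K sk) (Ls U K s)
  rw [S.card_L hK] at ad af
  rw [Finset.inter_comm] at af
  omega

lemma L_flip {K t} (h : K ≤ U.card) : Ls U K (t+NN) = U \ Ls U (U.card - K) t := by
  ext x
  simp only [mem_L, mem_sdiff]
  by_cases hx : x ∈ U
  · have := S.rk_flip (t := t) hx
    simp only [hx, true_and]; omega
  · simp [hx]

def pr (U : Finset V) (K t : ℕ) : Prop := Uu t ∈ U ∧ Vv t ∈ U ∧
  (Rk U t (Uu t) < K ∨ U.card < Rk U t (Uu t) + 2 + K)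

instance (U : Finset V) (K t : ℕ) : Decidable (S.pr U K t) := by unfold pr; infer_instance

def EL (U : Finset V) (K : ℕ) : ℕ := ((Ico 0 NN).filter fun t => S.pr U K t).card

lemma pr_periodic (U : Finset V) (K : ℕ) : Function.Periodic (S.pr U K) NN := by
  intro t
  apply propext
  unfold pr
  rw [(S.uN t).1, (S.uN t).2]
  by_cases h : Uu t ∈ U ∧ Vv t ∈ U
  · have aa := S.rk_flip (t := t) h.2
    have ad := S.rj (U := U) (t := t)
    rw [if_pos h.1] at ad
    simp only [h, true_and]; omega
  · tauto

lemma EL_window (U : Finset V) (K s : ℕ) :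
    ((Ico s (s+NN)).filter fun t => S.pr U K t).card = S.EL U K := by
  unfold EL
  rw [Nat.filter_Ico_card_eq_of_periodic _ _ _ (S.pr_periodic U K)]
  have := Nat.filter_Ico_card_eq_of_periodic 0 _ _ (S.pr_periodic U K)
  rw [zero_add] at this
  exact this.symm

lemma cross_up {p s sk g} (h : s ≤ sk) (aa : Rk U s p ≤ g)
    (ad : g < Rk U sk p) : ∃ t, s ≤ t ∧ t < sk ∧ Uu t = p ∧ Vv t ∈ U ∧ Rk U t p = g := by
  induction sk, h using Nat.le_induction with
  | base => omega
  | succ n hn ih =>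
    by_cases hc : Rk U n p ≤ g
    · refine ⟨n, hn, om, ?_⟩
      by_cases hu : p = Uu n
      · subst hu
        have := S.rk_u' (U := U) (t := n)
        split_ifs at this with hv
        · exact ⟨rfl, hv, om⟩
        · omega
      · by_cases hv : p = Vv n
        · subst hv
          have := S.rk_v' (U := U) (t := n); have := S.rj (U := U) (t := n); omega
        · rw [S.rk_step hu hv] at ad; omega
    · obtain ⟨t, a, b, c⟩ := ih om
      exact ⟨t, a, om, c⟩

lemma cross_down {p s sk g} (h : s ≤ sk) (aa : g < Rk U s p)
    (ad : Rk U sk p ≤ g) : ∃ t, s ≤ t ∧ t < sk ∧ Vv t = p ∧ Uu t ∈ U ∧ Rk U t (Uu t) = g := by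
  induction sk, h using Nat.le_induction with
  | base => omega
  | succ n hn ih =>
    by_cases hc : Rk U n p ≤ g
    · obtain ⟨t, a, b, c⟩ := ih hc
      exact ⟨t, a, om, c⟩
    · refine ⟨n, hn, om, ?_⟩
      by_cases hu : p = Vv n
      · subst hu
        have := S.rk_v' (U := U) (t := n)
        have := S.rj (U := U) (t := n)
        split_ifs at this with hv
        · exact ⟨rfl, hv, om⟩
        · omega
      · by_cases hv : p = Uu n
        · subst hv
          have := S.rk_u' (U := U) (t := n); omega
        · rw [S.rk_step hv hu] at ad; omega

lemma rk_erase {p t} (x : V) (hp : p ∈ U) :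
    Rk U t x = Rk (U.erase p) t x + if ps t p < ps t x then 1 else 0 := by
  unfold rk
  rw [Finset.filter_erase]
  split_ifs with h
  · rw [card_erase_of_mem (by simp [hp, h])]
    have : 0 < (U.filter fun z => ps t z < ps t x).card :=
      card_pos.2 ⟨p, by simp [hp, h]⟩
    omega
  · rw [Finset.erase_eq_of_notMem (by simp [h])]; rfl

lemma pass {p tc} (hp : p ∈ U) (ak : Rk U tc p = 0) (P : ℕ → Prop) [DecidablePred P] :
    ((range (U.card - 1)).filter P).card ≤
    ((Ico tc (tc+NN)).filter fun t => Uu t = p ∧ Vv t ∈ U ∧ P (Rk U t p)).card := by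
  refine le_trans (card_le_card ?_)
    (Finset.card_image_le (f := fun t => Rk U t p))
  intro g hg
  simp only [mem_filter, mem_range] at hg
  have hf := S.rk_flip (t := tc) hp
  obtain ⟨t, a, b, c, d, e⟩ := S.cross_up (U := U) (p := p) (s := tc) (sk := tc+NN) (g := g)
    om om om
  simp only [mem_image, mem_filter, mem_Ico]
  exact ⟨t, ⟨⟨a, b⟩, c, d, by rw [e]; exact hg.2⟩, e⟩

lemma two_gate_card {n K : ℕ} (h : 2*K ≤ n - 1) :
    2*K ≤ ((range (n-1)).filter fun g => g < K ∨ n < g + 2 + K).card := by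
  have : range K ∪ Ico (n-1-K) (n-1) ⊆
     (range (n-1)).filter fun g => g < K ∨ n < g + 2 + K := by
    intro g; simp only [mem_union, mem_range, mem_Ico, mem_filter]; omega
  refine le_trans ?_ (card_le_card this)
  rw [card_union_of_disjoint]
  · simp; omega
  · rw [Finset.disjoint_left]; intro g; simp; omega

lemma pass2 {p tc K} (hp : p ∈ U) (ak : Rk U tc p = 0) (h : 2*K ≤ U.card - 1) :
    2*K ≤ ((Ico tc (tc+NN)).filter fun t => Uu t = p ∧ S.pr U K t).card := by
  refine le_trans (two_gate_card h) (le_trans (S.pass hp ak _) (card_le_card ?_))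
  intro t; rw [mem_filter, mem_filter]
  rintro ⟨a, b, c, d⟩
  exact ⟨a, b, by rw [b]; exact hp, c, by rw [b]; exact d⟩

lemma stepA {p tc K} (hp : p ∈ U) (ak : Rk U tc p = 0) (hn : 2*K+3 ≤ U.card) :
    S.EL (U.erase p) K + 3*(K+1) ≤ S.EL U (K+1) := by
  set Ua := U.erase p with ay
  set n := U.card with hnn
  have dc : Ua.card = n - 1 := card_erase_of_mem hp
  have hf := S.rk_flip (t := tc) hp
  obtain ⟨ts, hs1, hs2, -, -, hs⟩ := S.cross_up (U := U) (p := p) (s := tc) (sk := tc+NN) (g := K+1)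
    om om om
  have hp1 := S.pass2 hp ak (K := K+1) om
  rw [← S.EL_window U (K+1) tc, ← S.EL_window Ua K tc]
  have hL := S.gate_lemma (U := Ua) (K := K+1) (s := ts) (sk := tc+NN) om
  have hR := S.gate_lemma (U := Ua) (K := n-1-(K+1)) (s := tc) (sk := ts) om
  rw [S.L_flip om, dc] at hL
  have hsum : K+1 ≤ S.G Ua (K+1) ts (tc+NN) + S.G Ua (n-1-(K+1)) tc ts := by
    have hcard := card_sdiff_add_card_inter Ua (Ls Ua (n-1-(K+1)) tc)
    rw [Finset.inter_eq_right.2 (S.L_subset), S.card_L om, dc] at hcard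
    have : Ua \ Ls Ua (n-1-(K+1)) tc ⊆
      ((Ua \ Ls Ua (n - 1 - (K + 1)) tc) \ Ls Ua (K + 1) ts) ∪
      (Ls Ua (n - 1 - (K + 1)) ts \ Ls Ua (n - 1 - (K + 1)) tc) := by
      intro x
      simp only [mem_sdiff, mem_union, mem_L]
      rintro ⟨a, b⟩
      by_cases hx : Rk Ua ts x < K+1
      · right; exact ⟨⟨a, om⟩, b⟩
      · left; exact ⟨⟨a, b⟩, by tauto⟩
    have := card_le_card this
    have := this.trans (card_union_le _ _)
    omega
  unfold G at hsum
  have hlate : ∀ t, ts ≤ t → t < tc+NN → S.gate Ua (K+1) t → ps t (Uu t) < ps t p := by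
    rintro t aa ad ⟨hu, hv, hk⟩
    by_contra hc
    have af : Rk U ts p ≤ Rk U t p := by
      apply card_le_card
      intro z; simp only [mem_filter]; rintro ⟨hz, hz2⟩
      refine ⟨hz, S.btw ts t (tc+NN) _ _ aa om om hz2 ?_⟩
      rw [S.flip_lt]
      by_contra hcc
      rcases lt_or_eq_of_le (not_lt.1 hcc) with ag | ag
      · have := S.rg hz ag; omega
      · have := S.inj _ _ _ ag; subst this; omega
    have ag := S.rk_mono (U := U) (t := t) (not_lt.1 hc)
    have ah := S.rk_erase (t := t) (Uu t) hp
    rw [← ay] at ah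
    split_ifs at ah with bx
    · have := S.rg hp bx; omega
    · have bh := S.inj t (Uu t) p om
      rw [ay, bh] at hu; simp at hu
  have hearly : ∀ t, tc ≤ t → t < ts → S.gate Ua (n-1-(K+1)) t → ps t p < ps t (Uu t) := by
    rintro t aa ad ⟨hu, hv, hk⟩
    by_contra hc
    have af : Rk U t p ≤ Rk U ts p := by
      apply card_le_card
      intro z; simp only [mem_filter]; rintro ⟨hz, hz2⟩
      refine ⟨hz, ?_⟩
      by_contra hcc
      rcases lt_or_eq_of_le (not_lt.1 hcc) with ag | ag
      · have bx : ps tc p < ps tc z := by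
          by_contra bh
          rcases lt_or_eq_of_le (not_lt.1 bh) with bk | bk
          · have := S.rg hz bk; omega
          · have := S.inj _ _ _ bk; subst this; omega
        have := S.btw tc t ts _ _ aa om om bx ag
        omega
      · have := S.inj _ _ _ ag; subst this; omega
    have hlt : ps t (Uu t) < ps t p := by
      rcases lt_or_eq_of_le (not_lt.1 hc) with ag | ag
      · exact ag
      · have bh := S.inj _ _ _ ag
        rw [ay, bh] at hu; simp at hu
    have ah := S.rk_erase (t := t) (Uu t) hp
    rw [← ay, if_neg hc] at ah
    have hvp : ps t (Vv t) < ps t p := by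
      have := S.huv t
      have bk : Vv t ≠ p := by rintro bk; rw [ay, bk] at hv; simp at hv
      have := S.pos_ne (t := t) bk
      omega
    have := S.rg (mem_of_mem_erase hv) hvp
    have bm := S.rj (U := U) (t := t)
    rw [if_pos (mem_of_mem_erase hu)] at bm
    omega
  have key : ((Ico tc (tc+NN)).filter fun t => Uu t = p ∧ S.pr U (K+1) t) ∪
      (((Ico tc (tc+NN)).filter fun t => S.pr Ua K t) ∪
      (((Ico ts (tc+NN)).filter fun t => S.gate Ua (K+1) t) ∪
      ((Ico tc ts).filter fun t => S.gate Ua (n-1-(K+1)) t))) ⊆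
      (Ico tc (tc+NN)).filter fun t => S.pr U (K+1) t := by
    intro t
    simp only [mem_union, mem_filter, mem_Ico]
    have ah := S.rk_erase (t := t) (Uu t) hp
    rw [← ay] at ah
    rintro (⟨a, b, c⟩ | ⟨a, b, c, d⟩ | ⟨a, b⟩ | ⟨a, b⟩)
    · exact ⟨a, c⟩
    · refine ⟨a, mem_of_mem_erase b, mem_of_mem_erase c, ?_⟩
      split_ifs at ah <;> omega
    · have := hlate t a.1 a.2 b
      refine ⟨⟨om, a.2⟩, mem_of_mem_erase b.1, mem_of_mem_erase b.2.1, ?_⟩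
      rw [if_neg om] at ah
      have := b.2.2; omega
    · have := hearly t a.1 a.2 b
      refine ⟨⟨a.1, om⟩, mem_of_mem_erase b.1, mem_of_mem_erase b.2.1, ?_⟩
      rw [if_pos om] at ah
      have := b.2.2; omega
  have hcard := card_le_card key
  have df := card_union_of_disjoint (s := (Ico ts (tc+NN)).filter fun t => S.gate Ua (K+1) t)
    (t := (Ico tc ts).filter fun t => S.gate Ua (n-1-(K+1)) t) (by
      rw [Finset.disjoint_left]; intro t; simp only [mem_filter, mem_Ico]; omega)
  have dh := card_union_of_disjoint (s := (Ico tc (tc+NN)).filter fun t => S.pr Ua K t)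
    (t := ((Ico ts (tc+NN)).filter fun t => S.gate Ua (K+1) t) ∪
      ((Ico tc ts).filter fun t => S.gate Ua (n-1-(K+1)) t)) (by
      rw [Finset.disjoint_left]; intro t
      simp only [mem_filter, mem_Ico, mem_union]
      rintro ⟨_, _, _, h⟩ (⟨_, _, _, ae⟩ | ⟨_, _, _, ae⟩) <;> omega)
  rw [card_union_of_disjoint, dh, df] at hcard
  · omega
  · rw [Finset.disjoint_left]; intro t; simp only [mem_filter, mem_union]
    rintro ⟨_, a, _⟩ h
    have : Uu t ∈ Ua := by
      rcases h with h | h | h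
      · exact h.2.1
      · exact h.2.1
      · exact h.2.1
    rw [a] at this; simp [ay] at this

def Tb (K : ℕ) : ℕ := ∑ i ∈ range K, 3*(i+1)

lemma Ee {K} (h : 2*K+1 ≤ U.card) : Tb K ≤ S.EL U K := by
  induction K generalizing U with
  | zero => simp [Tb]
  | succ K ih =>
    obtain ⟨p, hp, ak⟩ := S.exists_rk (U := U) (t := 0) (i := 0) om
    have aa := S.stepA hp ak (K := K) om
    have ad := ih (U := U.erase p) (by rw [card_erase_of_mem hp]; omega)
    unfold Tb at *
    rw [sum_range_succ]; omega

lemma rk_lip (U : Finset V) (t x) : Rk U (t+1) x ≤ Rk U t x + 1 ∧ Rk U t x ≤ Rk U (t+1) x + 1 := by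
  by_cases hu : x = Uu t
  · subst hu
    have := S.rk_u' (U := U) (t := t)
    split_ifs at this <;> omega
  · by_cases hv : x = Vv t
    · subst hv
      have := S.rk_v' (U := U) (t := t); have := S.rj (U := U) (t := t)
      split_ifs at this <;> omega
    · rw [S.rk_step hu hv]; omega

open scoped Classical in
noncomputable def Ext (U : Finset V) : Finset V := U.filter fun x => ∃ t, Rk U t x = 0

lemma mem_Ext {x} : x ∈ S.Ext U ↔ x ∈ U ∧ ∃ t, Rk U t x = 0 := by
  simp [Ext]

lemma rk_2N (U : Finset V) (t x) : Rk U (t+NN+NN) x = Rk U t x := by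
  unfold rk; simp only [S.pos_2N]

def ee (U : Finset V) (t : ℕ) : V := if Rk U t (Uu t) = 0 then Vv t else Uu t

lemma ee_add {t} (hn : 3 ≤ U.card) (h : S.pr U 1 t) : S.ee U (t+NN) = S.ee U t := by
  unfold ee
  rw [(S.uN t).1, (S.uN t).2]
  obtain ⟨a, b, c⟩ := h
  have aa := S.rk_flip (t := t) b
  have ad := S.rj (U := U) (t := t)
  rw [if_pos a] at ad
  split_ifs <;> first | rfl | omega

lemma Ext_le_EL (hn : 3 ≤ U.card) : (S.Ext U).card ≤ S.EL U 1 := by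
  unfold EL
  refine le_trans (card_le_card (t := ((Ico 0 NN).filter fun t => S.pr U 1 t).image (S.ee U)) ?_)
    Finset.card_image_le
  intro p hp
  obtain ⟨hp, tj, aa⟩ := S.mem_Ext.1 hp
  have hf := S.rk_flip (t := tj) hp
  obtain ⟨t, -, -, dk, ht2, ht3⟩ := S.cross_down (U := U) (p := p) (s := tj+NN) (sk := tj+NN+NN) (g := 0)
    om om (by rw [S.rk_2N]; omega)
  have hpr : S.pr U 1 t := ⟨ht2, by rw [dk]; exact hp, om⟩
  have he : S.ee U t = p := by unfold ee; rw [if_pos ht3, dk]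
  haveI : Nonempty V := ⟨p⟩
  have hN := S.Npos
  have key : ∀ m r, S.pr U 1 r → S.ee U (r + m * NN) = S.ee U r := by
    intro m
    induction m with
    | zero => intro r _; simp
    | succ m ih =>
      intro r hr
      have : r + (m+1)*NN = (r + m*NN) + NN := by ring
      rw [this, S.ee_add hn, ih r hr]
      have := (S.pr_periodic U 1).nat_mul m r
      simp only [Nat.cast_id] at this
      rw [this]; exact hr
  have hmod : S.pr U 1 (t % NN) := by
    have := (S.pr_periodic U 1).map_mod_nat t
    rw [this]; exact hpr
  rw [mem_image]
  refine ⟨t % NN, ?_, ?_⟩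
  · rw [mem_filter, mem_Ico]
    exact ⟨⟨om, Nat.mod_lt _ hN⟩, hmod⟩
  · rw [← he]
    have := key (t / NN) (t % NN) hmod
    rw [← this]; congr 1; rw [mul_comm]; exact Nat.mod_add_div t NN

lemma Ext_erase {p} (hp : p ∈ U) : (S.Ext U).erase p ⊆ S.Ext (U.erase p) := by
  intro x
  simp only [mem_erase, mem_Ext]
  rintro ⟨a, b, t, h⟩
  refine ⟨⟨a, b⟩, t, ?_⟩
  have := S.rk_erase (t := t) x hp; omega

lemma exists_good (hn : 5 ≤ U.card) (ag : 4 ≤ (S.Ext U).card) :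
    ∃ p ∈ S.Ext U, 4 ≤ (S.Ext (U.erase p)).card := by
  by_contra hc
  push Not at hc
  have hU : S.Ext U ⊆ U := fun x hx => (S.mem_Ext.1 hx).1
  have aa : ∀ p ∈ S.Ext U, (S.Ext U).card = 4 ∧ S.Ext (U.erase p) = (S.Ext U).erase p := by
    intro p hp
    have a := S.Ext_erase (hU hp)
    have b := card_le_card a
    have c := hc p hp
    rw [card_erase_of_mem hp] at b
    refine ⟨om, (eq_of_subset_of_card_le a ?_).symm⟩
    rw [card_erase_of_mem hp]; omega
  have hL2 : ∀ t, Ls U 2 t ⊆ S.Ext U := by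
    intro t x hx
    rw [mem_L] at hx
    obtain ⟨p, hpU, hp⟩ := S.exists_rk (U := U) (t := t) (i := 0) om
    have hpE : p ∈ S.Ext U := S.mem_Ext.2 ⟨hpU, t, hp⟩
    by_cases hxp : x = p
    · rw [hxp]; exact hpE
    · have : x ∈ S.Ext (U.erase p) := by
        rw [mem_Ext]
        refine ⟨mem_erase.2 ⟨hxp, hx.1⟩, t, ?_⟩
        have e := S.rk_erase (t := t) x hpU
        rw [if_pos] at e
        · omega
        · by_contra hcc
          have bk := S.pos_ne (t := t) hxp
          have := S.rg (U := U) (t := t) (x := x) (y := p) hx.1 om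
          omega
      rw [(aa p hpE).2] at this
      exact mem_of_mem_erase this
  obtain ⟨p0, hp0⟩ : (S.Ext U).Nonempty := card_pos.1 om
  have hE4 := (aa p0 hp0).1
  have hE : ∀ t x, x ∈ S.Ext U → Rk U t x < 2 ∨ U.card ≤ Rk U t x + 2 := by
    intro t
    have eg : Ls U 2 t ∪ Ls U 2 (t+NN) = S.Ext U := by
      apply eq_of_subset_of_card_le
      · exact Finset.union_subset (hL2 _) (hL2 _)
      · rw [card_union_of_disjoint, S.card_L om, S.card_L om, hE4]
        rw [Finset.disjoint_left]; intro x; simp only [mem_L]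
        rintro ⟨a, b⟩ ⟨_, c⟩
        have := S.rk_flip (t := t) a; omega
    intro x hx
    rw [← eg, mem_union, mem_L, mem_L] at hx
    rcases hx with hx | hx
    · exact Or.inl hx.2
    · have := S.rk_flip (t := t) hx.1; omega
  have hmono : ∀ t x, x ∈ Ls U 2 t → x ∈ Ls U 2 0 := by
    intro t
    induction t with
    | zero => intro x hx; exact hx
    | succ t ih =>
      intro x hx
      apply ih
      have a := hE t x (hL2 _ hx)
      have b := S.rk_lip U t x
      rw [mem_L] at hx ⊢
      exact ⟨hx.1, om⟩
  obtain ⟨x, hxU, hx⟩ := S.exists_rk (U := U) (t := 0+NN) (i := 0) om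
  have := hmono (0+NN) x (S.mem_L.2 ⟨hxU, om⟩)
  rw [mem_L] at this
  have := S.rk_flip (t := 0) hxU
  omega

lemma EL_ge' {K} (hK : 1 ≤ K) (h : 2*K+1 ≤ U.card) (ag : 4 ≤ (S.Ext U).card) :
    Tb K + 1 ≤ S.EL U K := by
  induction K, hK using Nat.le_induction generalizing U with
  | base => have := S.Ext_le_EL (U := U) om; simp [Tb]; omega
  | succ K hK ih =>
    obtain ⟨p, hp, hp4⟩ := S.exists_good (U := U) om ag
    obtain ⟨hpU, t, ak⟩ := S.mem_Ext.1 hp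
    have aa := S.stepA hpU ak (K := K) om
    have ad := ih (U := U.erase p) (by rw [card_erase_of_mem hpU]; omega) hp4
    unfold Tb at *
    rw [sum_range_succ]; omega

lemma Ext_ge3 (hn : 3 ≤ U.card) : 3 ≤ (S.Ext U).card := by
  by_contra hc
  have hfirst : ∀ t x, x ∈ U → Rk U t x = 0 → x ∈ S.Ext U := fun t x a b => S.mem_Ext.2 ⟨a, t, b⟩
  have hlast : ∀ t x, x ∈ U → Rk U t x + 1 = U.card → x ∈ S.Ext U := fun t x a b =>
    S.mem_Ext.2 ⟨a, t + NN, by have := S.rk_flip (t := t) a; omega⟩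
  have hE : ∀ t x, x ∈ S.Ext U → Rk U t x = 0 ∨ Rk U t x + 1 = U.card := by
    intro t x hx
    by_contra hcc
    obtain ⟨p, hpU, hp⟩ := S.exists_rk (U := U) (t := t) (i := 0) om
    obtain ⟨q, hqU, hq⟩ := S.exists_rk (U := U) (t := t) (i := U.card - 1) om
    have af : ({p, q, x} : Finset V).card = 3 := by
      apply card_eq_three.2
      refine ⟨p, q, x, ?_, ?_, ?_, rfl⟩ <;> rintro rfl <;> omega
    have : ({p, q, x} : Finset V) ⊆ S.Ext U := by
      intro z; simp only [mem_insert, mem_singleton]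
      rintro (rfl | rfl | rfl)
      · exact hfirst t _ hpU hp
      · exact hlast t _ hqU om
      · exact hx
    have := card_le_card this
    omega
  obtain ⟨p, hpU, hp⟩ := S.exists_rk (U := U) (t := 0) (i := 0) om
  have hpE := hfirst _ _ hpU hp
  have : ∀ t, Rk U t p = 0 := by
    intro t
    induction t with
    | zero => exact hp
    | succ t ih => have := S.rk_lip U t p; have := hE (t+1) p hpE; omega
  have aa := this (0+NN)
  have := S.rk_flip (t := 0) hpU
  omega

def fs (U : Finset V) (t : ℕ) (x : V) : Prop := ∀ z ∈ U, z ≠ x → ps t x < ps t z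
def ls (U : Finset V) (t : ℕ) (x : V) : Prop := ∀ z ∈ U, z ≠ x → ps t z < ps t x

lemma fs_of_rk {t x} (h : Rk U t x = 0) : S.fs U t x := by
  intro z hz hne
  have := S.pos_ne (t := t) hne
  by_contra hc
  have := S.rg (U := U) (t := t) (x := z) (y := x) hz om
  omega

lemma ls_of_rk {t x} (hx : x ∈ U) (h : Rk U t x + 1 = U.card) : S.ls U t x := by
  intro z hz hne
  have := S.fs_of_rk (U := U) (t := t+NN) (x := x) (by have := S.rk_flip (t := t) hx; omega) z hz hne
  rwa [S.flip_lt] at this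

lemma fs_flip {t x} (h : S.fs U t x) : S.ls U (t+NN) x := by
  intro z hz hne; rw [S.flip_lt]; exact h z hz hne
lemma ls_flip {t x} (h : S.ls U t x) : S.fs U (t+NN) x := by
  intro z hz hne; rw [S.flip_lt]; exact h z hz hne

lemma rl {U Ua : Finset V} {t x} (h : S.fs U t x) (hU : Ua ⊆ U) : Rk Ua t x = 0 := by
  unfold rk; rw [card_eq_zero, filter_eq_empty_iff]
  intro z hz hc
  by_cases hne : z = x
  · subst hne; omega
  · have := h z (hU hz) hne; omega

lemma rn {U Ua : Finset V} {t x} (h : S.ls U t x) (hU : Ua ⊆ U) (hx : x ∉ Ua) : Rk Ua t x = Ua.card := by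
  unfold rk; congr 1; rw [Finset.filter_eq_self]
  intro z hz
  exact h z (hU hz) (by rintro rfl; exact hx hz)

lemma rk_between {s t sk x} (aa : s ≤ t) (ad : t ≤ sk) (af : sk ≤ s + NN)
    (h : ∀ z ∈ U, ps s z < ps s x → ps sk z < ps sk x) : Rk U s x ≤ Rk U t x := by
  apply card_le_card
  intro z; simp only [mem_filter]; rintro ⟨a, b⟩
  exact ⟨a, S.btw s t sk _ _ aa ad af b (h z a b)⟩

lemma rk_between' {s t sk x} (aa : s ≤ t) (ad : t ≤ sk) (af : sk ≤ s + NN)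
    (h : ∀ z ∈ U, ps sk z < ps sk x → ps s z < ps s x) : Rk U sk x ≤ Rk U t x := by
  apply card_le_card
  intro z; simp only [mem_filter]; rintro ⟨a, b⟩
  exact ⟨a, S.btw s t sk _ _ aa ad af (h z a b) b⟩

lemma rk_between2 {s t sk x} (aa : s ≤ t) (ad : t ≤ sk) (af : sk ≤ s + NN) (hx : x ∉ U)
    (h : ∀ z ∈ U, ps s x < ps s z → ps sk x < ps sk z) : Rk U t x ≤ Rk U s x := by
  apply card_le_card
  intro z; simp only [mem_filter]; rintro ⟨a, b⟩
  refine ⟨a, ?_⟩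
  by_contra hc
  have hne : z ≠ x := by rintro rfl; exact hx a
  have ag := S.pos_ne (t := s) hne
  have ah : ps s x < ps s z := om
  have := S.btw s t sk _ _ aa ad af ah (h z a ah)
  omega

lemma rk_between2' {s t sk x} (aa : s ≤ t) (ad : t ≤ sk) (af : sk ≤ s + NN) (hx : x ∉ U)
    (h : ∀ z ∈ U, ps sk x < ps sk z → ps s x < ps s z) : Rk U t x ≤ Rk U sk x := by
  apply card_le_card
  intro z; simp only [mem_filter]; rintro ⟨a, b⟩
  refine ⟨a, ?_⟩
  by_contra hc
  have hne : z ≠ x := by rintro rfl; exact hx a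
  have ag := S.pos_ne (t := sk) hne
  have ah : ps sk x < ps sk z := om
  have := S.btw s t sk _ _ aa ad af (h z a ah) ah
  omega

structure TB (U : Finset V) (p q r : V) (k sd sf sg : ℕ) : Prop where
  hp : p ∈ U
  hq : q ∈ U
  hr : r ∈ U
  hpq : p ≠ q
  hpr : p ≠ r
  hqr : q ≠ r
  exu : ∀ t x, x ∈ U → S.rk U t x = 0 → x = p ∨ x = q ∨ x = r
  pE : ∃ t, S.rk U t p = 0
  qE : ∃ t, S.rk U t q = 0
  rE : ∃ t, S.rk U t r = 0
  au : sd < sf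
  ao : sf < sg
  am : sg < sd + S.N
  fa : S.fs U sd q
  lb : S.ls U sd r
  ma : k ≤ S.rk (((U.erase p).erase q).erase r) sd p
  mg : S.rk (((U.erase p).erase q).erase r) sd p + k ≤ (((U.erase p).erase q).erase r).card
  fb : S.fs U sf q
  lh : S.ls U sf p
  mc : k ≤ S.rk (((U.erase p).erase q).erase r) sf r
  mh : S.rk (((U.erase p).erase q).erase r) sf r + k ≤ (((U.erase p).erase q).erase r).card
  fc : S.fs U sg r
  lj : S.ls U sg p
  md : k ≤ S.rk (((U.erase p).erase q).erase r) sg q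
  mj : S.rk (((U.erase p).erase q).erase r) sg q + k ≤ (((U.erase p).erase q).erase r).card

lemma exists_TB {k} (hE : (S.Ext U).card = 3) (hk : 1 ≤ k) (hn : 2*k + 3 ≤ U.card) :
    ∃ p q r sd sf sg, S.TB U p q r k sd sf sg := by
  obtain ⟨p, hpE⟩ : (S.Ext U).Nonempty := card_pos.1 om
  obtain ⟨hp, tc, ak⟩ := S.mem_Ext.1 hpE
  have hfirst : ∀ t x, x ∈ U → Rk U t x = 0 → x ∈ S.Ext U := fun t x a b => S.mem_Ext.2 ⟨a, t, b⟩
  have hlast : ∀ t x, x ∈ U → Rk U t x + 1 = U.card → x ∈ S.Ext U := fun t x a b =>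
    S.mem_Ext.2 ⟨a, t + NN, by have := S.rk_flip (t := t) a; omega⟩
  have hEU : S.Ext U ⊆ U := fun x hx => (S.mem_Ext.1 hx).1
  set Ua := U \ S.Ext U with ay
  have hU'U : Ua ⊆ U := Finset.sdiff_subset
  have dc : Ua.card + 3 = U.card := by
    have := card_sdiff_add_card_inter U (S.Ext U)
    rw [Finset.inter_eq_right.2 hEU, hE] at this
    exact this
  have hnot : ∀ x ∈ S.Ext U, x ∉ Ua := by intro x hx; simp [ay, hx]
  have fp : S.fs U tc p := S.fs_of_rk ak
  obtain ⟨sd, hs1, hs2, -, -, hs⟩ := S.cross_up (U := Ua) (p := p) (s := tc) (sk := tc+NN) (g := k)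
    om (by rw [S.rl fp hU'U]; omega)
    (by rw [S.rn (S.fs_flip fp) hU'U (hnot p hpE)]; omega)
  obtain ⟨q, hq, hq0⟩ := S.exists_rk (U := U) (t := sd) (i := 0) om
  obtain ⟨r, hr, hr0⟩ := S.exists_rk (U := U) (t := sd) (i := U.card-1) om
  have hqE := hfirst _ _ hq hq0
  have hrE := hlast sd _ hr om
  have fa := S.fs_of_rk hq0
  have lb := S.ls_of_rk (t := sd) hr om
  have rq := S.rl fa hU'U
  have rr := S.rn lb hU'U (hnot r hrE)
  have hpq : p ≠ q := by rintro rfl; omega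
  have hpr : p ≠ r := by rintro rfl; omega
  have hqr : q ≠ r := by rintro rfl; omega
  have hEeq : S.Ext U = {p, q, r} := by
    symm; apply eq_of_subset_of_card_le
    · intro z; simp only [mem_insert, mem_singleton]
      rintro (rfl | rfl | rfl) <;> assumption
    · rw [hE, card_eq_three.2 ⟨p, q, r, hpq, hpr, hqr, rfl⟩]
  have hUe : ((U.erase p).erase q).erase r = Ua := by
    ext z; simp only [mem_erase, ay, mem_sdiff, hEeq, mem_insert, mem_singleton]; tauto
  have exu : ∀ t x, x ∈ U → Rk U t x = 0 → x = p ∨ x = q ∨ x = r := by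
    intro t x hx h
    have := hfirst t x hx h
    rw [hEeq] at this; simpa using this
  have extl : ∀ t x, x ∈ U → Rk U t x + 1 = U.card → x = p ∨ x = q ∨ x = r := by
    intro t x hx h
    have := hlast t x hx h
    rw [hEeq] at this; simpa using this
  have fl : ∀ t, (∃ x, (x = p ∨ x = q ∨ x = r) ∧ S.fs U t x) ∧ (∃ x, (x = p ∨ x = q ∨ x = r) ∧ S.ls U t x) := by
    intro t
    obtain ⟨x, hx, hx0⟩ := S.exists_rk (U := U) (t := t) (i := 0) om
    obtain ⟨y, hy, hy0⟩ := S.exists_rk (U := U) (t := t) (i := U.card-1) om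
    exact ⟨⟨x, exu t x hx hx0, S.fs_of_rk hx0⟩, ⟨y, extl t y hy om, S.ls_of_rk hy om⟩⟩
  have hnp := hnot p hpE
  have hnq := hnot q hqE
  have hnr := hnot r hrE
  obtain ⟨sf, hs21, hs22, hv2, hu2, hr2⟩ := S.cross_down (U := Ua) (p := r) (s := sd) (sk := sd+NN) (g := k)
    om om (by rw [S.rl (S.ls_flip lb) hU'U]; omega)
  have hr2' : Rk Ua (sf+1) r = k := by
    have := S.rk_v' (U := Ua) (t := sf); rw [hv2] at this; omega
  obtain ⟨sg, hs31, hs32, -, -, hq3⟩ := S.cross_up (U := Ua) (p := q) (s := sd) (sk := sd+NN) (g := k)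
    om om (by rw [S.rn (S.fs_flip fa) hU'U hnq]; omega)
  have lpN := S.fs_flip fp
  have hqp : ∀ t, sd ≤ t → t ≤ tc+NN → ps t q < ps t p := fun t a b =>
    S.btw sd t (tc+NN) q p a b om (fa p hp hpq) (lpN q hq (Ne.symm hpq))
  have hrp : ∀ t, tc+NN ≤ t → t ≤ sd+NN → ps t r < ps t p := fun t a b =>
    S.btw (tc+NN) t (sd+NN) r p a b om (lpN r hr (Ne.symm hpr)) (by
      rw [S.flip_lt]; exact lb p hp hpr)
  have hnof : ∀ t, sd ≤ t → t ≤ sd+NN → ¬ S.fs U t p := by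
    intro t a b hf
    rcases le_total t (tc+NN) with h | h
    · have := hqp t a h; have := hf q hq (Ne.symm hpq); omega
    · have := hrp t h b; have := hf r hr (Ne.symm hpr); omega
  have fb : S.fs U (sf+1) q := by
    obtain ⟨⟨x, hx, hfx⟩, -⟩ := fl (sf+1)
    rcases hx with rfl | rfl | rfl
    · exact absurd hfx (hnof _ om om)
    · exact hfx
    · rw [S.rl hfx hU'U] at hr2'; omega
  have lh : S.ls U (sf+1) p := by
    obtain ⟨-, ⟨x, hx, hfx⟩⟩ := fl (sf+1)
    rcases hx with rfl | rfl | rfl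
    · exact hfx
    · have := fb p hp hpq; have := hfx p hp hpq; omega
    · rw [S.rn hfx hU'U hnr] at hr2'; omega
  have fc : S.fs U sg r := by
    obtain ⟨⟨x, hx, hfx⟩, -⟩ := fl sg
    rcases hx with rfl | rfl | rfl
    · exact absurd hfx (hnof _ om om)
    · rw [S.rl hfx hU'U] at hq3; omega
    · exact hfx
  have lj : S.ls U sg p := by
    obtain ⟨-, ⟨x, hx, hfx⟩⟩ := fl sg
    rcases hx with rfl | rfl | rfl
    · exact hfx
    · rw [S.rn hfx hU'U hnq] at hq3; omega
    · have := fc p hp hpr; have := hfx p hp hpr; omega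
  have ao : sf + 1 < sg := by
    by_contra hc
    have := S.btw sd sg (sf+1) q r hs31 om om (fa r hr (Ne.symm hqr)) (fb r hr (Ne.symm hqr))
    have := fc q hq hqr
    omega
  rw [← hUe] at hs hr2' hq3 dc
  exact ⟨p, q, r, sd, sf+1, sg, hp, hq, hr, hpq, hpr, hqr, exu, ⟨tc, ak⟩, ⟨sd, hq0⟩, (S.mem_Ext.1 hrE).2,
    by omega, ao, hs32, fa, lb, om, om, fb, lh, om, om, fc, lj, om, om⟩

lemma window {P : ℕ → Prop} [DecidablePred P] (hP : Function.Periodic P NN) (s sk : ℕ) :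
    ((Ico s (s+NN)).filter P).card = ((Ico sk (sk+NN)).filter P).card := by
  rw [Nat.filter_Ico_card_eq_of_periodic _ _ _ hP, Nat.filter_Ico_card_eq_of_periodic _ _ _ hP]

lemma pass3 {p K} (s : ℕ) (hp : p ∈ U) (ak : ∃ t, Rk U t p = 0) (h : 2*K ≤ U.card - 1) :
    2*K ≤ ((Ico s (s+NN)).filter fun t => (Uu t = p ∨ Vv t = p) ∧ S.pr U K t).card := by
  obtain ⟨tc, ak⟩ := ak
  rw [S.window (sk := tc)]
  · refine le_trans (S.pass2 hp ak h) (card_le_card ?_)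
    intro t; rw [mem_filter, mem_filter]
    rintro ⟨a, b, c⟩; exact ⟨a, Or.inl b, c⟩
  · intro t
    apply propext
    have := S.pr_periodic U K t
    beta_reduce
    rw [this, (S.uN t).1, (S.uN t).2, or_comm]

lemma inter_le_one {p q : V} (hpq : p ≠ q) (s : ℕ) (Q : ℕ → Prop) [DecidablePred Q] :
    ((Ico s (s+NN)).filter fun t => (Uu t = p ∨ Vv t = p) ∧ (Uu t = q ∨ Vv t = q)).card ≤ 1 := by
  rw [Finset.card_le_one]
  intro a ha b hb
  rw [mem_filter, mem_Ico] at ha hb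
  by_contra hne
  have h : ∀ t, ((Uu t = p ∨ Vv t = p) ∧ (Uu t = q ∨ Vv t = q)) → (Uu t = p ∧ Vv t = q) ∨ (Uu t = q ∧ Vv t = p) := by
    intro t; grind
  have aa := h a ha.2
  have ad := h b hb.2
  rcases lt_or_gt_of_ne hne with hl | hl
  · exact S.swap_unique a b hl om (by grind)
  · exact S.swap_unique b a hl om (by grind)

set_option maxHeartbeats 2000000 in
lemma stepB {p q r K sd sf sg} (h : S.TB U p q r (K+1) sd sf sg) (Ua : Finset V)
    (ay : Ua = ((U.erase p).erase q).erase r) (hn : 2*K + 5 ≤ U.card) :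
    6*K+9 + S.EL Ua K + (Ls Ua (K+1) sf \ Ls Ua (K+1) sd).card +
    (Ls Ua (Ua.card-(K+1)) sf \ Ls Ua (Ua.card-(K+1)) sg).card +
    (Ls Ua (K+1) (sd+NN) \ Ls Ua (K+1) sg).card ≤ S.EL U (K+2) := by
  obtain ⟨hp, hq, hr, hpq, hpr, hqr, exu, pE, qE, rE, au, ao, am, fa, lb, ma, mg, fb, lh, mc, mh,
    fc, lj, md, mj⟩ := h
  rw [← ay] at ma mg mc mh md mj
  have dc : Ua.card + 3 = U.card := by
    rw [ay, card_erase_of_mem, card_erase_of_mem, card_erase_of_mem hp]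
    · omega
    · simp [hq, Ne.symm hpq]
    · simp [hr, Ne.symm hpr, Ne.symm hqr]
  have hmem : ∀ x, x ∈ Ua ↔ x ≠ p ∧ x ≠ q ∧ x ≠ r ∧ x ∈ U := by
    intro x; rw [ay]; simp only [mem_erase]; tauto
  have hU'U : Ua ⊆ U := fun x hx => ((hmem x).1 hx).2.2.2
  have hrk : ∀ t x, Rk U t x = Rk Ua t x + (if ps t p < ps t x then 1 else 0)
     + (if ps t q < ps t x then 1 else 0) + (if ps t r < ps t x then 1 else 0) := by
    intro t x
    rw [S.rk_erase x hp, S.rk_erase (p := q) (U := U.erase p) x (by simp [hq, Ne.symm hpq]),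
      S.rk_erase (p := r) (U := (U.erase p).erase q) x (by simp [hr, Ne.symm hpr, Ne.symm hqr]), ← ay]
    omega
  have ha1 : ∀ t x, x ∈ Ua → Rk Ua t x + 1 ≤ Rk U t x := by
    intro t x hx
    obtain ⟨y, hy, hy0⟩ := S.exists_rk (U := U) (t := t) (i := 0) om
    have hfy := S.fs_of_rk hy0
    have az := (hmem x).1 hx
    rw [hrk t x]
    rcases exu t y hy hy0 with rfl | rfl | rfl
    · rw [if_pos (hfy x az.2.2.2 az.1)]; omega
    · rw [if_pos (hfy x az.2.2.2 az.2.1)]; omega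
    · rw [if_pos (hfy x az.2.2.2 az.2.2.1)]; omega
  have ha2 : ∀ t x, x ∈ Ua → Rk U t x ≤ Rk Ua t x + 2 := by
    intro t x hx
    have aa := ha1 (t+NN) x hx
    have ad := S.rk_flip (t := t) hx
    have af := S.rk_flip (t := t) (hU'U hx)
    omega
  have np : p ∉ Ua := by simp [hmem]
  have nq : q ∉ Ua := by simp [hmem]
  have nr : r ∉ Ua := by simp [hmem]
  have fsU' : ∀ t x, S.fs U t x → x ∉ Ua → ∀ z ∈ Ua, ps t x < ps t z := by
    intro t x hf hx z hz; exact hf z (hU'U hz) (by rintro rfl; exact hx hz)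
  have lm : ∀ t x, S.ls U t x → x ∉ Ua → ∀ z ∈ Ua, ps t z < ps t x := by
    intro t x hf hx z hz; exact hf z (hU'U hz) (by rintro rfl; exact hx hz)
  have l1N := S.ls_flip lb
  have f1N := S.fs_flip fa
  have not_before : ∀ t x y, Rk Ua t y + 1 = K+1 → K + 1 ≤ Rk Ua t x → ¬ ps t x < ps t y := by
    intro t x y aa ad af
    have := S.rk_mono (U := Ua) (t := t) af.le; omega
  have P1 : ∀ t, sd ≤ t → t < sf → S.gate Ua (K+1) t → Rk U t (Uu t) ≤ K+1 := by
    rintro t aa ad ⟨a, b, c⟩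
    have eg : K+1 ≤ Rk Ua t p := le_trans ma (S.rk_between aa ad.le om fun z hz _ => lm _ _ lh np z hz)
    have eb : K+1 ≤ Rk Ua t r := le_trans mc (S.rk_between' aa ad.le om fun z hz _ => lm _ _ lb nr z hz)
    rw [hrk, if_neg (not_before t p _ c eg), if_neg (not_before t r _ c eb)]
    split_ifs <;> omega
  have P3 : ∀ t, sg ≤ t → t < sd+NN → S.gate Ua (K+1) t → Rk U t (Uu t) ≤ K+1 := by
    rintro t aa ad ⟨a, b, c⟩
    have eo : K+1 ≤ Rk Ua (sd+NN) p := by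
      have : Rk Ua (sd+NN) p + Rk Ua sd p = Ua.card := by
        unfold rk
        have := Finset.card_filter_add_card_filter_not (s := Ua) (fun z => ps sd z < ps sd p)
        rw [← this, add_comm]; congr 2
        ext z; simp only [mem_filter, S.flip_lt]
        by_cases hz : z ∈ Ua
        · have hne : z ≠ p := by rintro rfl; exact np hz
          have := S.pos_ne (t := sd) hne
          simp only [hz, true_and]; omega
        · simp [hz]
      omega
    have eg : K+1 ≤ Rk Ua t p := le_trans eo (S.rk_between' aa ad.le om fun z hz _ => lm _ _ lj np z hz)
    have eb : K+1 ≤ Rk Ua t q := le_trans md (S.rk_between aa ad.le om fun z hz _ => lm _ _ f1N nq z hz)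
    rw [hrk, if_neg (not_before t p _ c eg), if_neg (not_before t q _ c eb)]
    split_ifs <;> omega
  have P2 : ∀ t, sf ≤ t → t < sg → S.gate Ua (Ua.card-(K+1)) t → Rk Ua t (Uu t) + 2 ≤ Rk U t (Uu t) := by
    rintro t aa ad ⟨a, b, c⟩
    have eg : Rk Ua t q ≤ Rk Ua sg q :=
      S.rk_between2' aa ad.le om nq fun z hz _ => fsU' _ _ fb nq z hz
    have eb : Rk Ua t r ≤ Rk Ua sf r :=
      S.rk_between2 aa ad.le om nr fun z hz _ => fsU' _ _ fc nr z hz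
    have key : ∀ x, x ∉ Ua → Rk Ua t x + (K+1) ≤ Ua.card → ps t x < ps t (Uu t) := by
      intro x hx ag
      by_contra hc
      have hxu : Uu t ≠ x := by rintro rfl; exact hx a
      have hxv : Vv t ≠ x := by rintro rfl; exact hx b
      have := S.pos_ne (t := t) hxu
      have := S.pos_ne (t := t) hxv
      have := S.huv t
      have ah := S.rg (U := Ua) (t := t) (x := Vv t) (y := x) b om
      have bx := S.rj (U := Ua) (t := t)
      rw [if_pos a] at bx
      omega
    rw [hrk, if_pos (key q nq om), if_pos (key r nr om)]
    omega
  set W := Ico sd (sd+NN) with hW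
  have bp := S.pass3 sd hp pE (K := K+2) om
  have bq := S.pass3 sd hq qE (K := K+2) om
  have br := S.pass3 sd hr rE (K := K+2) om
  have ip := S.inter_le_one hpq sd (fun _ => True)
  have iq := S.inter_le_one hpr sd (fun _ => True)
  have ir := S.inter_le_one hqr sd (fun _ => True)
  rw [← hW] at bp bq br ip iq ir
  have gb := S.gate_lemma (U := Ua) (K := K+1) au.le
  have gf := S.gate_lemma' (U := Ua) (K := Ua.card - (K+1)) ao.le om
  have ga := S.gate_lemma (U := Ua) (K := K+1) am.le
  unfold G at gb gf ga
  rw [← S.EL_window U (K+2) sd, ← S.EL_window Ua K sd, ← hW]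
  set A := W.filter fun t => (Uu t = p ∨ Vv t = p) ∧ S.pr U (K+2) t with hA
  set B := W.filter fun t => (Uu t = q ∨ Vv t = q) ∧ S.pr U (K+2) t with hB
  set C := W.filter fun t => (Uu t = r ∨ Vv t = r) ∧ S.pr U (K+2) t with hC
  set D := W.filter fun t => S.pr Ua K t with hD
  set Ea := (Ico sd sf).filter fun t => S.gate Ua (K+1) t with dl
  set Eb := (Ico sf sg).filter fun t => S.gate Ua (Ua.card-(K+1)) t with dm
  set Ec := (Ico sg (sd+NN)).filter fun t => S.gate Ua (K+1) t with hE3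
  set T := W.filter fun t => S.pr U (K+2) t with hT
  have cc := Finset.card_union_add_card_inter A B
  have cd := Finset.card_union_add_card_inter (A ∪ B) C
  have cf : ((A ∪ B) ∩ C).card ≤ (A ∩ C).card + (B ∩ C).card := by
    rw [Finset.union_inter_distrib_right]; exact card_union_le _ _
  have cm : (A ∩ B).card ≤ 1 := le_trans (card_le_card (by
    intro t; rw [mem_inter, hA, hB, mem_filter, mem_filter, mem_filter]; tauto)) ip
  have cj : (A ∩ C).card ≤ 1 := le_trans (card_le_card (by
    intro t; rw [mem_inter, hA, hC, mem_filter, mem_filter, mem_filter]; tauto)) iq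
  have ci : (B ∩ C).card ≤ 1 := le_trans (card_le_card (by
    intro t; rw [mem_inter, hB, hC, mem_filter, mem_filter, mem_filter]; tauto)) ir
  have df : (Ea ∪ Eb).card = Ea.card + Eb.card := card_union_of_disjoint (by
    rw [Finset.disjoint_left]; intro t; rw [dl, dm, mem_filter, mem_filter, mem_Ico, mem_Ico]
    rintro ⟨a, _⟩ ⟨b, _⟩; omega)
  have dh : (Ea ∪ Eb ∪ Ec).card = (Ea ∪ Eb).card + Ec.card := card_union_of_disjoint (by
    rw [Finset.disjoint_left]; intro t
    rw [mem_union, dl, dm, hE3, mem_filter, mem_filter, mem_filter, mem_Ico, mem_Ico, mem_Ico]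
    rintro (⟨a, _⟩ | ⟨a, _⟩) ⟨b, _⟩ <;> omega)
  have inU' : ∀ t, t ∈ Ea ∪ Eb ∪ Ec → t ∈ W ∧ Uu t ∈ Ua ∧ Vv t ∈ Ua ∧ (Rk Ua t (Uu t) = K ∨ Rk Ua t (Uu t) + 1 + (K+1) = Ua.card) := by
    intro t
    rw [mem_union, mem_union, dl, dm, hE3, mem_filter, mem_filter, mem_filter, mem_Ico, mem_Ico, mem_Ico, hW, mem_Ico]
    rintro ((⟨a, b, c, d⟩ | ⟨a, b, c, d⟩) | ⟨a, b, c, d⟩)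
    · exact ⟨om, b, c, om⟩
    · exact ⟨om, b, c, om⟩
    · exact ⟨om, b, c, om⟩
  have d3 : (D ∪ (Ea ∪ Eb ∪ Ec)).card = D.card + (Ea ∪ Eb ∪ Ec).card := card_union_of_disjoint (by
    rw [Finset.disjoint_left]; intro t ht bn
    obtain ⟨_, _, _, ag⟩ := inU' t bn
    rw [hD, mem_filter] at ht
    obtain ⟨_, _, _, ah⟩ := ht
    omega)
  have d4 : ((A ∪ B ∪ C) ∪ (D ∪ (Ea ∪ Eb ∪ Ec))).card = (A ∪ B ∪ C).card + (D ∪ (Ea ∪ Eb ∪ Ec)).card :=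
    card_union_of_disjoint (by
    rw [Finset.disjoint_left]; intro t ht bn
    have hu : Uu t ∈ Ua ∧ Vv t ∈ Ua := by
      rw [mem_union] at bn
      rcases bn with h | h
      · rw [hD, mem_filter] at h; exact ⟨h.2.1, h.2.2.1⟩
      · have := inU' t h; exact ⟨this.2.1, this.2.2.1⟩
    rw [hmem, hmem] at hu
    rw [mem_union, mem_union, hA, hB, hC, mem_filter, mem_filter, mem_filter] at ht
    tauto)
  have hsub : (A ∪ B ∪ C) ∪ (D ∪ (Ea ∪ Eb ∪ Ec)) ⊆ T := by
    intro t ht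
    rw [mem_union] at ht
    rcases ht with ht | ht
    · rw [mem_union, mem_union, hA, hB, hC, mem_filter, mem_filter, mem_filter] at ht
      rw [hT, mem_filter]; tauto
    · rw [mem_union] at ht
      rw [hT, mem_filter]
      rcases ht with ht | ht
      · rw [hD, mem_filter] at ht
        obtain ⟨a, b, c, d⟩ := ht
        have := ha1 t _ b; have := ha2 t _ b
        exact ⟨a, hU'U b, hU'U c, om⟩
      · obtain ⟨a, b, c, -⟩ := inU' t ht
        refine ⟨a, hU'U b, hU'U c, ?_⟩
        rw [mem_union, mem_union, dl, dm, hE3, mem_filter, mem_filter, mem_filter, mem_Ico, mem_Ico, mem_Ico] at ht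
        rcases ht with (⟨d, e⟩ | ⟨d, e⟩) | ⟨d, e⟩
        · have := P1 t d.1 d.2 e; omega
        · have := P2 t d.1 d.2 e; have := e.2.2; omega
        · have := P3 t d.1 d.2 e; omega
  have := card_le_card hsub
  omega

lemma TB_U' {p q r k sd sf sg} (hE : (S.Ext U).card = 3) (h : S.TB U p q r k sd sf sg) :
    U \ S.Ext U = ((U.erase p).erase q).erase r := by
  have af : S.Ext U = {p, q, r} := by
    symm
    apply eq_of_subset_of_card_le
    · intro x; simp only [mem_insert, mem_singleton, mem_Ext]
      rintro (rfl | rfl | rfl)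
      · exact ⟨h.hp, h.pE⟩
      · exact ⟨h.hq, h.qE⟩
      · exact ⟨h.hr, h.rE⟩
    · rw [hE, card_eq_three.2 ⟨p, q, r, h.hpq, h.hpr, h.hqr, rfl⟩]
  ext x; rw [af]; simp only [mem_sdiff, mem_insert, mem_singleton, mem_erase]; tauto

lemma card_sdiff_Ext (hE : (S.Ext U).card = 3) : (U \ S.Ext U).card + 3 = U.card := by
  rw [← hE, Finset.card_sdiff_add_card_eq_card]
  intro x hx; exact (S.mem_Ext.1 hx).1

lemma three_disj {Ua : Finset V} {k sd sf sg} (hk : 2*k ≤ Ua.card) :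
    3*k ≤ Ua.card + (Ls Ua k sf \ Ls Ua k sd).card +
    (Ls Ua (Ua.card-k) sf \ Ls Ua (Ua.card-k) sg).card +
    (Ls Ua k (sd+NN) \ Ls Ua k sg).card := by
  have eg := card_sdiff_add_card_inter (Ls Ua k sf) (Ls Ua k sd)
  have eb := card_sdiff_add_card_inter (Ua \ Ls Ua (Ua.card-k) sg) (Ua \ Ls Ua (Ua.card-k) sf)
  have eh := card_sdiff_add_card_inter (Ls Ua k (sd+NN)) (Ls Ua k sg)
  have ew : (Ua \ Ls Ua (Ua.card-k) sg) \ (Ua \ Ls Ua (Ua.card-k) sf) =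
     Ls Ua (Ua.card-k) sf \ Ls Ua (Ua.card-k) sg := by
    ext x; simp only [mem_sdiff, mem_L]; tauto
  rw [ew] at eb
  have cf : (Ua \ Ls Ua (Ua.card-k) sg).card = k := by
    rw [← S.L_flip om, S.card_L om]
  rw [S.card_L om] at eg eh
  rw [cf] at eb
  set X := Ls Ua k sf ∩ Ls Ua k sd
  set Y := (Ua \ Ls Ua (Ua.card-k) sg) ∩ (Ua \ Ls Ua (Ua.card-k) sf)
  set Z := Ls Ua k (sd+NN) ∩ Ls Ua k sg
  have df : (X ∪ Y).card = X.card + Y.card := card_union_of_disjoint (by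
    rw [Finset.disjoint_left]; intro x hx hy
    simp only [X, Y, mem_inter, mem_sdiff, mem_L] at hx hy
    obtain ⟨⟨a, b⟩, -⟩ := hx
    obtain ⟨-, -, c⟩ := hy
    exact c ⟨a, om⟩)
  have dh : (X ∪ Y ∪ Z).card = (X ∪ Y).card + Z.card := card_union_of_disjoint (by
    rw [Finset.disjoint_left]; intro x hx hz
    simp only [X, Y, Z, mem_union, mem_inter, mem_sdiff, mem_L] at hx hz
    obtain ⟨⟨a, b⟩, -, d⟩ := hz
    have := S.rk_flip (t := sd) a
    rcases hx with ⟨-, -, e⟩ | ⟨⟨-, e⟩, -⟩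
    · omega
    · exact e ⟨a, om⟩)
  have d3 : (X ∪ Y ∪ Z).card ≤ Ua.card := card_le_card (by
    intro x hx
    simp only [X, Y, Z, mem_union, mem_inter, mem_sdiff, mem_L] at hx
    tauto)
  omega

lemma stepC {K} (hE : (S.Ext U).card = 3) (hn : 2*K+5 ≤ U.card) :
    6*K+9 + S.EL (U \ S.Ext U) K + 3*(K+1) ≤ S.EL U (K+2) + (U \ S.Ext U).card ∧
    6*K+9 + S.EL (U \ S.Ext U) K ≤ S.EL U (K+2) := by
  obtain ⟨p, q, r, sd, sf, sg, h⟩ := S.exists_TB (k := K+1) hE om om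
  have aa := S.stepB h _ (S.TB_U' hE h) hn
  have hc := S.card_sdiff_Ext hE
  have ad := S.three_disj (Ua := U \ S.Ext U) (k := K+1) (sd := sd) (sf := sf) (sg := sg) 
  by_cases af : 2*(K+1) ≤ (U \ S.Ext U).card
  · have := ad af; omega
  · omega

structure DD (A B C : Finset V) (sd sf sg : ℕ) : Prop where
  au : sd < sf
  ao : sf < sg
  am : sg < sd + S.N
  cov : ∀ x, x ∈ A ∨ x ∈ B ∨ x ∈ C
  aq : ∀ x ∈ A, S.pos sd x < 10
  bu : ∀ x ∈ B, 10 ≤ S.pos sd x ∧ S.pos sd x < 20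
  cc : ∀ x ∈ C, 20 ≤ S.pos sd x
  aj : ∀ x ∈ A, 10 ≤ S.pos sf x ∧ S.pos sf x < 20
  dj : ∀ x ∈ B, S.pos sf x < 10
  cd : ∀ x ∈ C, 20 ≤ S.pos sf x
  bg : ∀ x ∈ A, 20 ≤ S.pos sg x
  bv : ∀ x ∈ B, S.pos sg x < 10
  cf : ∀ x ∈ C, 10 ≤ S.pos sg x ∧ S.pos sg x < 20

lemma exists_DD (hV : Fintype.card V = 30) (hE : (S.Ext univ).card = 3)
    (h165 : S.EL univ 10 ≤ 165) : ∃ A B C sd sf sg, S.DD A B C sd sf sg := by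
  have hcu : (univ : Finset V).card = 30 := hV
  obtain ⟨p, q, r, sd, sf, sg, h⟩ := S.exists_TB (U := univ) (k := 9) hE om om
  have aa := S.stepB (K := 8) h _ rfl om
  have hU := S.TB_U' hE h
  have hc := S.card_sdiff_Ext hE
  rw [hU] at hc
  set Ua := (((univ : Finset V).erase p).erase q).erase r with ay
  have h108 := S.Ee (U := Ua) (K := 8) om
  have hT : Tb 8 = 108 := by decide
  rw [hT] at h108
  rw [show Ua.card - (8+1) = 18 by omega] at aa
  have za : Ls Ua 9 sf \ Ls Ua 9 sd = ∅ := by rw [← card_eq_zero]; simp only [Nat.reduceAdd] at aa; omega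
  have zb : Ls Ua 18 sf \ Ls Ua 18 sg = ∅ := by rw [← card_eq_zero]; simp only [Nat.reduceAdd] at aa; omega
  have zc : Ls Ua 9 (sd+NN) \ Ls Ua 9 sg = ∅ := by rw [← card_eq_zero]; simp only [Nat.reduceAdd] at aa; omega
  rw [Finset.sdiff_eq_empty_iff_subset] at za zb zc
  have yb : Ls Ua 9 sf = Ls Ua 9 sd := eq_of_subset_of_card_le za (by rw [S.card_L om, S.card_L om])
  have ya : Ls Ua 18 sf = Ls Ua 18 sg := eq_of_subset_of_card_le zb (by rw [S.card_L om, S.card_L om])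
  have yd : Ls Ua 9 (sd+NN) = Ls Ua 9 sg := eq_of_subset_of_card_le zc (by rw [S.card_L om, S.card_L om])
  obtain ⟨hp, hq, hr, hpq, hpr, hqr, exu, pE, qE, rE, au, ao, am, fa, lb, ma, mg, fb, lh, mc, mh,
    fc, lj, md, mj⟩ := h
  rw [← ay] at ma mg mc mh md mj
  have hmem : ∀ x, x ∈ Ua ↔ x ≠ p ∧ x ≠ q ∧ x ≠ r := by
    intro x; rw [ay]; simp only [mem_erase, mem_univ]; tauto
  have hrk : ∀ t x, ps t x = Rk Ua t x + (if ps t p < ps t x then 1 else 0)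
     + (if ps t q < ps t x then 1 else 0) + (if ps t r < ps t x then 1 else 0) := by
    intro t x
    have ah := S.rk_univ hV t x
    rw [S.rk_erase x hp, S.rk_erase (p := q) (U := univ.erase p) x (by simp [Ne.symm hpq]),
      S.rk_erase (p := r) (U := (univ.erase p).erase q) x (by simp [Ne.symm hpr, Ne.symm hqr]), ← ay] at ah
    omega
  have np : p ∉ Ua := by simp [hmem]
  have nq : q ∉ Ua := by simp [hmem]
  have nr : r ∉ Ua := by simp [hmem]
  have l1N := S.ls_flip lb
  have f1N := S.fs_flip fa
  have memQ : ∀ x, x ∈ Ua → (Rk Ua sf x < 9 ↔ Rk Ua sd x < 9) := by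
    intro x hx
    have : x ∈ Ls Ua 9 sf ↔ x ∈ Ls Ua 9 sd := by rw [yb]
    simpa [mem_L, hx] using this
  have memP : ∀ x, x ∈ Ua → (Rk Ua sf x < 18 ↔ Rk Ua sg x < 18) := by
    intro x hx
    have : x ∈ Ls Ua 18 sf ↔ x ∈ Ls Ua 18 sg := by rw [ya]
    simpa [mem_L, hx] using this
  have memR : ∀ x, x ∈ Ua → (18 ≤ Rk Ua sd x ↔ Rk Ua sg x < 9) := by
    intro x hx
    have : x ∈ Ls Ua 9 (sd+NN) ↔ x ∈ Ls Ua 9 sg := by rw [yd]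
    simp only [mem_L, hx, true_and] at this
    have := S.rk_flip (t := sd) hx
    omega
  have ordp : ∀ t x o, x ∈ Ua → o ∉ Ua → Rk Ua t x < Rk Ua t o → ps t x < ps t o := 
    fun t x o _ _ h => S.lt_of_rk h
  have ordp' : ∀ t x o, x ∈ Ua → o ∉ Ua → Rk Ua t o ≤ Rk Ua t x → ps t o < ps t x := by
    intro t x o hx ho h
    by_contra hcc
    have hne : x ≠ o := by rintro rfl; exact ho hx
    have := S.pos_ne (t := t) hne
    have := S.rg (U := Ua) hx (show ps t x < ps t o by omega)
    omega
  have eg : ∀ x ∈ Ua, ps sd x = Rk Ua sd x + 1 + (if Rk Ua sd p ≤ Rk Ua sd x then 1 else 0) := by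
    intro x hx
    have az := (hmem x).1 hx
    have gc := hrk sd x
    have gb := fa x (by simp) az.2.1
    have gf := lb x (by simp) az.2.2
    by_cases hh : Rk Ua sd p ≤ Rk Ua sd x
    · have ga := ordp' _ _ _ hx np hh
      rw [if_pos hh]; split_ifs at gc <;> omega
    · have ga := ordp sd x p hx np om
      rw [if_neg hh]; split_ifs at gc <;> omega
  have eb : ∀ x ∈ Ua, ps sf x = Rk Ua sf x + 1 + (if Rk Ua sf r ≤ Rk Ua sf x then 1 else 0) := by
    intro x hx
    have az := (hmem x).1 hx
    have gc := hrk sf x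
    have gb := fb x (by simp) az.2.1
    have gf := lh x (by simp) az.1
    by_cases hh : Rk Ua sf r ≤ Rk Ua sf x
    · have ga := ordp' _ _ _ hx nr hh
      rw [if_pos hh]; split_ifs at gc <;> omega
    · have ga := ordp sf x r hx nr om
      rw [if_neg hh]; split_ifs at gc <;> omega
  have eh : ∀ x ∈ Ua, ps sg x = Rk Ua sg x + 1 + (if Rk Ua sg q ≤ Rk Ua sg x then 1 else 0) := by
    intro x hx
    have az := (hmem x).1 hx
    have gc := hrk sg x
    have gb := fc x (by simp) az.2.2
    have gf := lj x (by simp) az.1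
    by_cases hh : Rk Ua sg q ≤ Rk Ua sg x
    · have ga := ordp' _ _ _ hx nq hh
      rw [if_pos hh]; split_ifs at gc <;> omega
    · have ga := ordp sg x q hx nq om
      rw [if_neg hh]; split_ifs at gc <;> omega
  have sp : ∀ t x, x ∈ Ua → Rk Ua t x < 27 := by
    intro t x hx; have := S.rk_lt_card (t := t) hx; omega
  have rb : ∀ t x, (∀ z, z ≠ x → ps t x < ps t z) → ps t x = 0 := by
    intro t x hh
    rw [← S.rk_univ hV]; exact S.rl (U := univ) (fun z _ => hh z) (fun _ h => h)
  have rc : ∀ t x, (∀ z, z ≠ x → ps t z < ps t x) → ps t x = 29 := by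
    intro t x hh
    have hf := S.flip t x
    have := rb (t+NN) x (fun z hz => by have := hh z hz; rw [S.flip_lt]; exact this)
    omega
  have pq1 : ps sd q = 0 := rb _ _ fun z hz => fa z (by simp) hz
  have pr1 : ps sd r = 29 := rc _ _ fun z hz => lb z (by simp) hz
  have pq2 : ps sf q = 0 := rb _ _ fun z hz => fb z (by simp) hz
  have pp2 : ps sf p = 29 := rc _ _ fun z hz => lh z (by simp) hz
  have pr3 : ps sg r = 0 := rb _ _ fun z hz => fc z (by simp) hz
  have pp3 : ps sg p = 29 := rc _ _ fun z hz => lj z (by simp) hz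
  have pp1 : ps sd p = Rk Ua sd p + 1 := by
    rw [hrk sd p, pq1, pr1]
    have := lb p (by simp) hpr; have := fa p (by simp) hpq
    rw [if_neg om, if_pos om, if_neg om]
  have pr2 : ps sf r = Rk Ua sf r + 1 := by
    rw [hrk sf r, pq2, pp2]
    have := lh r (by simp) hpr.symm; have := fb r (by simp) hqr.symm
    rw [if_neg om, if_pos om, if_neg om]
  have pq3 : ps sg q = Rk Ua sg q + 1 := by
    rw [hrk sg q, pr3, pp3]
    have := lj q (by simp) hpq.symm; have := fc q (by simp) hqr
    rw [if_neg om, if_neg om, if_pos om]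
  clear yb ya yd za zb zc aa hrk ordp ordp' rb rc l1N f1N exu fa fb fc lb lh lj
  have tri : ∀ x ∈ Ua, (Rk Ua sf x < 9) ∨ (18 ≤ Rk Ua sf x) ∨ (Rk Ua sg x < 9) := by
    set X := Ls Ua 9 sf
    set Y := Ua \ Ls Ua 18 sf
    set Z := Ls Ua 9 sg
    have hX : X.card = 9 := S.card_L om
    have hY : Y.card = 9 := by
      have := S.L_flip (U := Ua) (K := 9) (t := sf) om
      rw [show Ua.card - 9 = 18 by omega] at this
      rw [show Y = Ls Ua 9 (sf + NN) from this.symm]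
      exact S.card_L om
    have hZ : Z.card = 9 := S.card_L om
    have df : (X ∪ Y).card = X.card + Y.card := card_union_of_disjoint (by
      rw [Finset.disjoint_left]; intro x hx hy
      simp only [X, Y, mem_sdiff, mem_L] at hx hy
      exact hy.2 ⟨hx.1, om⟩)
    have dh : (X ∪ Y ∪ Z).card = (X ∪ Y).card + Z.card := card_union_of_disjoint (by
      rw [Finset.disjoint_left]; intro x hx hz
      simp only [X, Y, Z, mem_union, mem_sdiff, mem_L] at hx hz
      have aq := memQ x hz.1; have aj := memP x hz.1; have bg := memR x hz.1
      rcases hx with h | h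
      · omega
      · exact h.2 ⟨hz.1, om⟩)
    have hall : X ∪ Y ∪ Z = Ua := by
      apply eq_of_subset_of_card_le
      · intro x hx
        simp only [X, Y, Z, mem_union, mem_sdiff, mem_L] at hx
        tauto
      · omega
    intro x hx
    have az := hx
    rw [← hall] at az
    simp only [X, Y, Z, mem_union, mem_sdiff, mem_L, hx, true_and] at az
    omega
  have full : ∀ x ∈ Ua, (Rk Ua sf x < 9 ∧ Rk Ua sd x < 9 ∧ 9 ≤ Rk Ua sg x ∧ Rk Ua sg x < 18) ∨
     (18 ≤ Rk Ua sf x ∧ 18 ≤ Rk Ua sg x ∧ 9 ≤ Rk Ua sd x ∧ Rk Ua sd x < 18) ∨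
     (Rk Ua sg x < 9 ∧ 18 ≤ Rk Ua sd x ∧ 9 ≤ Rk Ua sf x ∧ Rk Ua sf x < 18) := by
    intro x hx
    have aq := memQ x hx; have aj := memP x hx; have bg := memR x hx; have dn := tri x hx
    omega
  have hxx : ∀ x, x = p ∨ x = q ∨ x = r ∨ x ∈ Ua := by intro x; rw [hmem]; tauto
  have hfl : ∀ x, ps (sd+NN) x = 29 - ps sd x := by intro x; have := S.flip sd x; omega
  refine ⟨univ.filter fun x => ps sf x < 10, univ.filter fun x => ps sg x < 10,
    univ.filter fun x => 20 ≤ ps sf x, sf, sg, sd+NN, ?_⟩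
  have key : ∀ x, (ps sf x < 10 ∧ 10 ≤ ps sg x ∧ ps sg x < 20 ∧ ps sd x < 10) ∨
    (ps sg x < 10 ∧ 10 ≤ ps sf x ∧ ps sf x < 20 ∧ 20 ≤ ps sd x) ∨
    (20 ≤ ps sf x ∧ 20 ≤ ps sg x ∧ 10 ≤ ps sd x ∧ ps sd x < 20) := by
    intro x
    rcases hxx x with rfl | rfl | rfl | hx
    · omega
    · omega
    · omega
    · have gb := eg x hx; have gf := eb x hx; have ga := eh x hx; have g4 := full x hx
      split_ifs at gb gf ga <;> omega
  refine ⟨ao, am, om, ?_, ?_, ?_, ?_, ?_, ?_, ?_, ?_, ?_, ?_⟩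
  · intro x; simp only [mem_filter, mem_univ, true_and]; have := key x; omega
  all_goals
    intro x hx
    simp only [mem_filter, mem_univ, true_and] at hx
    try rw [hfl]
    have := key x; omega

end Sq

namespace DP
inductive Tr where
  | e : Tr
  | lf : ℕ → ℕ → ℕ → Tr
  | nd : Tr → Tr → Tr

def Tr.mem (k v : ℕ) : Tr → Prop
  | .e => False
  | .lf kf _ vb => kf = k ∧ vb ≤ v
  | .nd a b => a.mem k v ∨ b.mem k v

def fT {β : Type} (t : Tr) (f : Tr → β) : β :=
  match t with
  | .e => f .e
  | .lf a b c => f (.lf a b c)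
  | .nd a b => f (.nd a b)
def fN {β : Type} (n : ℕ) (f : ℕ → β) : β :=
  match n with
  | 0 => f 0
  | n+1 => f (n+1)

lemma fd {β : Type} (t : Tr) (f : Tr → β) : fT t f = f t := by cases t <;> rfl
lemma fe {β : Type} (t : ℕ) (f : ℕ → β) : fN t f = f t := by cases t <;> rfl

def br (h : ℕ) (a b : Tr) : Tr := match Nat.mod h 2 with
  | 0 => .nd a b
  | _+1 => .nd b a

def ins : ℕ → Tr → ℕ → ℕ → ℕ → Tr
  | 0, t, k, h, v => .nd t (.lf k h v)
  | n+1, t, k, h, v => match t with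
    | .e => .lf k h v
    | .lf kf ae vb => match Nat.beq k kf with
      | true => match Nat.ble v vb with
        | true => .lf k h v
        | false => .lf k h vb
      | false => fN (Nat.div ae 2) fun ad => fN (Nat.div h 2) fun af => match Nat.beq (Nat.mod h 2) (Nat.mod ae 2) with
        | true => fT (ins n (.lf kf ad vb) k af v) fun t => br h t .e
        | false => br h (.lf k af v) (.lf kf ad vb)
    | .nd a b => fN (Nat.div h 2) fun af => match Nat.mod h 2 with
      | 0 => fT (ins n a k af v) fun t => .nd t b
      | _+1 => fT (ins n b k af v) fun t => .nd a t

lemma mem_br {h k v} {a b : Tr} (x : a.mem k v ∨ b.mem k v) : (br h a b).mem k v := by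
  unfold br; split <;> simp only [Tr.mem]
  · exact x
  · exact x.symm

lemma mem_ins (n : ℕ) : ∀ (t : Tr) (k h v : ℕ) (ka va : ℕ), (t.mem ka va ∨ (k = ka ∧ v ≤ va)) → (ins n t k h v).mem ka va := by
  induction n with
  | zero => intro t k h v ka va x; exact x
  | succ n ih =>
    intro t k h v ka va x
    unfold ins
    simp only [fe, fd]
    cases t with
    | e => simpa [Tr.mem] using x
    | lf kf ae vb =>
      simp only [Tr.mem] at x
      dsimp only
      split
      · rename_i hk
        have := Nat.eq_of_beq_eq_true hk
        split
        · rename_i hv; have := Nat.le_of_ble_eq_true hv; simp only [Tr.mem]; omega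
        · rename_i hv; have : ¬ v ≤ vb := fun q => by rw [Nat.ble_eq_true_of_le q] at hv; exact absurd hv (by simp)
          simp only [Tr.mem]; omega
      · split
        · exact mem_br (Or.inl (ih _ _ _ _ _ _ x))
        · exact mem_br x.symm
    | nd a b =>
      simp only [Tr.mem] at x
      dsimp only
      split
      · simp only [Tr.mem]
        rcases x with (x | x) | x
        · exact Or.inl (ih _ _ _ _ _ _ (Or.inl x))
        · exact Or.inr x
        · exact Or.inl (ih _ _ _ _ _ _ (Or.inr x))
      · simp only [Tr.mem]
        rcases x with (x | x) | x
        · exact Or.inl x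
        · exact Or.inr (ih _ _ _ _ _ _ (Or.inl x))
        · exact Or.inr (ih _ _ _ _ _ _ (Or.inr x))

def enc (p cg cc cd cf wb wf wc wa wd wg : ℕ) : ℕ :=
  Nat.add wb (Nat.mul 2 (Nat.add wf (Nat.mul 2 (Nat.add wc (Nat.mul 2 (Nat.add wa (Nat.mul 2 (Nat.add wd (Nat.mul 2 (Nat.add wg (Nat.mul 2 (Nat.add cg (Nat.mul 16 (Nat.add cc (Nat.mul 16 (Nat.add cd (Nat.mul 16 (Nat.add cf (Nat.mul 16 p)))))))))))))))))))

def Rok (p a b c o n : ℕ) : Bool :=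
  (Nat.ble o 3 && (Nat.ble 4 a || Nat.blt o a) && (Nat.ble 4 b || Nat.blt o b) && (Nat.ble 4 c || Nat.blt o c) &&
    (((Nat.ble a 3 || Nat.ble b 3 || Nat.ble c 3) && Nat.beq n 4) ||
      (Nat.ble 4 a && Nat.ble 4 b && Nat.ble 4 c && (Nat.beq n 6 || (Nat.beq n 5 && !Nat.beq a 5 && !Nat.beq b 5 && !Nat.beq c 5))))) ||
  (Nat.beq o 4 && Nat.ble 4 a && Nat.ble 4 b && Nat.ble 4 c && Nat.ble a 6 && Nat.ble b 6 && Nat.ble c 6 &&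
    (Nat.beq n 6 || (Nat.beq n 5 && !Nat.beq a 5 && !Nat.beq b 5 && !Nat.beq c 5) ||
      (Nat.ble 7 n && Nat.ble 5 a && Nat.ble 5 b && Nat.ble 5 c && Nat.ble 3 p))) ||
  (Nat.beq o 6 && Nat.ble 7 n && Nat.ble 5 a && Nat.ble 5 b && Nat.ble 5 c && Nat.ble 3 p &&
    (Nat.ble 7 a || Nat.ble 7 b || Nat.ble 7 c) &&
    (Nat.ble a 6 || Nat.blt n a) && (Nat.ble b 6 || Nat.blt n b) && (Nat.ble c 6 || Nat.blt n c))

def Lok (p a b c o : ℕ) : Bool := Nat.ble p 2 && Nat.beq o 5 && Nat.ble 4 a && Nat.ble 4 b && Nat.ble 4 c &&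
  Nat.ble a 6 && Nat.ble b 6 && Nat.ble c 6

def put (t : Tr) (k v : ℕ) : Tr := fN k fun k => fN v fun v => ins 40 t k k v
def gd (b : Bool) (t : Tr) (k v : ℕ) : Tr := match b with
  | true => put t k v
  | false => t

def sucR (t : Tr) (v p cg cc cd cf wb wf wc wa wd wg : ℕ) : Tr :=
  match Nat.beq (Nat.add wc (Nat.add wd wg)) 0 with
  | false => t
  | true =>
    fT (gd (Rok p cg cc cd cf 4) t (enc p cg cc cd 4 wb wf 1 wa 1 1) (Nat.add v 1)) fun t =>
    fT (gd (Rok p cg cc cd cf 5) t (enc p cg cc cd 5 wb wf 1 wa 1 1) (Nat.add v 1)) fun t =>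
    fT (gd (Rok p cg cc cd cf 6) t (enc p cg cc cd 6 wb wf 1 wa 1 1) (Nat.add v 1)) fun t =>
    fT (gd (Rok p cg cc cd cf 7) t (enc p cg cc cd 7 wb wf 1 wa 1 1) (Nat.add v 1)) fun t =>
    fT (gd (Rok p cg cc cd cf 8) t (enc p cg cc cd 8 wb wf 1 wa 1 1) (Nat.add v 1)) fun t =>
    fT (gd (Rok p cg cc cd cf 9) t (enc p cg cc cd 9 wb wf 1 wa 1 1) (Nat.add v 1)) fun t =>
    gd (Rok p cg cc cd cf 10) t (enc p cg cc cd 10 wb wf 1 wa 1 1) (Nat.add v 1)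

def sucs (t : Tr) (v p cg cc cd cf wb wf wc wa wd wg : ℕ) : Tr :=
  fT (gd (Nat.beq wb 1) t (enc p cc cg cd cf 0 wa wd wf wc wg) (Nat.add v 2)) fun t =>
  fT (gd (Nat.beq wa 1 && !Nat.beq cc 7 && !Nat.beq cd 7) t (enc p cg cd cc cf wf wb wc 0 wg wd) v) fun t =>
  fT (gd (Nat.beq wg 1) t (enc p cg cc cf cd wb wc wf wd wa 0) (Nat.add v 2)) fun t =>
  fT (gd (Nat.beq (Nat.add wb (Nat.add wf wc)) 0 && Lok p cc cd cf cg) t (enc (p+1) 4 cc cd cf 1 1 1 wa wd wg) (Nat.add v 1)) fun t =>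
  sucR t v p cg cc cd cf wb wf wc wa wd wg

def fin (n v cg cc cd cf wb wc wa wd : ℕ) : Bool :=
  match Nat.beq cd 7 && Nat.beq wa 1 && Nat.ble 8 cg && Nat.ble 8 cc && Nat.ble 8 cf with
  | false => true
  | true => match Nat.beq cf 8, Nat.beq cc 8 with
    | true, _ => Nat.ble (3+n+wb) v
    | false, true => Nat.ble (3+n+wc) v
    | false, false => Nat.ble (3+n+wd) v

def dec {β : Type} (k : ℕ) (f : ℕ → ℕ → ℕ → ℕ → ℕ → ℕ → ℕ → ℕ → ℕ → ℕ → ℕ → β) : β :=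
  f (Nat.div k 4194304) (Nat.mod (Nat.div k 64) 16) (Nat.mod (Nat.div k 1024) 16) (Nat.mod (Nat.div k 16384) 16) (Nat.mod (Nat.div k 262144) 16) (Nat.mod (Nat.div k 1) 2) (Nat.mod (Nat.div k 2) 2) (Nat.mod (Nat.div k 4) 2) (Nat.mod (Nat.div k 8) 2) (Nat.mod (Nat.div k 16) 2) (Nat.mod (Nat.div k 32) 2)

def proc (n : ℕ) : Tr → Tr → Option Tr
  | .e, t => some t
  | .lf k _ v, t => dec k fun p cg cc cd cf wb wf wc wa wd wg => match fin n v cg cc cd cf wb wc wa wd with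
    | false => none
    | true => fT (sucs t v p cg cc cd cf wb wf wc wa wd wg) some
  | .nd a b, t => match proc n a t with
    | none => none
    | some t => proc n b t

def run : ℕ → ℕ → Tr → Bool
  | 0, _, _ => false
  | f+1, n, .e => true
  | f+1, n, L => match proc n L .e with
    | none => false
    | some L => fN (n+1) fun n => run f n L

def ii (t : Tr) (a b c : ℕ) (w : ℕ → ℕ → ℕ → ℕ) : Tr :=
  let g := fun (t : Tr) (x y z : ℕ) => put t (enc 0 a b 0 c x 0 y 0 z 1) (w x y z)
  fT (g t 0 0 0) fun t => fT (g t 0 0 1) fun t => fT (g t 0 1 0) fun t => fT (g t 0 1 1) fun t =>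
  fT (g t 1 0 0) fun t => fT (g t 1 0 1) fun t => fT (g t 1 1 0) fun t => g t 1 1 1
def init : Tr :=
  fT (ii .e 1 2 3 (fun _ _ z => z)) fun t => fT (ii t 1 3 2 (fun _ _ z => z)) fun t =>
  fT (ii t 2 1 3 (fun _ y _ => y)) fun t => fT (ii t 3 1 2 (fun _ y _ => y)) fun t =>
  fT (ii t 2 3 1 (fun x _ _ => x)) fun t => ii t 3 2 1 (fun x _ _ => x)

set_option maxRecDepth 100000 in
theorem run_ok : run 100 0 init = true := by decide +kernel

lemma Tr.mono {t : Tr} {k v vb : ℕ} (h : t.mem k v) (hv : v ≤ vb) : t.mem k vb := by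
  induction t with
  | e => exact h
  | lf a b c => exact ⟨h.1, h.2.trans hv⟩
  | nd a b iha ihb => exact h.imp iha ihb

lemma gd_mem {b t k v ka va} (h : Tr.mem ka va t ∨ (b = true ∧ k = ka ∧ v ≤ va)) : (gd b t k v).mem ka va := by
  unfold gd
  cases b
  · simpa using h
  · dsimp only [put]; simp only [fe]
    refine mem_ins _ _ _ _ _ _ _ ?_
    simpa using h

lemma gdl {b t k v ka va} (h : Tr.mem ka va t) : (gd b t k v).mem ka va := gd_mem (.inl h)

structure St where
  p : ℕ
  cg : ℕ
  cc : ℕ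
  cd : ℕ
  cf : ℕ
  wb : ℕ
  wf : ℕ
  wc : ℕ
  wa : ℕ
  wd : ℕ
  wg : ℕ

def St.code (s : St) : ℕ := enc s.p s.cg s.cc s.cd s.cf s.wb s.wf s.wc s.wa s.wd s.wg
def St.ok (s : St) : Prop := s.cg < 16 ∧ s.cc < 16 ∧ s.cd < 16 ∧ s.cf < 16 ∧ s.wb < 2 ∧ s.wf < 2 ∧ s.wc < 2 ∧ s.wa < 2 ∧ s.wd < 2 ∧ s.wg < 2

def Suc (s sk : St) (e : ℕ) : Prop :=
  (s.wb = 1 ∧ sk = ⟨s.p, s.cc, s.cg, s.cd, s.cf, 0, s.wa, s.wd, s.wf, s.wc, s.wg⟩ ∧ e = 2) ∨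
  (s.wa = 1 ∧ s.cc ≠ 7 ∧ s.cd ≠ 7 ∧ sk = ⟨s.p, s.cg, s.cd, s.cc, s.cf, s.wf, s.wb, s.wc, 0, s.wg, s.wd⟩ ∧ e = 0) ∨
  (s.wg = 1 ∧ sk = ⟨s.p, s.cg, s.cc, s.cf, s.cd, s.wb, s.wc, s.wf, s.wd, s.wa, 0⟩ ∧ e = 2) ∨
  ((s.wb = 0 ∧ s.wf = 0 ∧ s.wc = 0) ∧ Lok s.p s.cc s.cd s.cf s.cg = true ∧
    sk = ⟨s.p+1, 4, s.cc, s.cd, s.cf, 1, 1, 1, s.wa, s.wd, s.wg⟩ ∧ e = 1) ∨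
  ((s.wc = 0 ∧ s.wd = 0 ∧ s.wg = 0) ∧ Rok s.p s.cg s.cc s.cd s.cf sk.cf = true ∧ 4 ≤ sk.cf ∧ sk.cf ≤ 10 ∧
    sk = ⟨s.p, s.cg, s.cc, s.cd, sk.cf, s.wb, s.wf, 1, s.wa, 1, 1⟩ ∧ e = 1)

def sucsS (t : Tr) (v : ℕ) (s : St) : Tr := sucs t v s.p s.cg s.cc s.cd s.cf s.wb s.wf s.wc s.wa s.wd s.wg

lemma sucs_old {t v ka va} (s : St) (h : Tr.mem ka va t) : (sucsS t v s).mem ka va := by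
  unfold sucsS sucs sucR
  simp only [fd]
  split
  · exact gdl (gdl (gdl (gdl h)))
  · exact gdl (gdl (gdl (gdl (gdl (gdl (gdl (
      gdl (gdl (gdl (gdl h))))))))))

lemma beq_t {a b : ℕ} (h : a = b) : Nat.beq a b = true := by subst h; exact Nat.beq_refl a
lemma beq_f {a b : ℕ} (h : a ≠ b) : Nat.beq a b = false := by
  by_contra k; exact h (Nat.eq_of_beq_eq_true (by simpa using k))

lemma sucs_new {t v e} {s sk : St} (h : Suc s sk e) : (sucsS t v s).mem sk.code (v+e) := by
  have key : ∀ q : Tr, q.mem sk.code (v+e) → (sucR q v s.p s.cg s.cc s.cd s.cf s.wb s.wf s.wc s.wa s.wd s.wg).mem sk.code (v+e) := by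
    intro q h; unfold sucR; simp only [fd]; split
    · exact h
    · exact gdl (gdl (gdl (gdl (gdl (gdl (gdl h))))))
  unfold sucsS sucs
  simp only [fd]
  rcases h with ⟨a, h, rfl⟩ | ⟨a, aj, bg, h, rfl⟩ | ⟨a, h, rfl⟩ | ⟨a, aj, h, rfl⟩ | ⟨a, aj, bg, dn, h, rfl⟩
  · refine key _ (gdl (gdl (gdl (gd_mem (.inr ⟨beq_t a, by rw [h]; rfl, le_rfl⟩)))))
  · refine key _ (gdl (gdl (gd_mem (.inr ⟨by rw [beq_t a, beq_f aj, beq_f bg]; rfl, by rw [h]; rfl, le_rfl⟩))))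
  · refine key _ (gdl (gd_mem (.inr ⟨beq_t a, by rw [h]; rfl, le_rfl⟩)))
  · refine key _ (gd_mem (.inr ⟨by rw [aj, a.1, a.2.1, a.2.2]; rfl, by rw [h]; rfl, le_rfl⟩))
  · have eo : Nat.beq (Nat.add s.wc (Nat.add s.wd s.wg)) 0 = true := by rw [a.1, a.2.1, a.2.2]; rfl
    unfold sucR; simp only [fd]
    rw [eo]
    dsimp only
    have hc : sk.code = enc s.p s.cg s.cc s.cd sk.cf s.wb s.wf 1 s.wa 1 1 := by
      conv_lhs => rw [h]
      rfl
    rw [hc]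
    have : sk.cf = 4 ∨ sk.cf = 5 ∨ sk.cf = 6 ∨ sk.cf = 7 ∨ sk.cf = 8 ∨ sk.cf = 9 ∨ sk.cf = 10 := om
    rcases this with w | w | w | w | w | w | w <;> rw [w] at aj ⊢
    · exact gdl (gdl (gdl (gdl (gdl (gdl (gd_mem (.inr ⟨aj, rfl, le_rfl⟩)))))))
    · exact gdl (gdl (gdl (gdl (gdl (gd_mem (.inr ⟨aj, rfl, le_rfl⟩))))))
    · exact gdl (gdl (gdl (gdl (gd_mem (.inr ⟨aj, rfl, le_rfl⟩)))))
    · exact gdl (gdl (gdl (gd_mem (.inr ⟨aj, rfl, le_rfl⟩))))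
    · exact gdl (gdl (gd_mem (.inr ⟨aj, rfl, le_rfl⟩)))
    · exact gdl (gd_mem (.inr ⟨aj, rfl, le_rfl⟩))
    · exact gd_mem (.inr ⟨aj, rfl, le_rfl⟩)

lemma dec_code {β : Type} (s : St) (h : s.ok) (f : ℕ → ℕ → ℕ → ℕ → ℕ → ℕ → ℕ → ℕ → ℕ → ℕ → ℕ → β) :
    dec s.code f = f s.p s.cg s.cc s.cd s.cf s.wb s.wf s.wc s.wa s.wd s.wg := by
  obtain ⟨p, cg, cc, cd, cf, wb, wf, wc, wa, wd, wg⟩ := s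
  obtain ⟨aa, ad, af, ag, ah, bx, bh, bk, bm, h10⟩ := h
  dsimp only at *
  have hk : St.code ⟨p, cg, cc, cd, cf, wb, wf, wc, wa, wd, wg⟩ = wb + 2 * (wf + 2 * (wc + 2 * (wa + 2 * (wd + 2 * (wg + 2 * (cg + 16 * (cc + 16 * (cd + 16 * (cf + 16 * p))))))))) := rfl
  generalize St.code _ = k at hk
  show f (k / 4194304) (k / 64 % 16) (k / 1024 % 16) (k / 16384 % 16) (k / 262144 % 16) (k / 1 % 2) (k / 2 % 2) (k / 4 % 2) (k / 8 % 2) (k / 16 % 2) (k / 32 % 2) = _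
  congr 1 <;> omega

lemma fin_mono {n v vb cg cc cd cf wb wc wa wd} (h : fin n v cg cc cd cf wb wc wa wd = true) (hv : v ≤ vb) :
    fin n vb cg cc cd cf wb wc wa wd = true := by
  unfold fin at *
  split at h
  · rfl
  · split at h <;> simp only [Nat.ble_eq] at * <;> omega

def leafF (n v : ℕ) (t : Tr) (p cg cc cd cf wb wf wc wa wd wg : ℕ) : Option Tr :=
  match fin n v cg cc cd cf wb wc wa wd with
    | false => none
    | true => fT (sucs t v p cg cc cd cf wb wf wc wa wd wg) some
lemma proc_lf (n k h v t) : proc n (.lf k h v) t = dec k (leafF n v t) := rfl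
lemma leafF_eq {n v t tb} (s : St) (h : leafF n v t s.p s.cg s.cc s.cd s.cf s.wb s.wf s.wc s.wa s.wd s.wg = some tb) :
    fin n v s.cg s.cc s.cd s.cf s.wb s.wc s.wa s.wd = true ∧ tb = sucsS t v s := by
  unfold leafF at h
  rw [fd] at h
  split at h
  · simp at h
  · rename_i hf; simp only [Option.some.injEq] at h; exact ⟨hf, h.symm⟩

lemma proc_ok (n : ℕ) : ∀ (L t tb : Tr), proc n L t = some tb → (∀ k v, t.mem k v → tb.mem k v) ∧
    ∀ (s : St) v, s.ok → L.mem s.code v → fin n v s.cg s.cc s.cd s.cf s.wb s.wc s.wa s.wd = true ∧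
      ∀ sk e, Suc s sk e → tb.mem sk.code (v+e) := by
  intro L
  induction L with
  | e => intro t tb h; simp only [proc, Option.some.injEq] at h; subst h; exact ⟨fun _ _ h => h, fun _ _ _ h => h.elim⟩
  | lf k h v =>
    intro t tb h
    rw [proc_lf] at h
    have gen : ∀ s : St, s.ok → k = s.code → fin n v s.cg s.cc s.cd s.cf s.wb s.wc s.wa s.wd = true ∧ tb = sucsS t v s := by
      intro s so e
      rw [e, dec_code s so] at h
      exact leafF_eq s h
    refine ⟨?_, ?_⟩
    · unfold dec at h
      intro ka va q
      rw [(leafF_eq ⟨_, _, _, _, _, _, _, _, _, _, _⟩ h).2]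
      exact sucs_old _ q
    · intro s va so hm
      obtain ⟨a, b⟩ := gen s so hm.1
      refine ⟨fin_mono a hm.2, fun sk e w => ?_⟩
      rw [b]
      exact Tr.mono (sucs_new w) (by have := hm.2; omega)
  | nd a b iha ihb =>
    intro t tb h
    simp only [proc] at h
    split at h
    · simp at h
    · rename_i tj aa
      have A := iha t tj aa; have B := ihb tj tb h
      refine ⟨fun k v q => B.1 _ _ (A.1 _ _ q), fun s v o q => ?_⟩
      rcases q with q | q
      · exact ⟨(A.2 s v o q).1, fun sk e w => B.1 _ _ ((A.2 s v o q).2 sk e w)⟩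
      · exact B.2 s v o q

theorem sound (st : ℕ → St) (hok : ∀ t, (st t).ok) (dd : ℕ → ℤ) (b : ℕ) : ∀ (len a f n : ℕ) (L : Tr) (v : ℕ), a + len = b →
    run f n L = true → L.mem (st a).code v → (v : ℤ) = dd a + n →
    (∀ t, a ≤ t → t < b → (st (t+1) = st t ∧ dd (t+1) = dd t) ∨ ∃ e : ℕ, Suc (st t) (st (t+1)) e ∧ dd (t+1) = dd t + e - 1) →
    ∃ n v : ℕ, (v : ℤ) = dd b + n ∧ fin n v (st b).cg (st b).cc (st b).cd (st b).cf (st b).wb (st b).wc (st b).wa (st b).wd = true := by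
  intro len
  induction len with
  | zero =>
    intro a f n L v hab hr hm hv _
    obtain rfl : a = b := om
    match f, L with
    | f+1, .e => exact hm.elim
    | f+1, .lf x y z =>
      simp only [run] at hr
      split at hr
      · simp at hr
      · rename_i La hL
        exact ⟨n, v, hv, ((proc_ok n _ _ _ hL).2 _ _ (hok a) hm).1⟩
    | f+1, .nd x y =>
      simp only [run] at hr
      split at hr
      · simp at hr
      · rename_i La hL
        exact ⟨n, v, hv, ((proc_ok n _ _ _ hL).2 _ _ (hok a) hm).1⟩
  | succ len ih =>
    intro a f n L v hab hr hm hv hs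
    rcases hs a le_rfl om with ⟨eg, eb⟩ | ⟨e, eg, eb⟩
    · exact ih (a+1) f n L v om hr (by rw [eg]; exact hm) (by rw [eb]; exact hv) (fun t aa ad => hs t om ad)
    · have : ∃ f' La, proc n L .e = some La ∧ run f' (n+1) La = true := by
        match f, L with
        | f+1, .e => exact hm.elim
        | f+1, .lf x y z =>
          simp only [run] at hr
          split at hr
          · simp at hr
          · rename_i La hL; exact ⟨f, La, hL, by rw [fe] at hr; exact hr⟩
        | f+1, .nd x y =>
          simp only [run] at hr
          split at hr
          · simp at hr
          · rename_i La hL; exact ⟨f, La, hL, by rw [fe] at hr; exact hr⟩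
      obtain ⟨f', La, hL, hr'⟩ := this
      have := ((proc_ok n _ _ _ hL).2 _ _ (hok a) hm).2 _ _ eg
      exact ih (a+1) f' (n+1) La (v+e) om hr' this (by push_cast; omega) (fun t aa ad => hs t om ad)

lemma put_mem {t k v ka va} (h : Tr.mem ka va t ∨ (k = ka ∧ v ≤ va)) : (put t k v).mem ka va := by
  unfold put; simp only [fe]
  exact mem_ins _ _ _ _ _ _ _ h

structure Tr.has (k v : ℕ) (t : Tr) : Prop where
  h : t.mem k v
lemma put_has {t k v ka va} (h : Tr.has ka va t ∨ (k = ka ∧ v ≤ va)) : (put t k v).has ka va :=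
  ⟨put_mem (h.imp (fun h => h.h) id)⟩

lemma g8 (g : Tr → ℕ → ℕ → ℕ → Tr) (hg : ∀ t x y z k v, Tr.has k v t → (g t x y z).has k v) (t : Tr) (r : Tr)
    (hr : r = g (g (g (g (g (g (g (g t 0 0 0) 0 0 1) 0 1 0) 0 1 1) 1 0 0) 1 0 1) 1 1 0) 1 1 1) :
    (∀ k v, t.has k v → r.has k v) ∧
    ∀ x y z k v, x < 2 → y < 2 → z < 2 → (∀ t, (g t x y z).has k v) → r.has k v := by
  subst hr
  refine ⟨fun k v h => by iterate 8 apply hg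
                          exact h, fun x y z k v hx hy hz h => ?_⟩
  obtain rfl | rfl : x = 0 ∨ x = 1 := om
  all_goals obtain rfl | rfl : y = 0 ∨ y = 1 := om
  all_goals obtain rfl | rfl : z = 0 ∨ z = 1 := om
  · iterate 7 apply hg
    apply h
  · iterate 6 apply hg
    apply h
  · iterate 5 apply hg
    apply h
  · iterate 4 apply hg
    apply h
  · iterate 3 apply hg
    apply h
  · iterate 2 apply hg
    apply h
  · apply hg
    apply h
  · apply h

lemma in3_eq (t a b c w) : ii t a b c w = (fun g : Tr → ℕ → ℕ → ℕ → Tr => g (g (g (g (g (g (g (g t 0 0 0) 0 0 1) 0 1 0) 0 1 1) 1 0 0) 1 0 1) 1 1 0) 1 1 1)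
    (fun (t : Tr) (x y z : ℕ) => put t (enc 0 a b 0 c x 0 y 0 z 1) (w x y z)) := by
  unfold ii; simp only [fd]

lemma in3_mem {t a b c w} : (∀ k v, Tr.has k v t → (ii t a b c w).has k v) ∧ 
    ∀ x y z k v, x < 2 → y < 2 → z < 2 → (∀ t, (put t (enc 0 a b 0 c x 0 y 0 z 1) (w x y z)).has k v) → (ii t a b c w).has k v :=
  g8 (fun (t : Tr) (x y z : ℕ) => put t (enc 0 a b 0 c x 0 y 0 z 1) (w x y z)) (fun _ _ _ _ _ _ h => put_has (.inl h)) t _ (in3_eq t a b c w)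

lemma in3_old {t a b c w k v} (h : Tr.has k v t) : (ii t a b c w).has k v := in3_mem.1 k v h
lemma in3_new {t a b c w x y z} (hx : x < 2) (hy : y < 2) (hz : z < 2) (k v : ℕ) (hk : enc 0 a b 0 c x 0 y 0 z 1 = k)
    (hv : w x y z = v) : (ii t a b c w).has k v :=
  in3_mem.2 x y z k v hx hy hz (fun t => put_has (.inr ⟨hk, hv.le⟩))

lemma six (F : Tr → ℕ → ℕ → ℕ → (ℕ → ℕ → ℕ → ℕ) → Tr) (hF : ∀ t a b c w k v, Tr.has k v t → (F t a b c w).has k v) (k v : ℕ)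
    (h : (∀ t, (F t 1 2 3 (fun _ _ z => z)).has k v) ∨ (∀ t, (F t 1 3 2 (fun _ _ z => z)).has k v) ∨
      (∀ t, (F t 2 1 3 (fun _ y _ => y)).has k v) ∨ (∀ t, (F t 3 1 2 (fun _ y _ => y)).has k v) ∨
      (∀ t, (F t 2 3 1 (fun x _ _ => x)).has k v) ∨ (∀ t, (F t 3 2 1 (fun x _ _ => x)).has k v)) :
    (F (F (F (F (F (F .e 1 2 3 (fun _ _ z => z)) 1 3 2 (fun _ _ z => z)) 2 1 3 (fun _ y _ => y)) 3 1 2 (fun _ y _ => y)) 2 3 1 (fun x _ _ => x)) 3 2 1 (fun x _ _ => x)).has k v := by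
  rcases h with h | h | h | h | h | h
  · iterate 5 apply hF
    apply h
  · iterate 4 apply hF
    apply h
  · iterate 3 apply hF
    apply h
  · iterate 2 apply hF
    apply h
  · apply hF
    apply h
  · apply h

lemma init_eq : init = (fun F : Tr → ℕ → ℕ → ℕ → (ℕ → ℕ → ℕ → ℕ) → Tr => F (F (F (F (F (F .e 1 2 3 (fun _ _ z => z)) 1 3 2 (fun _ _ z => z)) 2 1 3 (fun _ y _ => y)) 3 1 2 (fun _ y _ => y)) 2 3 1 (fun x _ _ => x)) 3 2 1 (fun x _ _ => x)) ii := by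
  unfold init; simp only [fd]

lemma init_mem (s : St) (hs : s.ok) (v : ℕ) (h : s.p = 0 ∧ s.cd = 0 ∧ s.wf = 0 ∧ s.wa = 0 ∧ s.wg = 1)
    (ae : (s.cg = 1 ∧ ((s.cc = 2 ∧ s.cf = 3) ∨ (s.cc = 3 ∧ s.cf = 2)) ∧ v = s.wd) ∨
      (s.cc = 1 ∧ ((s.cg = 2 ∧ s.cf = 3) ∨ (s.cg = 3 ∧ s.cf = 2)) ∧ v = s.wc) ∨
      (s.cf = 1 ∧ ((s.cg = 2 ∧ s.cc = 3) ∨ (s.cg = 3 ∧ s.cc = 2)) ∧ v = s.wb)) : init.has s.code v := by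
  obtain ⟨p, cg, cc, cd, cf, wb, wf, wc, wa, wd, wg⟩ := s
  obtain ⟨-, -, -, -, ah, -, bh, -, bm, -⟩ := hs
  dsimp only at *
  obtain ⟨rfl, rfl, rfl, rfl, rfl⟩ := h
  rw [init_eq]
  refine six ii (fun _ _ _ _ _ _ _ h => in3_old h) _ _ ?_
  rcases ae with ⟨eg, ⟨eb, eh⟩ | ⟨eb, eh⟩, ej⟩ | ⟨eg, ⟨eb, eh⟩ | ⟨eb, eh⟩, ej⟩ | ⟨eg, ⟨eb, eh⟩ | ⟨eb, eh⟩, ej⟩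
  · exact .inl fun t => in3_new ah bh bm _ _ (by rw [eg, eb, eh]; rfl) ej.symm
  · exact .inr <| .inl fun t => in3_new ah bh bm _ _ (by rw [eg, eb, eh]; rfl) ej.symm
  · exact .inr <| .inr <| .inl fun t => in3_new ah bh bm _ _ (by rw [eg, eb, eh]; rfl) ej.symm
  · exact .inr <| .inr <| .inr <| .inl fun t => in3_new ah bh bm _ _ (by rw [eg, eb, eh]; rfl) ej.symm
  · exact .inr <| .inr <| .inr <| .inr <| .inl fun t => in3_new ah bh bm _ _ (by rw [eg, eb, eh]; rfl) ej.symm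
  · exact .inr <| .inr <| .inr <| .inr <| .inr fun t => in3_new ah bh bm _ _ (by rw [eg, eb, eh]; rfl) ej.symm

theorem sound' (st : ℕ → St) (hok : ∀ t, (st t).ok) (dd : ℕ → ℤ) (a b : ℕ) (hab : a ≤ b) (L : Tr) (f v : ℕ)
    (hr : run f 0 L = true) (hm : L.has (st a).code v) (hv : (v : ℤ) = dd a)
    (h : ∀ t, a ≤ t → t < b → (st (t+1) = st t ∧ dd (t+1) = dd t) ∨ ∃ e : ℕ, Suc (st t) (st (t+1)) e ∧ dd (t+1) = dd t + e - 1) :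
    ∃ n v : ℕ, (v : ℤ) = dd b + n ∧ fin n v (st b).cg (st b).cc (st b).cd (st b).cf (st b).wb (st b).wc (st b).wa (st b).wd = true :=
  sound st hok dd b (b - a) a f 0 L v om hr hm.h (by simpa using hv) h

theorem main (st : ℕ → St) (hok : ∀ t, (st t).ok) (dd : ℕ → ℤ) (a b : ℕ) (hab : a ≤ b) (v : ℕ)
    (hm : init.has (st a).code v) (hv : (v : ℤ) = dd a)
    (h : ∀ t, a ≤ t → t < b → (st (t+1) = st t ∧ dd (t+1) = dd t) ∨ ∃ e : ℕ, Suc (st t) (st (t+1)) e ∧ dd (t+1) = dd t + e - 1) :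
    ∃ n v : ℕ, (v : ℤ) = dd b + n ∧ fin n v (st b).cg (st b).cc (st b).cd (st b).cf (st b).wb (st b).wc (st b).wa (st b).wd = true :=
  sound' st hok dd a b hab _ _ v run_ok hm hv h

lemma Rok_of {p a b c o n : ℕ} (h :
    (o ≤ 3 ∧ (4 ≤ a ∨ o < a) ∧ (4 ≤ b ∨ o < b) ∧ (4 ≤ c ∨ o < c) ∧
      (((a ≤ 3 ∨ b ≤ 3 ∨ c ≤ 3) ∧ n = 4) ∨ (4 ≤ a ∧ 4 ≤ b ∧ 4 ≤ c ∧ (n = 6 ∨ (n = 5 ∧ a ≠ 5 ∧ b ≠ 5 ∧ c ≠ 5))))) ∨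
    (o = 4 ∧ 4 ≤ a ∧ 4 ≤ b ∧ 4 ≤ c ∧ a ≤ 6 ∧ b ≤ 6 ∧ c ≤ 6 ∧
      (n = 6 ∨ (n = 5 ∧ a ≠ 5 ∧ b ≠ 5 ∧ c ≠ 5) ∨ (7 ≤ n ∧ 5 ≤ a ∧ 5 ≤ b ∧ 5 ≤ c ∧ 3 ≤ p))) ∨
    (o = 6 ∧ 7 ≤ n ∧ 5 ≤ a ∧ 5 ≤ b ∧ 5 ≤ c ∧ 3 ≤ p ∧ (7 ≤ a ∨ 7 ≤ b ∨ 7 ≤ c) ∧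
      (a ≤ 6 ∨ n < a) ∧ (b ≤ 6 ∨ n < b) ∧ (c ≤ 6 ∨ n < c))) : Rok p a b c o n = true := by
  have e : ∀ x y : ℕ, ((!Nat.beq x y) = true) = (x ≠ y) := by
    intro x y; rw [Bool.not_eq_true', ← Bool.not_eq_true, Nat.beq_eq]
  unfold Rok Nat.blt
  simp only [Bool.or_eq_true, Bool.and_eq_true, Nat.ble_eq, Nat.beq_eq, e, and_assoc, or_assoc]
  exact h

lemma Lok_of {p a b c o : ℕ} (h : p ≤ 2 ∧ o = 5 ∧ 4 ≤ a ∧ 4 ≤ b ∧ 4 ≤ c ∧ a ≤ 6 ∧ b ≤ 6 ∧ c ≤ 6) : Lok p a b c o = true := by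
  unfold Lok
  simp only [Bool.and_eq_true, Nat.ble_eq, Nat.beq_eq]
  omega

lemma fin_out {n v cg cc cd cf wb wc wa wd : ℕ} (h : fin n v cg cc cd cf wb wc wa wd = true)
    (ae : cd = 7 ∧ wa = 1 ∧ 8 ≤ cg ∧ 8 ≤ cc ∧ 8 ≤ cf) :
    (cf = 8 ∧ 3 + n + wb ≤ v) ∨ (cf ≠ 8 ∧ cc = 8 ∧ 3 + n + wc ≤ v) ∨ (cf ≠ 8 ∧ cc ≠ 8 ∧ 3 + n + wd ≤ v) := by
  unfold fin at h
  have : (Nat.beq cd 7 && Nat.beq wa 1 && Nat.ble 8 cg && Nat.ble 8 cc && Nat.ble 8 cf) = true := by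
    simp only [Bool.and_eq_true, Nat.ble_eq, Nat.beq_eq]; omega
  rw [this] at h
  dsimp only at h
  split at h <;> rename_i qb
  · rw [Nat.ble_eq] at h; rw [Nat.beq_eq] at qb; omega
  · rename_i qa; rw [Nat.ble_eq] at h; rw [← Bool.not_eq_true, Nat.beq_eq] at qa; rw [Nat.beq_eq] at qb; omega
  · rename_i qa; rw [Nat.ble_eq] at h; rw [← Bool.not_eq_true, Nat.beq_eq] at qb qa; omega

end DP

namespace Sq
variable (S : SF)
local notation "ps" => pos S
local notation "NN" => N S
local notation "Uu" => u S
local notation "Vv" => v S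
local notation "Rk" => rk S
local notation "Ls" => L S
lemma pos_surj (t : ℕ) {i : ℕ} (hi : i < 30) : ∃ x, ps t x = i := by
  obtain ⟨x, -, h⟩ := S.exists_rk (U := univ) (t := t) (i := i) (by simpa using hi)
  rw [S.rk_univ (by simp)] at h
  exact ⟨x, h⟩

noncomputable def el (t i : ℕ) : Fin 30 := if h : i < 30 then (S.pos_surj t h).choose else 0

local notation "El" => el S
lemma pos_el {t i : ℕ} (h : i < 30) : ps t (El t i) = i := by
  unfold el; rw [dif_pos h]; exact (S.pos_surj t h).choose_spec

lemma el_pos (t x) : El t (ps t x) = x := S.inj t _ _ (S.pos_el (S.lt t x))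

lemma ek {t i x} (h : ps t x = i) : El t i = x := by rw [← h, el_pos]

def l (t : ℕ) : ℕ := ps t (Uu t)

local notation "Le" => l S
lemma l_lt (t) : Le t < 29 := by
  have := S.huv t; have := S.lt t (Vv t); unfold l; omega

lemma eu (t) : El t (Le t) = Uu t := S.el_pos t _
lemma ev (t) : El t (Le t + 1) = Vv t := S.ek (S.huv t)
lemma el_l' (t) : El (t+1) (Le t) = Vv t := S.ek (S.hv t)
lemma el_l1' (t) : El (t+1) (Le t + 1) = Uu t := S.ek (S.hu t)
lemma ez {t i} (aa : i ≠ Le t) (ad : i ≠ Le t + 1) (hi : i < 30) : El (t+1) i = El t i := by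
  apply S.ek
  have af := S.pos_el (t := t) hi
  rw [S.hx, af]
  · intro h; rw [h] at af; exact aa af.symm
  · intro h; rw [h, S.huv] at af; exact ad af.symm

lemma ld (t) : Le (t+NN) + Le t = 28 := by
  unfold l; rw [(S.uN t).1]; have := S.flip t (Vv t); have := S.huv t; omega

def cn (Q : ℕ → Prop) [DecidablePred Q] (s sk : ℕ) : ℕ := ((Ico s sk).filter Q).card

lemma cn_succ (Q : ℕ → Prop) [DecidablePred Q] {s sk : ℕ} (h : s ≤ sk) :
    cn Q s (sk+1) = cn Q s sk + if Q sk then 1 else 0 := by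
  unfold cn
  rw [← Finset.insert_Ico_right_eq_Ico_add_one h, Finset.filter_insert]
  split_ifs with aa
  · rw [card_insert_of_notMem (by simp)]
  · rfl

lemma cn_self (Q : ℕ → Prop) [DecidablePred Q] (s : ℕ) : cn Q s s = 0 := by simp [cn]

lemma cn_add (Q : ℕ → Prop) [DecidablePred Q] {a b c : ℕ} (h : a ≤ b) (ae : b ≤ c) :
    cn Q a b + cn Q b c = cn Q a c := by
  unfold cn
  rw [← Finset.Ico_union_Ico_eq_Ico h ae, Finset.filter_union, card_union_of_disjoint]
  apply Finset.disjoint_filter_filter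
  exact Finset.Ico_disjoint_Ico_consecutive a b c

def cenQ (t : ℕ) : Prop := Le t = 13 ∨ Le t = 14 ∨ Le t = 15
def borQ (t : ℕ) : Prop := Le t = 12 ∨ Le t = 16
def HQ (t : ℕ) : Prop := Le t = 14
def OQ (t : ℕ) : Prop := Le t = 13 ∨ Le t = 15
instance : DecidablePred S.cenQ := fun t => by unfold cenQ; infer_instance
instance : DecidablePred S.borQ := fun t => by unfold borQ; infer_instance
instance : DecidablePred S.HQ := fun t => by unfold HQ; infer_instance
instance : DecidablePred S.OQ := fun t => by unfold OQ; infer_instance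

open Classical in
noncomputable def bt (R : Fin 30 → Fin 30 → Prop) (t i j : ℕ) : ℕ := if R (El t i) (El t j) then 1 else 0

noncomputable def Phi (R : Fin 30 → Fin 30 → Prop) (t : ℕ) : ℕ :=
  S.bt R t 13 14 + S.bt R t 13 15 + S.bt R t 13 16 + S.bt R t 14 15 + S.bt R t 14 16 + S.bt R t 15 16

def freshL (R : Fin 30 → Fin 30 → Prop) (t : ℕ) : Prop :=
  ∀ j, 14 ≤ j → j ≤ 16 → ¬ R (Vv t) (El t j) ∧ R (Uu t) (El t j)
def freshR (R : Fin 30 → Fin 30 → Prop) (t : ℕ) : Prop :=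
  ∀ j, 13 ≤ j → j ≤ 15 → ¬ R (El t j) (Uu t) ∧ R (El t j) (Vv t)

def badQ (R : Fin 30 → Fin 30 → Prop) (t : ℕ) : Prop :=
  (Le t = 12 ∧ ¬ S.freshL R t) ∨ (Le t = 16 ∧ ¬ S.freshR R t)

lemma bf (R) (t i j) : S.bt R t i j ≤ 1 := by unfold bt; split_ifs <;> omega

lemma bt_congr {R t tb i j ij ja} (aa : El t i = El tb ij) (ad : El t j = El tb ja) :
   S.bt R t i j = S.bt R tb ij ja := by unfold bt; rw [aa, ad]

lemma bt_one {R t i j} : S.bt R t i j = 1 ↔ R (El t i) (El t j) := by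
  unfold bt; split_ifs with h <;> simp [h]
lemma bt_zero {R t i j} : S.bt R t i j = 0 ↔ ¬ R (El t i) (El t j) := by
  unfold bt; split_ifs with h <;> simp [h]

lemma Phi_le (R) (t) : S.Phi R t ≤ 6 := by
  unfold Phi
  have := S.bf R t 13 14; have := S.bf R t 13 15; have := S.bf R t 13 16
  have := S.bf R t 14 15; have := S.bf R t 14 16; have := S.bf R t 15 16; omega

open Classical in
lemma Phi_step {R t} (aa : R (Uu t) (Vv t)) (ad : ¬ R (Vv t) (Uu t)) :
    S.Phi R (t+1) + (if S.cenQ t then 1 else 0) + (if S.badQ R t then 1 else 0) ≤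
    S.Phi R t + 3 * (if S.borQ t then 1 else 0) := by
  have eg := S.eu t; have eb := S.ev t; have eh := S.el_l' t; have ej := S.el_l1' t
  have ep := fun i => S.ez (t := t) (i := i)
  rw [← eg, ← eb] at aa ad
  have hc : ∀ k, Le t = k → k < 29 → El (t+1) k = El t (k+1) ∧ El (t+1) (k+1) = El t k ∧
     ∀ i, i ≠ k → i ≠ k+1 → i < 30 → El (t+1) i = El t i := by
    intro k hk _
    rw [hk] at eg eb eh ej ep
    exact ⟨by rw [eh, eb], by rw [ej, eg], ep⟩
  by_cases hk : Le t < 12 ∨ 16 < Le t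
  · have : S.Phi R (t+1) = S.Phi R t := by
      unfold Phi
      have f : ∀ i, 13 ≤ i → i ≤ 16 → El (t+1) i = El t i := by
        intro i a b; exact ep i om om om
      simp only [bt, f 13 om om, f 14 om om, f 15 om om, f 16 om om]
    rw [if_neg (show ¬ S.cenQ t by unfold cenQ; omega), if_neg (show ¬ S.borQ t by unfold borQ; omega), if_neg (show ¬ S.badQ R t by rintro (⟨h, -⟩ | ⟨h, -⟩) <;> omega)]; omega
  · obtain h | h | h | h | h : Le t = 12 ∨ Le t = 13 ∨ Le t = 14 ∨ Le t = 15 ∨ Le t = 16 := om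
    · obtain ⟨a, b, c⟩ := hc _ h om
      have cm := c 14 om om om
      have cj := c 15 om om om
      have ci := c 16 om om om
      rw [if_neg (show ¬ S.cenQ t by unfold cenQ; omega), if_pos (show S.borQ t by unfold borQ; omega)]
      unfold Phi
      rw [S.bt_congr cm cj, S.bt_congr cm ci, S.bt_congr cj ci, S.bt_congr b cm, S.bt_congr b cj, S.bt_congr b ci]
      have lb := S.bf R t 12 14; have lh := S.bf R t 12 15; have lj := S.bf R t 12 16
      split_ifs with hb
      · rcases hb with hb | hb
        · obtain ⟨-, hb⟩ := hb
          by_contra hcon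
          apply hb
          have za : S.bt R t 13 14 = 0 := om
          have zb : S.bt R t 13 15 = 0 := om
          have zc : S.bt R t 13 16 = 0 := om
          have zd : S.bt R t 12 14 = 1 := om
          have zf : S.bt R t 12 15 = 1 := om
          have zg : S.bt R t 12 16 = 1 := om
          rw [bt_zero] at za zb zc
          rw [bt_one] at zd zf zg
          rw [h] at eg eb
          simp only [Nat.reduceAdd] at eb
          rw [eg] at zd zf zg; rw [eb] at za zb zc
          intro j hj dp
          obtain rfl | rfl | rfl : j = 14 ∨ j = 15 ∨ j = 16 := om
          · exact ⟨za, zd⟩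
          · exact ⟨zb, zf⟩
          · exact ⟨zc, zg⟩
        · omega
      · omega
    · obtain ⟨a, b, c⟩ := hc _ h om
      rw [h] at aa ad
      have cj := c 15 om om om
      have ci := c 16 om om om
      rw [if_pos (show S.cenQ t by unfold cenQ; omega), if_neg (show ¬ S.borQ t by unfold borQ; omega), if_neg (show ¬ S.badQ R t by rintro (⟨h, -⟩ | ⟨h, -⟩) <;> omega)]
      unfold Phi
      rw [S.bt_congr a b, S.bt_congr a cj, S.bt_congr a ci, S.bt_congr b cj, S.bt_congr b ci, S.bt_congr cj ci]
      have := S.bt_one.2 aa; have := S.bt_zero.2 ad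
      simp only [Nat.reduceAdd] at *
      omega
    · obtain ⟨a, b, c⟩ := hc _ h om
      rw [h] at aa ad
      have cj := c 13 om om om
      have ci := c 16 om om om
      rw [if_pos (show S.cenQ t by unfold cenQ; omega), if_neg (show ¬ S.borQ t by unfold borQ; omega), if_neg (show ¬ S.badQ R t by rintro (⟨h, -⟩ | ⟨h, -⟩) <;> omega)]
      unfold Phi
      rw [S.bt_congr a b, S.bt_congr cj a, S.bt_congr a ci, S.bt_congr cj b, S.bt_congr b ci, S.bt_congr cj ci]
      have := S.bt_one.2 aa; have := S.bt_zero.2 ad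
      simp only [Nat.reduceAdd] at *
      omega
    · obtain ⟨a, b, c⟩ := hc _ h om
      rw [h] at aa ad
      have cj := c 13 om om om
      have ci := c 14 om om om
      rw [if_pos (show S.cenQ t by unfold cenQ; omega), if_neg (show ¬ S.borQ t by unfold borQ; omega), if_neg (show ¬ S.badQ R t by rintro (⟨h, -⟩ | ⟨h, -⟩) <;> omega)]
      unfold Phi
      rw [S.bt_congr a b, S.bt_congr cj a, S.bt_congr ci a, S.bt_congr cj b, S.bt_congr ci b, S.bt_congr cj ci]
      have := S.bt_one.2 aa; have := S.bt_zero.2 ad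
      simp only [Nat.reduceAdd] at *
      omega
    · obtain ⟨a, b, c⟩ := hc _ h om
      have cm := c 13 om om om
      have cj := c 14 om om om
      have ci := c 15 om om om
      rw [if_neg (show ¬ S.cenQ t by unfold cenQ; omega), if_pos (show S.borQ t by unfold borQ; omega)]
      unfold Phi
      rw [S.bt_congr cm cj, S.bt_congr cm ci, S.bt_congr cj ci, S.bt_congr cm a, S.bt_congr cj a, S.bt_congr ci a]
      have lb := S.bf R t 13 17; have lh := S.bf R t 14 17; have lj := S.bf R t 15 17
      simp only [Nat.reduceAdd] at *
      split_ifs with hb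
      · rcases hb with hb | hb
        · omega
        · obtain ⟨-, hb⟩ := hb
          by_contra hcon
          apply hb
          have za : S.bt R t 13 16 = 0 := om
          have zb : S.bt R t 14 16 = 0 := om
          have zc : S.bt R t 15 16 = 0 := om
          have zd : S.bt R t 13 17 = 1 := om
          have zf : S.bt R t 14 17 = 1 := om
          have zg : S.bt R t 15 17 = 1 := om
          rw [bt_zero] at za zb zc
          rw [bt_one] at zd zf zg
          rw [h] at eg eb
          simp only [Nat.reduceAdd] at eb
          rw [eb] at zd zf zg; rw [eg] at za zb zc
          intro j hj dp
          obtain rfl | rfl | rfl : j = 13 ∨ j = 14 ∨ j = 15 := om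
          · exact ⟨za, zd⟩
          · exact ⟨zb, zf⟩
          · exact ⟨zc, zg⟩
      · omega

open Classical in
lemma Phi_sum {R} {s sk : ℕ} (hs : s ≤ sk) (hR : ∀ t, s ≤ t → t < sk → R (Uu t) (Vv t) ∧ ¬ R (Vv t) (Uu t)) :
    S.Phi R sk + cn S.cenQ s sk + cn (S.badQ R) s sk ≤ S.Phi R s + 3 * cn S.borQ s sk := by
  induction sk, hs using Nat.le_induction with
  | base => simp [cn_self]
  | succ n hn ih =>
    have aa := ih (fun t a b => hR t a om)
    have ad := hR n hn om
    have af := S.Phi_step ad.1 ad.2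
    rw [cn_succ _ hn, cn_succ _ hn, cn_succ _ hn]
    omega

lemma nat_rel {s t : ℕ} (h : s ≤ t) (ae : t < s + NN) :
    ps s (Uu t) < ps s (Vv t) ∧ ¬ ps s (Vv t) < ps s (Uu t) := by
  have : ps s (Uu t) < ps s (Vv t) := by
    by_contra hc
    have hne := S.pos_ne (t := s) (S.ud t)
    have ad : ps s (Vv t) < ps s (Uu t) := om
    have af := S.swap_lt t
    have ag : ps t (Uu t) < ps t (Vv t) := af
    have ah := S.swap_lt' t
    have := S.btw s t (t+1) _ _ h om om ad ah
    omega
  omega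

lemma cn_window {P : ℕ → Prop} [DecidablePred P] (hP : ∀ t, P (t+NN) ↔ P t) (s sk : ℕ) :
    cn P s (s+NN) = cn P sk (sk+NN) :=
  S.window (fun t => propext (hP t)) s sk

lemma cenQ_N (t) : S.cenQ (t+NN) ↔ S.cenQ t := by have := S.ld t; unfold cenQ; omega
lemma borQ_N (t) : S.borQ (t+NN) ↔ S.borQ t := by have := S.ld t; unfold borQ; omega
lemma HQ_N (t) : S.HQ (t+NN) ↔ S.HQ t := by have := S.ld t; unfold HQ; omega
lemma OQ_N (t) : S.OQ (t+NN) ↔ S.OQ t := by have := S.ld t; unfold OQ; omega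

lemma cn_pos {Q : ℕ → Prop} [DecidablePred Q] {s sk} (h : 1 ≤ cn Q s sk) : ∃ t, s ≤ t ∧ t < sk ∧ Q t := by
  obtain ⟨t, ht⟩ := card_pos.1 h
  rw [mem_filter, mem_Ico] at ht
  exact ⟨t, ht.1.1, ht.1.2, ht.2⟩

open Classical in
lemma cen_le (s : ℕ) : cn S.cenQ s (s+NN) ≤ 3 * cn S.borQ s (s+NN) + 6 ∧
    (1 ≤ cn S.borQ s (s+NN) → cn S.cenQ s (s+NN) ≤ 3 * cn S.borQ s (s+NN) + 3) := by
  have hNp : 0 < NN := S.Npos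
  constructor
  · have := S.Phi_sum (R := fun x y => ps s x < ps s y) (s := s) (sk := s+NN) om
      (fun t a b => S.nat_rel a b)
    have := S.Phi_le (fun x y => ps s x < ps s y) s
    omega
  · intro h
    obtain ⟨b, aa, ad, hb⟩ := cn_pos h
    rw [S.cn_window S.cenQ_N s b, S.cn_window S.borQ_N s b]
    have eo := S.Phi_sum (R := fun x y => ps b x < ps b y) (s := b+1) (sk := b+NN) om
      (fun t a b => S.nat_rel om b)
    have eg := S.Phi_le (fun x y => ps b x < ps b y) (b+1)
    have eb := cn_succ S.cenQ (le_refl b)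
    have eh := cn_succ S.borQ (le_refl b)
    rw [cn_self] at eb eh
    rw [if_pos hb] at eh
    rw [if_neg (by unfold cenQ borQ at *; omega)] at eb
    have ej := cn_add S.cenQ (a := b) (b := b+1) (c := b+NN) om om
    have ep := cn_add S.borQ (a := b) (b := b+1) (c := b+NN) om om
    omega

lemma H_sum {R} {s sk : ℕ} (hs : s ≤ sk) (hR : ∀ t, s ≤ t → t < sk → R (Uu t) (Vv t) ∧ ¬ R (Vv t) (Uu t)) :
    S.bt R sk 14 15 + cn S.HQ s sk ≤ S.bt R s 14 15 + cn S.OQ s sk := by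
  induction sk, hs using Nat.le_induction with
  | base => simp [cn_self]
  | succ n hn ih =>
    have aa := ih (fun t a b => hR t a om)
    have ad := hR n hn om
    rw [cn_succ _ hn, cn_succ _ hn]
    have g := S.bf R (n+1) 14 15
    by_cases hh : S.HQ n
    · rw [if_pos hh, if_neg (by unfold HQ OQ at *; omega)]
      unfold HQ at hh
      have eg := S.eu n; have eb := S.ev n; have eh := S.el_l' n; have ej := S.el_l1' n
      rw [hh] at eg eb eh ej
      rw [← eh, ← ej] at ad
      have za := S.bt_zero.2 ad.2
      rw [eh, ej] at ad
      rw [← eg, ← eb] at ad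
      have zb := S.bt_one.2 ad.1
      simp only [Nat.reduceAdd] at *
      omega
    · rw [if_neg hh]
      by_cases ho : S.OQ n
      · rw [if_pos ho]; omega
      · rw [if_neg ho]
        unfold HQ OQ at *
        rw [S.bt_congr (S.ez (t := n) (i := 14) om om om)
          (S.ez (t := n) (i := 15) om om om)]
        omega

lemma H_le (s : ℕ) : cn S.HQ s (s+NN) ≤ cn S.OQ s (s+NN) + 1 ∧
    (1 ≤ cn S.OQ s (s+NN) → cn S.HQ s (s+NN) ≤ cn S.OQ s (s+NN)) := by
  have hNp : 0 < NN := S.Npos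
  constructor
  · have := S.H_sum (R := fun x y => ps s x < ps s y) (s := s) (sk := s+NN) om
      (fun t a b => S.nat_rel a b)
    have := S.bf (fun x y => ps s x < ps s y) s 14 15
    omega
  · intro h
    obtain ⟨b, aa, ad, hb⟩ := cn_pos h
    rw [S.cn_window S.HQ_N s b, S.cn_window S.OQ_N s b]
    have eo := S.H_sum (R := fun x y => ps b x < ps b y) (s := b+1) (sk := b+NN) om
      (fun t a b => S.nat_rel om b)
    have eg := S.bf (fun x y => ps b x < ps b y) (b+1) 14 15
    have eb := cn_succ S.HQ (le_refl b)
    have eh := cn_succ S.OQ (le_refl b)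
    rw [cn_self] at eb eh
    rw [if_pos hb] at eh
    rw [if_neg (by unfold HQ OQ at *; omega)] at eb
    have ej := cn_add S.HQ (a := b) (b := b+1) (c := b+NN) om om
    have ep := cn_add S.OQ (a := b) (b := b+1) (c := b+NN) om om
    omega

end Sq

namespace Sq
variable {S : SF} {sd sf sg τ a c : ℕ}
local notation "ps" => pos S
local notation "NN" => N S
local notation "Uu" => u S
local notation "Vv" => v S
local notation "El" => el S
local notation "Rk" => rk S
local notation "Le" => l S
local notation "Ls" => L S
local notation "sN" => (sf+S.N)
structure TT (S : SF) (sd sf sg : ℕ) : Prop where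
  au : sd < sf
  ao : sf < sg
  am : sg < sd + S.N
  cov : ∀ x, (S.pos sd x < 10 ∧ 10 ≤ S.pos sf x ∧ S.pos sf x < 20 ∧ 20 ≤ S.pos sg x) ∨
    (10 ≤ S.pos sd x ∧ S.pos sd x < 20 ∧ S.pos sf x < 10 ∧ S.pos sg x < 10) ∨
    (20 ≤ S.pos sd x ∧ 20 ≤ S.pos sf x ∧ 10 ≤ S.pos sg x ∧ S.pos sg x < 20)

lemma DD.toTT {A B C : Finset (Fin 30)} (D : S.DD A B C sd sf sg) : S.TT sd sf sg := by
  refine ⟨D.au, D.ao, D.am, fun x => ?_⟩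
  rcases D.cov x with h | h | h
  · have := D.aq x h; have := D.aj x h; have := D.bg x h; omega
  · have := D.bu x h; have := D.dj x h; have := D.bv x h; omega
  · have := D.cc x h; have := D.cd x h; have := D.cf x h; omega

lemma TT.rot (D : S.TT sd sf sg) : S.TT sN (sg+NN) (sd+NN+NN) := by
  have := D.au; have := D.ao; have := D.am
  refine ⟨om, om, om, fun x => ?_⟩
  have := D.cov x; have := S.flip sd x; have := S.flip sf x; have := S.flip sg x
  have := S.flip (sd+NN) x; omega

lemma el_N (t) {i} (hi : i < 30) : El (t+NN) i = El t (29 - i) := by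
  apply S.ek
  have := S.flip t (El t (29-i))
  rw [S.pos_el om] at this; omega

def Ra (S : SF) (sd sf : ℕ) (x y : Fin 30) : Prop :=
  (S.pos sd x < 10 ∧ S.pos sd y < 10 ∧ S.pos sd x < S.pos sd y) ∨
  (¬ (S.pos sd x < 10 ∧ S.pos sd y < 10) ∧ S.pos sf x < S.pos sf y)

local notation "R2S" => Ra S sd sf
lemma TT.R2_uv (D : S.TT sd sf sg) {t} (h : sf ≤ t) (ae : t < sg) :
    R2S (Uu t) (Vv t) ∧ ¬ R2S (Vv t) (Uu t) := by
  have := D.au; have := D.am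
  have aa := S.nat_rel (s := sd) (t := t) om om
  have ad := S.nat_rel (s := sf) (t := t) om om
  unfold Ra; omega

lemma TT.glue (D : S.TT sd sf sg) : S.Phi (R2S) sg = S.Phi (S.Ra sN (sg+NN)) (sg+NN) := by
  have key : ∀ i j, 13 ≤ i → i ≤ 16 → 13 ≤ j → j ≤ 16 →
      S.bt (R2S) sg i j = S.bt (S.Ra sN (sg+NN)) (sg+NN) (29-j) (29-i) := by
    intro i j hi hi' hj dp
    unfold bt
    rw [el_N _ om, el_N _ om, show 29 - (29-j) = j by omega, show 29 - (29-i) = i by omega]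
    have hx := D.cov (El sg i); have hy := D.cov (El sg j)
    have ex := S.pos_el (t := sg) (i := i) om
    have ey := S.pos_el (t := sg) (i := j) om
    have fx := S.flip sf (El sg i); have fy := S.flip sf (El sg j)
    have : R2S (El sg i) (El sg j) ↔ S.Ra sN (sg+NN) (El sg j) (El sg i) := by
      unfold Ra; omega
    by_cases hh : R2S (El sg i) (El sg j)
    · rw [if_pos hh, if_pos (this.1 hh)]
    · rw [if_neg hh, if_neg (fun k => hh (this.2 k))]
  unfold Phi
  rw [key 13 14, key 13 15, key 13 16, key 14 15, key 14 16, key 15 16] <;> norm_num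
  omega

lemma pos_4N (t x) : ps (t+NN+NN+NN+NN) x = ps t x := by rw [S.pos_2N, S.pos_2N]

lemma cn_shift {P : ℕ → Prop} [DecidablePred P] (hP : ∀ t, P (t+NN) ↔ P t) (a b : ℕ) :
    cn P (a+NN) (b+NN) = cn P a b := by
  unfold cn
  symm
  apply Finset.card_bij (fun t _ => t + NN)
  · intro t; simp only [mem_filter, mem_Ico]; rintro ⟨h, ae⟩; exact ⟨om, (hP t).2 ae⟩
  · intro t _ tb _; omega
  · intro t; simp only [mem_filter, mem_Ico]; rintro ⟨h, ae⟩
    have e : t - NN + NN = t := om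
    refine ⟨t - NN, ⟨om, (hP _).1 (by rw [e]; exact ae)⟩, e⟩

open Classical in
lemma TT.sum1 (D : S.TT sd sf sg) : S.Phi (S.Ra sN (sg+NN)) (sg+NN) + cn S.cenQ sf sg
    + cn (S.badQ (R2S)) sf sg ≤ S.Phi (R2S) sf + 3 * cn S.borQ sf sg := by
  rw [← D.glue]
  exact S.Phi_sum D.ao.le (fun t a b => D.R2_uv a b)

open Classical in
lemma TT.bad0 (D : S.TT sd sf sg) (hb : cn S.borQ sf sN = 48) (hc : cn S.cenQ sf sN = 144) :
    cn (S.badQ (R2S)) sf sg = 0 ∧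
    cn (S.badQ (S.Ra (sg+NN+NN) (sd+NN+NN+NN))) (sd+NN+NN+NN) (sf+NN+NN+NN) = 0 := by
  have aa := D.sum1
  have ad := D.rot.sum1
  have af := D.rot.rot.sum1
  have e : S.Ra (sd+NN+NN+NN+NN) (sf+NN+NN+NN+NN) = R2S := by
    ext x y; unfold Ra; simp only [pos_4N]
  have eb : S.Phi (R2S) (sf+NN+NN+NN+NN) = S.Phi (R2S) sf := by
    have : ∀ i, i < 30 → El (sf+NN+NN+NN+NN) i = El sf i := by
      intro i hi
      apply S.ek; rw [pos_4N]; exact S.pos_el hi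
    unfold Phi bt
    simp only [this 13 om, this 14 om, this 15 om, this 16 om]
  rw [e, eb] at af
  simp only [cn_shift S.cenQ_N, cn_shift S.borQ_N] at ad af
  have cc := cn_add S.cenQ (a := sf) (b := sg) (c := sd+NN) D.ao.le D.am.le
  have cd := cn_add S.cenQ (a := sf) (b := sd+NN) (c := sf+NN) (by have := D.ao; have := D.am; omega) (by have := D.au; omega)
  have cf := cn_add S.borQ (a := sf) (b := sg) (c := sd+NN) D.ao.le D.am.le
  have cm := cn_add S.borQ (a := sf) (b := sd+NN) (c := sf+NN) (by have := D.ao; have := D.am; omega) (by have := D.au; omega)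
  rw [cn_shift S.cenQ_N] at cd
  rw [cn_shift S.borQ_N] at cm
  omega

structure Ta (S : SF) (sd sf sg : ℕ) : Prop extends TT S sd sf sg where
  hb : cn S.borQ sf (sf+S.N) = 48
  hc : cn S.cenQ sf (sf+S.N) = 144

local notation "DT" => Ta S sd sf sg
lemma Ta.rot (D : DT) : S.Ta sN (sg+NN) (sd+NN+NN) :=
  ⟨D.toTT.rot, by rw [S.cn_window S.borQ_N _ sf]; exact D.hb, by rw [S.cn_window S.cenQ_N _ sf]; exact D.hc⟩

lemma cn_zero {Q : ℕ → Prop} [DecidablePred Q] {s sk t} (h : cn Q s sk = 0) (aa : s ≤ t) (ad : t < sk) : ¬ Q t := by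
  intro hq
  unfold cn at h
  rw [card_eq_zero, filter_eq_empty_iff] at h
  exact h (mem_Ico.2 ⟨aa, ad⟩) hq

def cen (S : SF) (t : ℕ) (x : Fin 30) : Prop := 13 ≤ S.pos t x ∧ S.pos t x ≤ 16

local notation "Ce" => cen S
lemma Ta.fr2L (D : DT) {t} (h : sf ≤ t) (ae : t < sg) (hl : Le t = 12) {f} (hf : Ce t f) (hfv : f ≠ Vv t) :
    R2S (Uu t) f ∧ ¬ R2S (Vv t) f := by
  classical
  have aa := cn_zero (D.bad0 D.hb D.hc).1 h ae
  unfold badQ at aa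
  have ad : S.freshL (R2S) t := by by_contra hh; exact aa (Or.inl ⟨hl, hh⟩)
  have af := S.pos_ne (t := t) hfv
  have ag := S.huv t
  unfold l at hl
  unfold cen at hf
  have ah := ad (ps t f) om om
  rw [S.el_pos] at ah
  tauto

lemma Ta.fr2R (D : DT) {t} (h : sf ≤ t) (ae : t < sg) (hl : Le t = 16) {f} (hf : Ce t f) (hfv : f ≠ Uu t) :
    R2S f (Vv t) ∧ ¬ R2S f (Uu t) := by
  classical
  have aa := cn_zero (D.bad0 D.hb D.hc).1 h ae
  unfold badQ at aa
  have ad : S.freshR (R2S) t := by by_contra hh; exact aa (Or.inr ⟨hl, hh⟩)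
  have af := S.pos_ne (t := t) hfv
  unfold l at hl
  unfold cen at hf
  have ah := ad (ps t f) om om
  rw [S.el_pos] at ah
  tauto

lemma TT.Bleft (D : S.TT sd sf sg) {t x} (h : sf ≤ t) (ae : t ≤ sg) (hx : 10 ≤ ps sd x) (az : ps sd x < 20) :
    ps t x < 10 := by
  by_contra hc
  have hsub : univ.filter (fun y => ps t y < ps t x) ⊆
      univ.filter (fun y => ps sf y < 10 ∧ y ≠ x) := by
    intro y
    rw [mem_filter, mem_filter]
    rintro ⟨-, hy⟩
    refine ⟨mem_univ _, ?_, fun e => by rw [e] at hy; omega⟩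
    by_contra hb
    have := D.cov x; have := D.cov y; have := D.au; have := D.am
    have := S.btw sf t sg x y h ae om om om
    omega
  have cc := card_le_card hsub
  have cd : (univ.filter (fun y => ps t y < ps t x)).card = ps t x := by
    exact S.rk_univ (by simp) t x
  have cf : (univ.filter (fun y => ps sf y < 10 ∧ y ≠ x)).card ≤ 9 := by
    have : (univ.filter (fun y => ps sf y < 10 ∧ y ≠ x)).card ≤ ((range 10).erase (ps sf x)).card := by
      apply card_le_card_of_injOn (fun y => ps sf y)
      · intro y hy
        rw [Finset.mem_coe, mem_filter] at hy
        rw [Finset.mem_coe, mem_erase, mem_range]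
        exact ⟨S.pos_ne hy.2.2, hy.2.1⟩
      · intro y _ z _ e; exact S.inj _ _ _ e
    rw [card_erase_of_mem (by rw [mem_range]; have := D.cov x; omega)] at this
    simpa using this
  omega

lemma flip3 (t x) : ps (t+NN+NN+NN) x + ps t x = 29 := by
  have := S.flip t x; rw [S.pos_2N (t+NN)]; exact this

lemma uv2N (t) : Uu (t+NN+NN) = Uu t ∧ Vv (t+NN+NN) = Vv t := by
  rw [(S.uN _).1, (S.uN _).2, (S.uN _).2, (S.uN _).1]; exact ⟨rfl, rfl⟩

lemma ln (t) : Le (t+NN+NN) = Le t := by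
  have := S.ld t; have := S.ld (t+NN); omega

lemma TT.Cright (D : S.TT sd sf sg) {t x} (h : sd ≤ t) (ae : t ≤ sf) (hx : 20 ≤ ps sd x) : 20 ≤ ps t x := by
  have aa := D.rot.rot.Bleft (t := t+NN+NN+NN) (x := x) om om
  have := flip3 (S := S) t x
  have := D.cov x; have := S.pos_2N sg x
  have := aa om om
  omega

lemma Ta.fr1L (D : DT) {t} (h : sd ≤ t) (ae : t < sf) (hl : Le t = 12) {f} (hf : Ce t f) (hfv : f ≠ Vv t) :
    (ps sd (Uu t) < 10 ∨ ps sd f < 10 → ps sd (Uu t) < ps sd f) ∧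
    (ps sd (Vv t) < 10 ∨ ps sd f < 10 → ps sd f < ps sd (Vv t)) := by
  have eg : Uu (t+NN+NN+NN) = Vv t := by rw [(S.uN _).1, (uv2N t).2]
  have eb : Vv (t+NN+NN+NN) = Uu t := by rw [(S.uN _).2, (uv2N t).1]
  have eh : Le (t+NN+NN+NN) = 16 := by have := S.ld (t+NN+NN); have := ln (S := S) t; omega
  have ej : Ce (t+NN+NN+NN) f := by have := flip3 (S := S) t f; unfold cen at *; omega
  have aa := D.rot.rot.fr2R (t := t+NN+NN+NN) om om eh ej (by rw [eg]; exact hfv)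
  rw [eg, eb] at aa
  have nf := S.pos_ne (t := sd) hfv
  have a := D.cov f; have b := D.cov (Uu t); have c := D.cov (Vv t)
  have bg := S.pos_2N sg f; have bv := S.pos_2N sg (Uu t); have cf := S.pos_2N sg (Vv t)
  have aq := flip3 (S := S) sd f; have bu := flip3 (S := S) sd (Uu t); have cc := flip3 (S := S) sd (Vv t)
  unfold Ra at aa
  rw [bg, bv, cf] at aa
  omega

lemma Ta.fr1R (D : DT) {t} (h : sd ≤ t) (ae : t < sf) (hl : Le t = 16) {f} (hf : Ce t f) (hfv : f ≠ Uu t) :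
    (ps sd (Vv t) < 10 ∨ ps sd f < 10 → ps sd f < ps sd (Vv t)) ∧
    (ps sd (Uu t) < 10 ∨ ps sd f < 10 → ps sd (Uu t) < ps sd f) := by
  have eg : Uu (t+NN+NN+NN) = Vv t := by rw [(S.uN _).1, (uv2N t).2]
  have eb : Vv (t+NN+NN+NN) = Uu t := by rw [(S.uN _).2, (uv2N t).1]
  have eh : Le (t+NN+NN+NN) = 12 := by have := S.ld (t+NN+NN); have := ln (S := S) t; omega
  have ej : Ce (t+NN+NN+NN) f := by have := flip3 (S := S) t f; unfold cen at *; omega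
  have aa := D.rot.rot.fr2L (t := t+NN+NN+NN) om om eh ej (by rw [eb]; exact hfv)
  rw [eg, eb] at aa
  have nf := S.pos_ne (t := sd) hfv
  have a := D.cov f; have b := D.cov (Uu t); have c := D.cov (Vv t)
  have bg := S.pos_2N sg f; have bv := S.pos_2N sg (Uu t); have cf := S.pos_2N sg (Vv t)
  have aq := flip3 (S := S) sd f; have bu := flip3 (S := S) sd (Uu t); have cc := flip3 (S := S) sd (Vv t)
  unfold Ra at aa
  rw [bg, bv, cf] at aa
  omega

lemma Ta.frL (D : DT) {t} (h : sd ≤ t) (ae : t < sg) (hl : Le t = 12) {f} (hf : Ce t f) (hfv : f ≠ Vv t) :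
    (ps sd (Uu t) < 10 ∨ ps sd f < 10 → ps sd (Uu t) < ps sd f) ∧
    (ps sd (Vv t) < 10 ∨ ps sd f < 10 → ps sd f < ps sd (Vv t)) := by
  rcases Nat.lt_or_ge t sf with ad | ad
  · exact D.fr1L h ad hl hf hfv
  have aa := D.fr2L ad ae hl hf hfv
  have nf := S.pos_ne (t := sd) hfv
  have nf2 := S.pos_ne (t := sf) hfv
  have a := D.cov f; have b := D.cov (Uu t); have c := D.cov (Vv t)
  have aq := D.Bleft (x := f) ad ae.le; have bu := D.Bleft (x := Uu t) ad ae.le; have cc := D.Bleft (x := Vv t) ad ae.le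
  have p := S.huv t
  unfold l at hl; unfold cen at hf; unfold Ra at aa
  omega

lemma Ta.frR (D : DT) {t} (h : sd ≤ t) (ae : t < sg) (hl : Le t = 16) {f} (hf : Ce t f) (hfv : f ≠ Uu t) :
    (ps sd (Vv t) < 10 ∨ ps sd f < 10 → ps sd f < ps sd (Vv t)) ∧
    (ps sd (Uu t) < 10 ∨ ps sd f < 10 → ps sd (Uu t) < ps sd f) := by
  rcases Nat.lt_or_ge t sf with ad | ad
  · exact D.fr1R h ad hl hf hfv
  have aa := D.fr2R ad ae hl hf hfv
  have nf := S.pos_ne (t := sd) hfv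
  have nf2 := S.pos_ne (t := sf) hfv
  have a := D.cov f; have b := D.cov (Uu t); have c := D.cov (Vv t)
  have aq := D.Bleft (x := f) ad ae.le; have bu := D.Bleft (x := Uu t) ad ae.le; have cc := D.Bleft (x := Vv t) ad ae.le
  have p := S.huv t
  unfold l at hl; unfold cen at hf; unfold Ra at aa
  omega

lemma sum_step (S : SF) (g : Fin 30 → ℕ → ℕ) (t) :
    ∑ x, g x (S.pos (t+1) x) + g (S.u t) (S.l t) + g (S.v t) (S.l t + 1) =
    ∑ x, g x (S.pos t x) + g (S.u t) (S.l t + 1) + g (S.v t) (S.l t) := by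
  have hne := S.ud t
  have hm : S.v t ∈ univ.erase (S.u t) := mem_erase.2 ⟨hne.symm, mem_univ _⟩
  rw [← add_sum_erase _ _ (mem_univ (S.u t)), ← add_sum_erase _ _ hm,
    ← add_sum_erase (a := S.u t) _ (fun x => g x (S.pos t x)) (mem_univ (S.u t)),
    ← add_sum_erase _ (fun x => g x (S.pos t x)) hm]
  have : ∑ x ∈ (univ.erase (S.u t)).erase (S.v t), g x (S.pos (t+1) x) =
     ∑ x ∈ (univ.erase (S.u t)).erase (S.v t), g x (S.pos t x) := by
    apply Finset.sum_congr rfl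
    intro x hx
    rw [mem_erase, mem_erase] at hx
    rw [S.hx t x hx.2.1 hx.1]
  rw [this, S.hu, S.hv, S.huv]
  unfold l
  omega

lemma sum_pos (S : SF) (f : ℕ → ℕ) (t) : ∑ x, f (S.pos t x) = ∑ i ∈ range 30, f i := by
  apply Finset.sum_bij (fun x _ => S.pos t x)
  · intro x _; exact mem_range.2 (S.lt t x)
  · intro x _ y _ e; exact S.inj t x y e
  · intro i hi; obtain ⟨x, hx⟩ := S.pos_surj t (mem_range.1 hi); exact ⟨x, mem_univ _, hx⟩
  · intro x _; rfl

def wt (p : ℕ) : ℕ := min 3 (16 - p)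

lemma w15 : ∑ i ∈ range 30, (fun p => if 10 ≤ p then wt p else 0) i ≤ 15 := by decide +kernel
lemma wa : ∑ i ∈ range 30, (fun p => if p < 4 then wt p else 0) i ≤ 12 := by decide +kernel
lemma ci : (((Ico 0 4) ×ˢ (Ico 0 4)).filter (fun p => p.1 < p.2)).card = 6 := by decide +kernel
lemma c15 : (((Ico 4 10) ×ˢ (Ico 4 10)).filter (fun p => p.1 < p.2)).card = 15 := by decide +kernel

open Classical in
noncomputable def W (S : SF) (A : Fin 30 → Prop) (t : ℕ) : ℕ := ∑ x, if A x then wt (S.pos t x) else 0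

open Classical in
lemma W_sum (A : Fin 30 → Prop) {s sk : ℕ} (hs : s ≤ sk)
    (hA : ∀ t, s ≤ t → t < sk → ¬ (A (Vv t) ∧ ¬ A (Uu t)) ∨ ¬ S.cenQ t)
    (Q : ℕ → Prop) [DecidablePred Q] (hQ : ∀ t, Q t ↔ (S.cenQ t ∧ A (Uu t) ∧ ¬ A (Vv t))) :
    cn Q s sk + S.W A sk = S.W A s := by
  induction sk, hs using Nat.le_induction with
  | base => simp [cn_self]
  | succ n hn ih =>
    have aa := ih (fun t a b => hA t a om)
    have ad := hA n hn om
    have af := S.sum_step (fun x p => if A x then wt p else 0) n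
    rw [cn_succ _ hn]
    have hq := hQ n
    have eg : S.W A (n+1) = ∑ x, if A x then wt (ps (n+1) x) else 0 := rfl
    have eb : S.W A n = ∑ x, if A x then wt (ps n x) else 0 := rfl
    rw [← eg, ← eb] at af
    by_cases hu : A (Uu n) <;> by_cases hv : A (Vv n) <;> by_cases hc : S.cenQ n <;>
      simp only [hu, hv, hc, if_true, if_false, and_true, and_false, true_and, false_and, not_true, not_false_iff, or_false, or_true, iff_true, iff_false] at ad af hq ⊢ <;> simp only [hq, if_true, if_false] <;>
      unfold cenQ at hc <;> (try unfold wt at af) <;> omega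

lemma cn_cov {Q Qa Qb : ℕ → Prop} [DecidablePred Q] [DecidablePred Qa] [DecidablePred Qb] {s sk : ℕ}
    (h : ∀ t, s ≤ t → t < sk → Q t → Qa t ∨ Qb t) : cn Q s sk ≤ cn Qa s sk + cn Qb s sk := by
  unfold cn
  refine le_trans (card_le_card ?_) (card_union_le _ _)
  intro t ht
  rw [mem_filter, mem_Ico] at ht
  rw [mem_union, mem_filter, mem_filter, mem_Ico]
  have := h t ht.1.1 ht.1.2 ht.2
  tauto

lemma cn_disj {Q Qa Qb : ℕ → Prop} [DecidablePred Q] [DecidablePred Qa] [DecidablePred Qb] {s sk : ℕ}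
    (h : ∀ t, s ≤ t → t < sk → (Qa t ∨ Qb t → Q t) ∧ ¬ (Qa t ∧ Qb t)) : cn Qa s sk + cn Qb s sk ≤ cn Q s sk := by
  unfold cn
  rw [← card_union_of_disjoint]
  · apply card_le_card
    intro t ht
    rw [mem_union, mem_filter, mem_filter, mem_Ico] at ht
    rw [mem_filter, mem_Ico]
    have := h t (by tauto) (by tauto)
    tauto
  · rw [Finset.disjoint_left]
    intro t ht bn
    rw [mem_filter, mem_Ico] at ht bn
    exact (h t ht.1.1 ht.1.2).2 ⟨ht.2, bn.2⟩

def prQ (S : SF) (s a b t : ℕ) : Prop :=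
  (a ≤ S.pos s (S.u t) ∧ S.pos s (S.u t) < b) ∧ (a ≤ S.pos s (S.v t) ∧ S.pos s (S.v t) < b)
def prC (S : SF) (s a b t : ℕ) : Prop := S.prQ s a b t ∧ S.cenQ t
def prN (S : SF) (s a b t : ℕ) : Prop := S.prQ s a b t ∧ ¬ S.cenQ t
def ko (S : SF) (s t : ℕ) : Prop := S.cenQ t ∧ S.pos s (S.u t) < 4 ∧ ¬ S.pos s (S.v t) < 4
def koA (S : SF) (s t : ℕ) : Prop := S.ko s t ∧ ¬ 10 ≤ S.pos s (S.v t)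
def koB (S : SF) (s t : ℕ) : Prop := S.ko s t ∧ 10 ≤ S.pos s (S.v t)
def koU (S : SF) (s t : ℕ) : Prop := S.prC s 4 10 t ∨ S.koA s t
noncomputable instance (s a b) : DecidablePred (S.prQ s a b) := Classical.decPred _
noncomputable instance (s a b) : DecidablePred (S.prC s a b) := Classical.decPred _
noncomputable instance (s a b) : DecidablePred (S.prN s a b) := Classical.decPred _
noncomputable instance (s) : DecidablePred (S.ko s) := Classical.decPred _
noncomputable instance (s) : DecidablePred (S.koA s) := Classical.decPred _
noncomputable instance (s) : DecidablePred (S.koB s) := Classical.decPred _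
noncomputable instance (s) : DecidablePred (S.koU s) := Classical.decPred _

lemma cn_pairs (S : SF) (s a b : ℕ) : cn (S.prQ s a b) s (s+S.N)
    ≤ (((Ico a b) ×ˢ (Ico a b)).filter (fun p => p.1 < p.2)).card := by
  unfold cn
  apply card_le_card_of_injOn (fun t => (S.pos s (S.u t), S.pos s (S.v t)))
  · intro t ht
    rw [Finset.mem_coe, mem_filter, mem_Ico] at ht
    have := S.nat_rel ht.1.1 ht.1.2
    rw [Finset.mem_coe, mem_filter, mem_product, mem_Ico, mem_Ico]
    exact ⟨ht.2, this.1⟩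
  · intro t ht tb bn e
    rw [Finset.mem_coe, mem_filter, mem_Ico] at ht bn
    simp only [Prod.mk.injEq] at e
    have eg := S.inj _ _ _ e.1
    have eb := S.inj _ _ _ e.2
    by_contra hne
    rcases Nat.lt_or_gt_of_ne hne with h | h
    · exact S.swap_unique t tb h om (Or.inl ⟨eg, eb⟩)
    · exact S.swap_unique tb t h om (Or.inl ⟨eg.symm, eb.symm⟩)

def monoQ (S : SF) (s : ℕ) (t : ℕ) : Prop := S.cenQ t ∧ S.pos s (S.u t) < 10 ∧ S.pos s (S.v t) < 10
def acQ (S : SF) (s : ℕ) (t : ℕ) : Prop := S.cenQ t ∧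
  ((S.pos s (S.u t) < 10 ∧ 20 ≤ S.pos s (S.v t)) ∨ (S.pos s (S.v t) < 10 ∧ 20 ≤ S.pos s (S.u t)))

instance (s) : DecidablePred (S.monoQ s) := fun t => by unfold monoQ; infer_instance
instance (s) : DecidablePred (S.acQ s) := fun t => by unfold acQ; infer_instance

lemma monoQ_N (s t) : S.monoQ s (t+NN) ↔ S.monoQ s t := by
  unfold monoQ; rw [S.cenQ_N, (S.uN t).1, (S.uN t).2]; tauto
lemma acQ_N (s t) : S.acQ s (t+NN) ↔ S.acQ s t := by
  unfold acQ; rw [S.cenQ_N, (S.uN t).1, (S.uN t).2]; tauto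

open Classical in
lemma TT.ac_le (D : S.TT sd sf sg) : cn (S.acQ sd) sf sN ≤ 15 := by
  have au := D.au; have ao := D.ao; have am := D.am
  have aa := W_sum (S := S) (fun x => ps sd x < 10) (s := sf) (sk := sg) D.ao.le (by
    intro t a b
    by_cases hc : S.cenQ t
    · left
      have aq := D.Bleft (x := Uu t) a b.le; have c := D.cov (Uu t); have cp := D.cov (Vv t)
      have := S.nat_rel (s := sf) (t := t) om om
      have : Le t = ps t (Uu t) := rfl
      unfold cenQ at hc; omega
    · exact Or.inr hc) (fun t => S.cenQ t ∧ ps sd (Uu t) < 10 ∧ ¬ ps sd (Vv t) < 10) (fun t => Iff.rfl)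
  have ad : S.W (fun x => ps sd x < 10) sf ≤ 15 := by
    have : S.W (fun x => ps sd x < 10) sf ≤ ∑ x, (fun p => if 10 ≤ p then wt p else 0) (ps sf x) := by
      unfold W
      apply sum_le_sum
      intro x _
      have := D.cov x
      by_cases h : ps sd x < 10
      · rw [if_pos h]; beta_reduce; rw [if_pos om]
      · rw [if_neg h]; omega
    rw [S.sum_pos (fun p => if 10 ≤ p then wt p else 0) sf] at this
    exact this.trans w15
  have af := cn_add (S.acQ sd) (a := sf) (b := sg) (c := sf+NN) om om
  have ag : cn (S.acQ sd) sg sN = 0 := by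
    unfold cn
    rw [card_eq_zero, filter_eq_empty_iff]
    intro t ht hq
    rw [mem_Ico] at ht
    have c := D.cov (Uu t); have cp := D.cov (Vv t)
    have := S.nat_rel (s := sf) (t := t) om om
    have := S.nat_rel (s := sg) (t := t) om om
    unfold acQ at hq; omega
  have ah : cn (S.acQ sd) sf sg ≤ cn (fun t => S.cenQ t ∧ ps sd (Uu t) < 10 ∧ ¬ ps sd (Vv t) < 10) sf sg := by
    unfold cn
    apply card_le_card
    intro t
    rw [mem_filter, mem_filter]
    rintro ⟨ht, hq⟩
    refine ⟨ht, ?_⟩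
    rw [mem_Ico] at ht
    have c := D.cov (Uu t); have cp := D.cov (Vv t)
    have := S.nat_rel (s := sf) (t := t) om om
    unfold acQ at hq
    exact ⟨hq.1, om⟩
  omega

lemma mono_le (S : SF) (s : ℕ) : cn (S.monoQ s) s (s+S.N)
    + cn (S.prN s 0 4) s (s+S.N) + cn (S.prN s 4 10) s (s+S.N) + cn (S.koB s) s (s+S.N) ≤ 33 := by
  have aa := S.cn_pairs s 0 4
  have ad := S.cn_pairs s 4 10
  rw [ci] at aa
  rw [c15] at ad
  have af := W_sum (S := S) (fun x => S.pos s x < 4) (s := s) (sk := s + S.N) om (by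
    intro t a b
    left
    have := S.nat_rel a b; omega) (S.ko s) (fun t => Iff.rfl)
  have ag : S.W (fun x => S.pos s x < 4) s ≤ 12 := by
    have : S.W (fun x => S.pos s x < 4) s ≤ ∑ x, (fun p => if p < 4 then wt p else 0) (S.pos s x) := by
      unfold W
      apply sum_le_sum
      intro x _
      by_cases h : S.pos s x < 4
      · rw [if_pos h]; beta_reduce; rw [if_pos h]
      · rw [if_neg h]; omega
    rw [S.sum_pos (fun p => if p < 4 then wt p else 0) s] at this
    exact this.trans wa
  have df := cn_disj (s := s) (sk := s+S.N) (Q := S.prQ s 0 4) (Qa := S.prN s 0 4) (Qb := S.prC s 0 4)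
    (fun t _ _ => ⟨fun h => h.elim (fun k => k.1) (fun k => k.1), fun h => h.1.2 h.2.2⟩)
  have dh := cn_disj (s := s) (sk := s+S.N) (Q := S.prQ s 4 10) (Qa := S.prN s 4 10) (Qb := S.prC s 4 10)
    (fun t _ _ => ⟨fun h => h.elim (fun k => k.1) (fun k => k.1), fun h => h.1.2 h.2.2⟩)
  have d3 := cn_disj (s := s) (sk := s+S.N) (Q := S.ko s) (Qa := S.koA s) (Qb := S.koB s)
    (fun t _ _ => ⟨fun h => h.elim (fun k => k.1) (fun k => k.1), fun h => h.1.2 h.2.2⟩)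
  have eg := cn_cov (s := s) (sk := s+S.N) (Q := S.monoQ s) (Qa := S.prC s 0 4) (Qb := S.koU s)
    (by
      intro t a b
      rintro ⟨h, ae, cq⟩
      have := S.nat_rel a b
      unfold koU prC koA ko prQ
      by_cases k : S.pos s (S.u t) < 4 <;> by_cases kf : S.pos s (S.v t) < 4
      · left; exact ⟨om, h⟩
      · right; right; exact ⟨⟨h, k, kf⟩, om⟩
      · omega
      · right; left; exact ⟨om, h⟩)
  have eb := cn_cov (s := s) (sk := s+S.N) (Q := S.koU s) (Qa := S.prC s 4 10) (Qb := S.koA s)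
    (by intro t _ _ h; exact h)
  omega

lemma cn_per {Q : ℕ → Prop} [DecidablePred Q] (hQ : ∀ t, Q (t+NN) ↔ Q t) (s sk) : cn Q s (s+NN) = cn Q sk (sk+NN) :=
  S.cn_window hQ s sk

lemma Ta.mono_eq (D : DT) : 33 ≤ cn (S.monoQ sd) sd (sd+NN) := by
  have aq := D.ac_le
  have aj := D.rot.ac_le
  have bg := D.rot.rot.ac_le
  have mc := S.mono_le sN
  have md := S.mono_le (sg+NN+NN)
  rw [cn_per (acQ_N sd) _ sf] at aq
  rw [cn_per (acQ_N _) _ sf] at aj bg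
  rw [cn_per (monoQ_N _) _ sf] at mc md ⊢
  have hc := D.hc
  have cc := cn_cov (Q := S.cenQ) (s := sf) (sk := sf+NN) (Qa := fun t => (S.monoQ sd t ∨ S.monoQ sN t) ∨ S.monoQ (sg+NN+NN) t)
    (Qb := fun t => (S.acQ sd t ∨ S.acQ sN t) ∨ S.acQ (sg+NN+NN) t) (by
    intro t _ _ h
    have a := D.cov (Uu t); have b := D.cov (Vv t)
    have fa := S.flip sf (Uu t); have fb := S.flip sf (Vv t)
    have fc := S.pos_2N sg (Uu t); have f4 := S.pos_2N sg (Vv t)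
    unfold monoQ acQ
    simp only [h, true_and]
    omega)
  have cd := cn_cov (s := sf) (sk := sf+NN) (Q := fun t => (S.monoQ sd t ∨ S.monoQ sN t) ∨ S.monoQ (sg+NN+NN) t)
    (Qa := fun t => (S.monoQ sd t ∨ S.monoQ sN t)) (Qb := S.monoQ (sg+NN+NN)) (fun t _ _ h => h)
  have cf := cn_cov (s := sf) (sk := sf+NN) (Q := fun t => (S.monoQ sd t ∨ S.monoQ sN t)) (Qa := S.monoQ sd)
    (Qb := S.monoQ sN) (fun t _ _ h => h)
  have cm := cn_cov (s := sf) (sk := sf+NN) (Q := fun t => (S.acQ sd t ∨ S.acQ sN t) ∨ S.acQ (sg+NN+NN) t)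
    (Qa := fun t => (S.acQ sd t ∨ S.acQ sN t)) (Qb := S.acQ (sg+NN+NN)) (fun t _ _ h => h)
  have cj := cn_cov (s := sf) (sk := sf+NN) (Q := fun t => (S.acQ sd t ∨ S.acQ sN t)) (Qa := S.acQ sd)
    (Qb := S.acQ sN) (fun t _ _ h => h)
  omega

lemma Ta.F12 (D : DT) {t} (h : sd ≤ t) (ae : t < sd + NN)
    (hk : (ps sd (Uu t) < 4 ∧ ps sd (Vv t) < 4) ∨ ((4 ≤ ps sd (Uu t) ∧ ps sd (Uu t) < 10) ∧ (4 ≤ ps sd (Vv t) ∧ ps sd (Vv t) < 10))) :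
    S.cenQ t := by
  have aa := D.mono_eq
  have ad := S.mono_le sd
  by_contra hc
  rcases hk with hk | hk
  · exact cn_zero (s := sd) (sk := sd+NN) (Q := S.prN sd 0 4) om h ae ⟨by unfold prQ; omega, hc⟩
  · exact cn_zero (s := sd) (sk := sd+NN) (Q := S.prN sd 4 10) om h ae ⟨by unfold prQ; omega, hc⟩

lemma Ta.F3 (D : DT) {t} (h : sd ≤ t) (ae : t < sd + NN) (hc : S.cenQ t)
    (hk : ps sd (Uu t) < 4) : ps sd (Vv t) < 10 := by
  have aa := D.mono_eq
  have ad := S.mono_le sd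
  by_contra hv
  exact cn_zero (s := sd) (sk := sd+NN) (Q := S.koB sd) om h ae ⟨⟨hc, hk, om⟩, om⟩

lemma first_exit {P : ℕ → Prop} {a b : ℕ} (h : a ≤ b) (ha : P a) (hb : ¬ P b) :
    ∃ n, a ≤ n ∧ n < b ∧ (∀ m, a ≤ m → m ≤ n → P m) ∧ ¬ P (n+1) := by
  by_contra hc
  push Not at hc
  have : ∀ n, a ≤ n → n ≤ b → ∀ m, a ≤ m → m ≤ n → P m := by
    intro n hn
    induction n, hn using Nat.le_induction with
    | base => intro _ m aa ad; rw [show m = a by omega]; exact ha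
    | succ n hn ih =>
      intro af m aa ad
      rcases Nat.lt_or_ge m (n+1) with ag | ag
      · exact ih om m aa om
      · rw [show m = n+1 by omega]; exact hc n hn om (ih om)
  exact hb (this b h le_rfl b h le_rfl)

lemma last_entry {P : ℕ → Prop} {a b : ℕ} (h : a ≤ b) (ha : ¬ P a) (hb : P b) :
    ∃ n, a ≤ n ∧ n < b ∧ (∀ m, n < m → m ≤ b → P m) ∧ ¬ P n := by
  by_contra hc
  push Not at hc
  have : ∀ k, k ≤ b - a → ∀ m, b - k ≤ m → m ≤ b → P m := by
    intro k
    induction k with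
    | zero => intro _ m aa ad; rw [show m = b by omega]; exact hb
    | succ k ih =>
      intro af m aa ad
      rcases Nat.lt_or_ge m (b - k) with ag | ag
      · exact hc m om om (fun j hj dp => ih om j om dp)
      · exact ih om m ag ad
  exact ha (this (b-a) le_rfl a om h)

lemma cen_out {t x} (h : Ce t x) (ae : ¬ Ce (t+1) x) : (Le t = 12 ∧ x = Vv t) ∨ (Le t = 16 ∧ x = Uu t) := by
  have aa := S.bb t x
  have ad := S.huv t; have af := S.hu t; have ag := S.hv t
  unfold cen at *; unfold l
  rcases aa with rfl | rfl | aa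
  · right; exact ⟨om, rfl⟩
  · left; exact ⟨om, rfl⟩
  · omega

lemma cen_in {t x} (h : ¬ Ce t x) (ae : Ce (t+1) x) : (Le t = 12 ∧ x = Uu t) ∨ (Le t = 16 ∧ x = Vv t) := by
  have aa := S.bb t x
  have ad := S.huv t; have af := S.hu t; have ag := S.hv t
  unfold cen at *; unfold l
  rcases aa with rfl | rfl | aa
  · left; exact ⟨om, rfl⟩
  · right; exact ⟨om, rfl⟩
  · omega

lemma right_out {t x} (h : 17 ≤ ps t x) (ae : ¬ 17 ≤ ps (t+1) x) : Le t = 16 ∧ x = Vv t := by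
  have aa := S.bb t x
  have ad := S.huv t; have af := S.hu t; have ag := S.hv t
  unfold l
  rcases aa with rfl | rfl | aa
  · omega
  · exact ⟨om, rfl⟩
  · omega
lemma right_in {t x} (h : ¬ 17 ≤ ps t x) (ae : 17 ≤ ps (t+1) x) : Le t = 16 ∧ x = Uu t := by
  have aa := S.bb t x
  have ad := S.huv t; have af := S.hu t; have ag := S.hv t
  unfold l
  rcases aa with rfl | rfl | aa
  · exact ⟨om, rfl⟩
  · omega
  · omega
lemma left_in {t x} (h : 13 ≤ ps t x) (ae : ¬ 13 ≤ ps (t+1) x) : Le t = 12 ∧ x = Vv t := by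
  have aa := S.bb t x
  have ad := S.huv t; have af := S.hu t; have ag := S.hv t
  unfold l
  rcases aa with rfl | rfl | aa
  · omega
  · exact ⟨om, rfl⟩
  · omega
lemma left_out {t x} (h : ¬ 13 ≤ ps t x) (ae : 13 ≤ ps (t+1) x) : Le t = 12 ∧ x = Uu t := by
  have aa := S.bb t x
  have ad := S.huv t; have af := S.hu t; have ag := S.hv t
  unfold l
  rcases aa with rfl | rfl | aa
  · exact ⟨om, rfl⟩
  · omega
  · omega

lemma Ta.stayF (D : DT) {x y t tb} (hx : ps sd x < 10) (hxy : ps sd x < ps sd y) (h : sd ≤ t) (ae : t ≤ tb)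
    (cq : tb ≤ sg) (cx : Ce t x) (cy : Ce t y) (u' : ps tb x < ps tb y) : Ce tb x ∧ Ce tb y := by
  by_contra hc
  have am := D.am
  obtain ⟨n, aa, ad, af, ag⟩ := first_exit (P := fun m => Ce m x ∧ Ce m y) ae ⟨cx, cy⟩ hc
  obtain ⟨cc, cd⟩ := af n aa le_rfl
  have hb := S.btw sd n tb x y om om om hxy u'
  have hne : x ≠ y := by rintro rfl; omega
  by_cases hh : Ce (n+1) x
  · have hy : ¬ Ce (n+1) y := fun k => ag ⟨hh, k⟩
    rcases cen_out cd hy with ⟨e, rfl⟩ | ⟨e, rfl⟩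
    · have := S.huv n; unfold l at e; unfold cen at cc; omega
    · have := D.frR om om e cc hne; omega
  · rcases cen_out cc hh with ⟨e, rfl⟩ | ⟨e, rfl⟩
    · have := D.frL om om e cd hne.symm; omega
    · unfold l at e; unfold cen at cd; omega

lemma Ta.stayB (D : DT) {x y t tb} (hx : ps sd x < 10) (hxy : ps sd x < ps sd y) (h : sd ≤ tb) (ae : tb ≤ t)
    (cq : t ≤ sg) (cx : Ce t x) (cy : Ce t y) (u' : ¬ ps tb x < ps tb y) : Ce tb x ∧ Ce tb y := by
  by_contra hc
  have am := D.am
  have hne : x ≠ y := by rintro rfl; omega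
  obtain ⟨n, aa, ad, af, ag⟩ := last_entry (P := fun m => Ce m x ∧ Ce m y) ae hc ⟨cx, cy⟩
  obtain ⟨cc, cd⟩ := af (n+1) om om
  have hb : ¬ ps n x < ps n y := by
    intro k
    have := S.btw sd tb n x y om om om hxy k
    omega
  have hn := S.pos_ne (t := n) hne
  by_cases hh : Ce n x
  · have hy : ¬ Ce n y := fun k => ag ⟨hh, k⟩
    rcases cen_in hy cd with ⟨e, rfl⟩ | ⟨e, rfl⟩
    · have q : x ≠ Vv n := by
        rintro rfl
        have := S.hv n; unfold l at e; unfold cen at cc; omega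
      have := D.frL om om e hh q; omega
    · have := S.huv n; unfold l at e; unfold cen at hh; omega
  · have hy : Ce n y := by
      by_contra k
      have a := cen_in hh cc; have b := cen_in k cd
      rcases a with ⟨a, rfl⟩ | ⟨a, rfl⟩ <;> rcases b with ⟨b, bj⟩ | ⟨b, bj⟩
      · exact hne bj.symm
      · omega
      · omega
      · exact hne bj.symm
    rcases cen_in hh cc with ⟨e, rfl⟩ | ⟨e, rfl⟩
    · unfold l at e; unfold cen at hy; omega
    · have q : y ≠ Uu n := by
        rintro rfl
        have := S.hu n; unfold l at e; unfold cen at cd; omega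
      have := D.frR om om e hy q; omega

lemma Ta.CS (D : DT) {x y t} (hx : ps sd x < 4) (h : sd ≤ t) (ae : t ≤ sg)
    (cx : Ce t x) (cy : Ce t y) : ps sd y < 10 := by
  by_contra hy
  have am := D.am
  have a := D.cov x; have b := D.cov y
  rcases Nat.lt_or_ge (ps t x) (ps t y) with k | k
  · obtain ⟨r, rb, rc, rf, rh⟩ := S.exists_swap t sg x y ae k om
    have kg := S.swap_lt r
    rw [rf, rh] at kg
    have := D.stayF (t := t) (tb := r) om om h rb om cx cy kg
    have e := S.huv r
    rw [rf, rh] at e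
    have := D.F3 (t := r) om om (by unfold cenQ l; unfold cen at this; rw [rf]; omega) (by rw [rf]; exact hx)
    rw [rh] at this; omega
  · obtain ⟨r, rb, rc, rf, rh⟩ := S.exists_swap sd t x y h om om
    have kg := S.swap_lt' r
    rw [rf, rh] at kg
    have := D.stayB (t := t) (tb := r+1) (x := x) (y := y) om om om om ae cx cy om
    have e := S.hu r; have ei := S.hv r
    rw [rf] at e; rw [rf, rh] at ei
    have := D.F3 (t := r) om om (by unfold cenQ l; unfold cen at this; rw [rf]; omega) (by rw [rf]; exact hx)
    rw [rh] at this; omega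

lemma cen_el {t j} (h : 13 ≤ j) (ae : j ≤ 16) : Ce t (El t j) := by
  unfold cen; rw [S.pos_el om]; omega

lemma el_ne_el {t i j} (hi : i < 30) (hj : j < 30) (h : i ≠ j) : El t i ≠ El t j := by
  intro e; have a := S.pos_el (t := t) hi; rw [e, S.pos_el hj] at a; omega

lemma Ta.rb (D : DT) {t} (h : sd ≤ t) (ae : t < sg) (hl : Le t = 16) : ¬ ps sd (Vv t) < 4 := by
  intro hv
  have hu := S.eu t; rw [hl] at hu
  have a := D.frR h ae hl (cen_el (j := 13) om om) (by rw [← hu]; exact el_ne_el om om om)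
  have b := D.frR h ae hl (cen_el (j := 14) om om) (by rw [← hu]; exact el_ne_el om om om)
  have c := D.frR h ae hl (cen_el (j := 15) om om) (by rw [← hu]; exact el_ne_el om om om)
  have nb := S.pos_ne (t := sd) (el_ne_el (S := S) (t := t) (i := 13) (j := 14) om om om)
  have nh := S.pos_ne (t := sd) (el_ne_el (S := S) (t := t) (i := 13) (j := 15) om om om)
  have nj := S.pos_ne (t := sd) (el_ne_el (S := S) (t := t) (i := 14) (j := 15) om om om)
  omega

lemma Ta.rc (D : DT) {t} (h : sd ≤ t) (ae : t < sg) (hl : Le t = 12) : ¬ ps sd (Vv t) < 4 := by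
  intro hv
  have hu := S.ev t; rw [hl] at hu
  have a := D.frL h ae hl (cen_el (j := 14) om om) (by rw [← hu]; exact el_ne_el om om om)
  have b := D.frL h ae hl (cen_el (j := 15) om om) (by rw [← hu]; exact el_ne_el om om om)
  have c := D.frL h ae hl (cen_el (j := 16) om om) (by rw [← hu]; exact el_ne_el om om om)
  have nb := S.pos_ne (t := sd) (el_ne_el (S := S) (t := t) (i := 14) (j := 15) om om om)
  have nh := S.pos_ne (t := sd) (el_ne_el (S := S) (t := t) (i := 14) (j := 16) om om om)
  have nj := S.pos_ne (t := sd) (el_ne_el (S := S) (t := t) (i := 15) (j := 16) om om om)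
  omega

lemma Ta.rf (D : DT) {t} (h : sd ≤ t) (ae : t < sd + NN) (hl : Le t = 12 ∨ Le t = 16) :
    ¬ ((4 ≤ ps sd (Uu t) ∧ ps sd (Uu t) < 10) ∧ (4 ≤ ps sd (Vv t) ∧ ps sd (Vv t) < 10)) := by
  intro k
  have := D.F12 h ae (Or.inr k)
  unfold cenQ at this; omega

structure Tau (S : SF) (sd sg τ : ℕ) : Prop where
  aa : sd ≤ τ
  ad : τ < sg
  hl : S.l τ = 14
  hu : S.pos sd (S.u τ) = 0
  hK : ∀ y, S.pos sd y < 4 → S.cen τ y ∧ S.cen (τ+1) y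

local notation "TU" => Tau S sd sg τ
lemma mono0 {x : Fin 30} (hx : ps sd x = 0) {t tb} (h : sd ≤ t) (ae : t ≤ tb) (cq : tb ≤ sd+NN) : ps t x ≤ ps tb x := by
  induction tb, ae using Nat.le_induction with
  | base => exact le_rfl
  | succ n hn ih =>
    have := ih om
    have aa := S.bb n x
    have ad := S.huv n; have af := S.hu n; have ag := S.hv n
    have ah := S.nat_rel (s := sd) (t := n) om om
    rcases aa with aa | aa | aa
    · rw [aa] at this ⊢; omega
    · rw [← aa] at ah; omega
    · omega

lemma Ta.exists_tau (D : DT) : ∃ τ, S.Tau sd sg τ := by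
  have au := D.au; have ao := D.ao; have am := D.am
  have hx := S.pos_el (t := sd) (i := 0) om
  set x := El sd 0 with hxd
  have hc := D.cov x
  obtain ⟨τ, a, b, c, d⟩ := first_exit (P := fun m => ps m x ≤ 14) (a := sd) (b := sg) om om om
  have cp := c τ a le_rfl
  have hu : Uu τ = x ∧ Le τ = 14 := by
    have aa := S.bb τ x
    have ad := S.huv τ; have af := S.hu τ; have ag := S.hv τ
    unfold l
    rcases aa with aa | aa | aa
    · rw [← aa] at ad af ag ⊢; exact ⟨rfl, om⟩
    · rw [aa] at cp d; omega
    · omega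
  have pτ : ps τ x = 14 := by rw [← hu.1]; exact hu.2
  have pτ' : ps (τ+1) x = 15 := by have := S.hu τ; rw [hu.1] at this; omega
  have hcen : ∀ y, ps sd y < 4 → Ce τ y := by
    intro y hy
    by_cases hyx : y = x
    · rw [hyx]; unfold cen; omega
    have hn := S.pos_ne (t := sd) hyx
    have fl1 := S.flip sd x; have fl2 := S.flip sd y
    obtain ⟨r, rb, rc, rf, rh⟩ := S.exists_swap sd (sd+NN) x y om om om
    have hq := D.F12 rb rc (Or.inl (by rw [rf, rh]; omega))
    have e := S.huv r; rw [rf, rh] at e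
    have hq' : 13 ≤ ps r x ∧ ps r x ≤ 15 := by unfold cenQ l at hq; rw [rf] at hq; omega
    have hr3 : r < sg := by
      by_contra k
      have := mono0 (S := S) hx (t := sg) (tb := r) om om om; omega
    have cry : Ce r y := by unfold cen; omega
    by_contra hny
    rcases Nat.lt_or_ge r τ with k | k
    · obtain ⟨n, nb, nh, nj, nk⟩ := first_exit (P := fun m => Ce m y) k.le cry hny
      have ma := mono0 (S := S) hx (t := r) (tb := n) om om om
      have mc := mono0 (S := S) hx (t := n) (tb := τ) om om om
      rcases cen_out (nj n nb le_rfl) nk with ⟨e, ei⟩ | ⟨e, ei⟩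
      · exact D.rc om om e (by rw [← ei]; omega)
      · have := D.frR (t := n) om om e (f := x) (by unfold cen; omega) (by rw [← ei]; exact fun h => hyx h.symm)
        rw [← ei] at this; omega
    · obtain ⟨n, nb, nh, nj, nk⟩ := last_entry (P := fun m => Ce m y) k hny cry
      have ma := mono0 (S := S) hx (t := n) (tb := r) om om om
      have mc := mono0 (S := S) hx (t := τ) (tb := n) om om om
      rcases cen_in nk (nj (n+1) om om) with ⟨e, ei⟩ | ⟨e, ei⟩
      · have hv : x ≠ Vv n := by
          intro h
          have ah := S.nat_rel (s := sd) (t := n) om om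
          rw [← h] at ah; omega
        have := D.frL (t := n) om om e (f := x) (by unfold cen; omega) hv
        rw [← ei] at this; omega
      · exact D.rb om om e (by rw [← ei]; omega)
  refine ⟨τ, a, b, hu.2, by rw [hu.1]; exact hx, fun y hy => ⟨hcen y hy, ?_⟩⟩
  by_contra k
  have := cen_out (hcen y hy) k
  omega

lemma pig {s t a b : ℕ} (I : Finset ℕ) (h : ∀ i ∈ I, i < 30) (ae : ∀ i ∈ I, a ≤ ps s (El t i) ∧ ps s (El t i) < b) :
    I.card ≤ b - a := by
  have := card_le_card_of_injOn (s := I) (t := Ico a b) (fun i => ps s (El t i))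
    (fun i hi => by have := ae i (Finset.mem_coe.1 hi); simp only [Finset.coe_Ico, Set.mem_Ico]; exact this)
    (fun i hi j hj e => by
      have ei := S.inj s _ _ e
      by_contra k
      exact el_ne_el (h i (Finset.mem_coe.1 hi)) (h j (Finset.mem_coe.1 hj)) k ei)
  simpa using this

lemma cenR {t} (hl : Le t = 16) : Ce t (Uu t) ∧ Ce (t+1) (Vv t) ∧ ps t (Vv t) = 17 ∧ ps (t+1) (Uu t) = 17 := by
  have ad := S.huv t; have af := S.hu t; have ag := S.hv t
  unfold l at hl; unfold cen; omega
lemma cenL {t} (hl : Le t = 12) : Ce t (Vv t) ∧ Ce (t+1) (Uu t) ∧ ps t (Uu t) = 12 ∧ ps (t+1) (Vv t) = 12 := by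
  have ad := S.huv t; have af := S.hu t; have ag := S.hv t
  unfold l at hl; unfold cen; omega
lemma cenF {t f} (hf : Ce t f) (h : (Le t = 12 ∧ f ≠ Vv t) ∨ (Le t = 16 ∧ f ≠ Uu t)) : Ce (t+1) f := by
  by_contra k
  rcases cen_out hf k with ⟨a, b⟩ | ⟨a, b⟩ <;> rcases h with ⟨c, d⟩ | ⟨c, d⟩
  · exact d b
  · omega
  · omega
  · exact d b

lemma Ta.RK (D : DT) {t f} (h : sd ≤ t) (ae : t < sg) (hl : Le t = 16) (hf : Ce t f) (hu : f ≠ Uu t)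
    (k : ps sd f < 4) : ps sd (Uu t) < 4 ∧ 4 ≤ ps sd (Vv t) ∧ ps sd (Vv t) < 10 := by
  have a := D.frR h ae hl hf hu
  have b := D.CS k om om (cenF hf (Or.inr ⟨hl, hu⟩)) (cenR hl).2.1
  have c := D.rb h ae hl
  omega
lemma Ta.LK (D : DT) {t f} (h : sd ≤ t) (ae : t < sg) (hl : Le t = 12) (hf : Ce t f) (hu : f ≠ Vv t)
    (k : ps sd f < 4) : ps sd (Uu t) < 4 ∧ 4 ≤ ps sd (Vv t) ∧ ps sd (Vv t) < 10 := by
  have a := D.frL h ae hl hf hu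
  have b := D.CS k om om hf (cenL hl).1
  have c := D.rc h ae hl
  omega
lemma Ta.RKu (D : DT) {t f} (h : sd ≤ t) (ae : t < sg) (hl : Le t = 16) (hf : Ce t f) (hu : f ≠ Uu t)
    (k : ps sd (Uu t) < 4) : ps sd (Uu t) < ps sd f ∧ ps sd f < 10 := by
  have a := D.frR h ae hl hf hu
  have b := D.CS k h ae.le (cenR hl).1 hf
  omega
lemma Ta.LKu (D : DT) {t f} (h : sd ≤ t) (ae : t < sg) (hl : Le t = 12) (hf : Ce t f) (hu : f ≠ Vv t)
    (k : ps sd (Uu t) < 4) : ps sd (Uu t) < ps sd f ∧ ps sd f < 10 := by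
  have a := D.frL h ae hl hf hu
  have b := D.CS k om om (cenL hl).2.1 (cenF hf (Or.inl ⟨hl, hu⟩))
  omega

lemma Ta.Ia (D : DT) (T : TU) {t y} (h : τ + 1 ≤ t) (ae : t ≤ sg) (hy : ps sd y < 4) : 13 ≤ ps t y := by
  by_contra k
  have c := (T.hK y hy).2
  have := T.aa
  obtain ⟨n, nb, nh, nj, nk⟩ := first_exit (P := fun m => 13 ≤ ps m y) h c.1 k
  obtain ⟨e, ei⟩ := left_in (nj n nb le_rfl) nk
  exact D.rc om om e (ei ▸ hy)
lemma Ta.Ib (D : DT) (T : TU) {t y} (h : sd ≤ t) (ae : t ≤ τ + 1) (hy : ps sd y < 4) : ps t y ≤ 16 := by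
  by_contra k
  have c := (T.hK y hy).2
  have := T.ad
  obtain ⟨n, nb, nh, nj, nk⟩ := first_exit (P := fun m => 17 ≤ ps m y) ae om (by unfold cen at c; omega)
  obtain ⟨e, ei⟩ := right_out (nj n nb le_rfl) nk
  exact D.rb om om e (ei ▸ hy)

lemma Ta.aL (D : DT) (T : TU) {t} (h : τ + 1 ≤ t) (ae : t < sg) (hl : Le t = 12) :
    (4 ≤ ps sd (Uu t)) ∧ ∀ f, Ce t f → 4 ≤ ps sd f := by
  have := T.aa
  have a : 4 ≤ ps sd (Uu t) := by
    by_contra k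
    have := D.Ia T h ae.le (y := Uu t) om
    have := (cenL hl).2.2.1; omega
  refine ⟨a, fun f hf => ?_⟩
  by_contra k
  by_cases e : f = Vv t
  · have := D.rc om ae hl; rw [← e] at this; omega
  · have := D.LK om ae hl hf e om; omega
lemma Ta.bR (D : DT) (T : TU) {t} (h : sd ≤ t) (ae : t < τ) (hl : Le t = 16) :
    (4 ≤ ps sd (Vv t)) ∧ ∀ f, Ce t f → 4 ≤ ps sd f := by
  have := T.ad
  have a : 4 ≤ ps sd (Uu t) := by
    by_contra k
    have := D.Ib T (t := t+1) om om (y := Uu t) om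
    have := (cenR hl).2.2.2; omega
  have b := D.rb om om hl
  refine ⟨om, fun f hf => ?_⟩
  by_contra k
  by_cases e : f = Uu t
  · rw [e] at k; omega
  · have := D.RK om om hl hf e om; omega

lemma Ta.NB (D : DT) {t x} (h : sf ≤ t) (ae : t ≤ sg) (hx : ps sd x < 10 ∨ 20 ≤ ps sd x) : 10 ≤ ps t x := by
  by_contra k
  have := pig (S := S) (s := t) (t := sd) (a := 0) (b := 10) (insert (ps sd x) (Ico 10 20))
    (fun i hi => by
      have := S.lt sd x
      rw [mem_insert, mem_Ico] at hi; omega)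
    (fun i hi => by
      rw [mem_insert, mem_Ico] at hi
      rcases hi with rfl | hi
      · rw [S.el_pos]; omega
      · have := D.Bleft h ae (x := El sd i) (by rw [S.pos_el om]; omega) (by rw [S.pos_el om]; omega)
        omega)
  rw [card_insert_of_notMem (by rw [mem_Ico]; omega)] at this
  simp at this
lemma Ta.NC (D : DT) {t x} (h : sd ≤ t) (ae : t ≤ sf) (hx : ps sd x < 20) : ps t x < 20 := by
  by_contra k
  have := pig (S := S) (s := t) (t := sd) (a := 20) (b := 30) (insert (ps sd x) (Ico 20 30))
    (fun i hi => by
      have := S.lt sd x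
      rw [mem_insert, mem_Ico] at hi; omega)
    (fun i hi => by
      have := S.lt t (El sd i)
      rw [mem_insert, mem_Ico] at hi
      rcases hi with rfl | hi
      · rw [S.el_pos] at this ⊢; omega
      · have := D.Cright h ae (x := El sd i) (by rw [S.pos_el om]; omega)
        omega)
  rw [card_insert_of_notMem (by rw [mem_Ico]; omega)] at this
  simp at this

lemma fourK {t a : ℕ} (h : ∀ y, ps sd y < 4 → a ≤ ps t y ∧ ps t y < a + 3) : False := by
  have := pig (S := S) (s := t) (t := sd) (a := a) (b := a+3) (Ico 0 4)
    (fun i hi => by rw [mem_Ico] at hi; omega)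
    (fun i hi => by rw [mem_Ico] at hi; exact h _ (by rw [S.pos_el om]; omega))
  simp at this

lemma Ta.aK (D : DT) (T : TU) {t} (h : τ + 1 ≤ t) (ae : t ≤ sf) : ∃ y, ps sd y < 4 ∧ Ce t y := by
  by_contra! k
  have := T.aa; have := D.ao
  refine fourK (S := S) (sd := sd) (t := t) (a := 17) (fun y hy => ?_)
  have a := D.Ia T h om hy
  have b := D.NC (t := t) (x := y) om ae om
  have c := k y hy
  unfold cen at c; omega
lemma Ta.bK (D : DT) (T : TU) {t} (h : sf ≤ t) (ae : t ≤ τ) : ∃ y, ps sd y < 4 ∧ Ce t y := by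
  by_contra! k
  have := T.ad; have := D.au
  refine fourK (S := S) (sd := sd) (t := t) (a := 10) (fun y hy => ?_)
  have a := D.Ib T (t := t) om om hy
  have b := D.NB (t := t) (x := y) om om om
  have c := k y hy
  unfold cen at c; omega

lemma Ta.aKb (D : DT) (T : TU) {t n y} (h : τ + 1 ≤ n) (aa : n ≤ t) (ae : t ≤ sg) (hy : ps sd y < 4)
    (hc : Ce t y) : Ce n y := by
  by_contra k
  have := T.aa
  have a := D.Ia T h om hy
  obtain ⟨m, ma, mc, md, mf⟩ := first_exit (P := fun m => 17 ≤ ps m y) aa (by unfold cen at k; omega) (by unfold cen at hc; omega)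
  obtain ⟨e, ei⟩ := right_out (md m ma le_rfl) mf
  exact D.rb om om e (ei ▸ hy)
lemma Ta.bKf (D : DT) (T : TU) {t n y} (h : sd ≤ t) (aa : t ≤ n) (ae : n ≤ τ + 1) (hy : ps sd y < 4)
    (hc : Ce t y) : Ce n y := by
  by_contra k
  have := T.ad
  have a := D.Ib T (t := n) om ae hy
  obtain ⟨m, ma, mc, md, mf⟩ := first_exit (P := fun m => 13 ≤ ps m y) aa hc.1 (by unfold cen at k; omega)
  obtain ⟨e, ei⟩ := left_in (md m ma le_rfl) mf
  exact D.rc om om e (ei ▸ hy)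
lemma Ta.bconst (D : DT) (T : TU) {t y x} (h : sd ≤ t) (ae : t ≤ τ) (hy : ps sd y < 4)
    (hc : Ce t y) : 17 ≤ ps t x ↔ 17 ≤ ps (τ+1) x := by
  have key : ∀ m, t ≤ m → m < τ+1 → Le m ≠ 16 := by
    intro m ma mc e
    have c := D.bKf T h ma om hy hc
    rcases Nat.lt_or_ge m τ with q | q
    · have := (D.bR T om q e).2 y c; omega
    · have := T.hl; rw [show m = τ by omega] at e; omega
  constructor
  · intro a; by_contra b
    obtain ⟨m, ma, mc, md, mf⟩ := first_exit (P := fun m => 17 ≤ ps m x) (b := τ+1) om a b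
    exact key m ma mc (right_out (md m ma le_rfl) mf).1
  · intro a; by_contra b
    obtain ⟨m, ma, mc, md, mf⟩ := first_exit (P := fun m => ¬ 17 ≤ ps m x) (b := τ+1) om b (by simpa using a)
    exact key m ma mc (right_in (md m ma le_rfl) (by simpa using mf)).1

lemma Ta.I3 (D : DT) (T : TU) {t x y} (h : τ + 1 ≤ t) (ae : t ≤ sg) (hy : ps sd y < 4)
    (hc : Ce t y) (hx : 20 ≤ ps sd x) : 13 ≤ ps t x := by
  by_contra k
  have := T.aa; have := D.au; have := D.ao
  have q := D.Cright (t := sf) om le_rfl hx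
  have qa : sf ≤ t := by
    by_contra qa
    have := D.Cright (t := t) om om hx; omega
  obtain ⟨n, nb, nh, nj, nk⟩ := first_exit (P := fun m => 13 ≤ ps m x) qa om k
  obtain ⟨e, ei⟩ := left_in (nj n nb le_rfl) nk
  have cx := (cenL e).1; rw [← ei] at cx
  have : ∃ z, ps sd z < 4 ∧ Ce n z := by
    rcases Nat.lt_or_ge n (τ+1) with w | w
    · exact D.bK T nb om
    · exact ⟨y, hy, D.aKb T w nh.le ae hy hc⟩
  obtain ⟨z, za, zb⟩ := this
  have := D.CS za om om zb cx
  omega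

lemma Ta.RA5 (D : DT) (T : TU) {n} (h : τ + 1 ≤ n) (ae : n < sg) (hl : Le n = 16)
    (hu : ps sd (Uu n) < 4) (hF : ∀ f, Ce n f → f ≠ Uu n → 4 ≤ ps sd f) :
    sf ≤ n ∧ ∀ x, 4 ≤ ps sd x → ps sd x < 10 → ps n x < 17 := by
  have := T.aa; have := D.au; have := D.ao
  obtain ⟨cc, cd, cf, cm⟩ := cenR hl
  have s2n : sf ≤ n := by
    by_contra q
    obtain ⟨y, yb, ya⟩ := D.aK T (t := n+1) om om
    by_cases hy : Ce n y
    · by_cases e : y = Uu n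
      · rw [e] at ya; unfold cen at ya; omega
      · have := hF y hy e; omega
    · rcases cen_in hy ya with ⟨e, ei⟩ | ⟨e, ei⟩
      · omega
      · have := D.rb om ae hl; rw [← ei] at this; omega
  refine ⟨s2n, fun x xe xd => ?_⟩
  by_contra k
  have := pig (S := S) (s := sd) (t := n) (a := 4) (b := 10) (insert (ps n x) (Ico 10 16))
    (fun i hi => by
      have := S.lt n x
      rw [mem_insert, mem_Ico] at hi; omega)
    (fun i hi => by
      rw [mem_insert, mem_Ico] at hi
      rcases hi with rfl | hi
      · rw [S.el_pos]; omega
      · have p := S.pos_el (t := n) (i := i) om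
        have a := D.cov (El n i)
        have ui : El n i ≠ Uu n := by intro e; rw [e] at p; unfold l at hl; omega
        rcases Nat.lt_or_ge i 13 with w | w
        · have bu := D.Bleft s2n ae.le (x := El n i)
          have dj := D.I3 T h ae.le hu cc (x := El n i)
          have bv := D.Ia T h ae.le (y := El n i)
          omega
        · have ce : Ce n (El n i) := by unfold cen; omega
          have bu := D.CS hu om ae.le cc ce
          have dj := hF _ ce ui
          omega)
  rw [card_insert_of_notMem (by rw [mem_Ico]; omega)] at this
  simp at this

lemma Ta.RX (D : DT) (T : TU) : ∃ n, τ + 1 ≤ n ∧ n < sg ∧ (∀ m, τ + 1 ≤ m → m ≤ n → Le m ≠ 12) ∧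
    (∀ i, 13 ≤ i → i < 16 → (4 ≤ ps sd (El n i) ∧ ps sd (El n i) < 10) ∧ 17 ≤ ps (τ+1) (El n i)) ∧
    (∀ x, ps sd x < 10 → 17 ≤ ps (τ+1) x → Ce n x ∧ 4 ≤ ps sd x) := by
  have := T.aa; have := T.ad; have := D.au; have := D.ao
  obtain ⟨n, nb, nh, nj, nk⟩ := first_exit (P := fun m => ∃ y, ps sd y < 4 ∧ Ce m y) (a := τ+1) (b := sg) om
    ⟨Uu τ, by rw [T.hu]; omega, (T.hK _ (by rw [T.hu]; omega)).2⟩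
    (by rintro ⟨y, yb, ya⟩; have := D.cov y; unfold cen at ya; omega)
  obtain ⟨y, yb, ya⟩ := nj n nb le_rfl
  have yd : ¬ Ce (n+1) y := fun h => nk ⟨y, yb, h⟩
  have noL : ∀ m, τ + 1 ≤ m → m ≤ n → Le m ≠ 12 := by
    intro m ma mc e
    have := (D.aL T ma om e).2 y (D.aKb T ma mc om yb ya)
    omega
  have yu : Le n = 16 ∧ y = Uu n := by
    rcases cen_out ya yd with ⟨e, ei⟩ | e
    · exact absurd e (noL n nb le_rfl)
    · exact e
  obtain ⟨hl, rfl⟩ := yu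
  have hF : ∀ f, Ce n f → f ≠ Uu n → 4 ≤ ps sd f := by
    intro f fa fb
    by_contra k
    exact nk ⟨f, om, cenF fa (Or.inr ⟨hl, fb⟩)⟩
  have hL : ∀ x, 13 ≤ ps (τ+1) x ↔ 13 ≤ ps n x := by
    intro x
    constructor
    · intro a; by_contra b
      obtain ⟨m, ma, mc, md, mf⟩ := first_exit (P := fun m => 13 ≤ ps m x) nb a b
      exact noL m ma om (left_in (md m ma le_rfl) mf).1
    · intro a; by_contra b
      obtain ⟨m, ma, mc, md, mf⟩ := first_exit (P := fun m => ¬ 13 ≤ ps m x) nb b (by simpa using a)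
      exact noL m ma om (left_out (md m ma le_rfl) (by simpa using mf)).1
  have R := (D.RA5 T nb nh hl yb hF).2
  have cK : ∀ x, Ce (τ+1) x → ps sd x < 4 := by
    intro x hx
    by_contra k
    have := pig (S := S) (s := τ+1) (t := sd) (a := 13) (b := 17) (insert (ps sd x) (Ico 0 4))
      (fun i hi => by
        have := S.lt sd x
        rw [mem_insert, mem_Ico] at hi; omega)
      (fun i hi => by
        rw [mem_insert, mem_Ico] at hi
        rcases hi with rfl | hi
        · rw [S.el_pos]; unfold cen at hx; omega
        · have := (T.hK (El sd i) (by rw [S.pos_el om]; omega)).2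
          unfold cen at this; omega)
    rw [card_insert_of_notMem (by rw [mem_Ico]; omega)] at this
    simp at this
  refine ⟨n, nb, nh, noL, fun i i1 i2 => ?_, fun x xe xd => ?_⟩
  · have p := S.pos_el (t := n) (i := i) om
    have ui : El n i ≠ Uu n := by intro e; rw [e] at p; unfold l at hl; omega
    have ce : Ce n (El n i) := by unfold cen; omega
    have bu := D.CS yb om nh.le ya ce
    have dj := hF _ ce ui
    have bv := hL (El n i)
    have b4 := cK (El n i)
    unfold cen at b4; omega
  · have b0 : 4 ≤ ps sd x := by
      by_contra k
      have := (T.hK x om).2; unfold cen at this; omega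
    have bv := hL x
    have b4 := R x b0 xe
    unfold cen; omega

lemma Ta.RXb (D : DT) (T : TU) {x y t} (hx : ps sd x < 10) (hy : ps sd y < 10) (hne : x ≠ y)
    (rx : 17 ≤ ps (τ+1) x) (ry : 17 ≤ ps (τ+1) y) (h : sd ≤ t) (ae : t ≤ τ + 1) (cx : Ce t x) (cy : Ce t y) : False := by
  wlog hxy : ps sd x < ps sd y generalizing x y
  · exact this hy hx hne.symm ry rx cy cx (by have := S.pos_ne (t := sd) hne; omega)
  have := T.aa; have := T.ad; have := D.am
  obtain ⟨n, nb, nh, noL, -, ad⟩ := D.RX T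
  have a := (ad x hx rx).1; have b := (ad y hy ry).1
  obtain ⟨m, ma, mc, md, mf⟩ := last_entry (P := fun m => Ce m x ∧ Ce m y) nb (by rintro ⟨a, b⟩; unfold cen at a; omega) ⟨a, b⟩
  obtain ⟨cc, cd⟩ := md (m+1) om om
  have un : ps m x < ps m y := by
    have nL := noL m ma om
    by_cases k : Ce m x
    · rcases cen_in (fun q => mf ⟨k, q⟩) cd with ⟨e, ei⟩ | ⟨e, ei⟩
      · exact absurd e nL
      · have := (cenR e).2.2.1; rw [← ei] at this; unfold cen at k; omega
    · rcases cen_in k cc with ⟨e, ei⟩ | ⟨e, ei⟩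
      · exact absurd e nL
      · have cy' : Ce m y := by
          by_contra q
          rcases cen_in q cd with ⟨eb, ew⟩ | ⟨eb, ew⟩
          · exact nL eb
          · exact hne (ei.trans ew.symm)
        have w : y ≠ Uu m := by
          intro q; have := (cenR e).2.2.2; rw [← q] at this; unfold cen at cd; omega
        have := D.frR om om e cy' w
        rw [← ei] at this; omega
  have un' := S.btw sd (τ+1) m x y om om om hxy un
  have := (D.stayF hx hxy h ae om cx cy un').1
  unfold cen at this; omega

lemma Ta.LB4 (D : DT) (T : TU) {t} (h : sd ≤ t) (ae : t < τ) (hl : Le t = 12)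
    (hu : ps sd (Uu t) < 4) (hF : ∀ f, Ce t f → f ≠ Vv t → 4 ≤ ps sd f) : 10 ≤ ps sd (Vv t) := by
  by_contra k
  have := T.aa; have := T.ad
  obtain ⟨cc, cd, cf, cm⟩ := cenL hl
  have hr := D.rc h om hl
  obtain ⟨n, nb, nh, -, hX, -⟩ := D.RX T
  have hX' : ∀ i, 13 ≤ i → i < 16 → 17 ≤ ps t (El n i) := by
    intro i i1 i2
    have a := (D.bconst T (t := t+1) (x := El n i) om om hu cd).2 (hX i i1 i2).2
    have aa := S.bb t (El n i)
    have ad := S.huv t; have af := S.hu t; have ag := S.hv t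
    rcases aa with aa | aa | aa
    · rw [aa] at a ⊢; omega
    · rw [aa] at a ⊢; omega
    · omega
  have cK : ∀ f, Ce t f → 4 ≤ ps sd f ∧ ps sd f < 10 := by
    intro f hf
    by_cases e : f = Vv t
    · rw [e]; omega
    · have a := hF f hf e
      have b := D.LKu h om hl hf e hu
      omega
  have p13 := hX' 13 om om
  have p14 := hX' 14 om om
  have p15 := hX' 15 om om
  have qb := S.pos_ne (t := t) (el_ne_el (S := S) (t := n) (i := 13) (j := 14) om om om)
  have qa := S.pos_ne (t := t) (el_ne_el (S := S) (t := n) (i := 13) (j := 15) om om om)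
  have q3 := S.pos_ne (t := t) (el_ne_el (S := S) (t := n) (i := 14) (j := 15) om om om)
  have := pig (S := S) (s := sd) (t := t) (a := 4) (b := 10)
    (insert (ps t (El n 13)) (insert (ps t (El n 14)) (insert (ps t (El n 15)) (Ico 13 17))))
    (fun i hi => by
      have := S.lt t (El n 13); have := S.lt t (El n 14); have := S.lt t (El n 15)
      simp only [mem_insert, mem_Ico] at hi; omega)
    (fun i hi => by
      simp only [mem_insert, mem_Ico] at hi
      rcases hi with rfl | rfl | rfl | hi
      · rw [S.el_pos]; exact (hX 13 om om).1
      · rw [S.el_pos]; exact (hX 14 om om).1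
      · rw [S.el_pos]; exact (hX 15 om om).1
      · exact cK _ (cen_el hi.1 om))
  rw [card_insert_of_notMem (by simp only [mem_insert, mem_Ico]; omega),
    card_insert_of_notMem (by simp only [mem_insert, mem_Ico]; omega),
    card_insert_of_notMem (by simp only [mem_Ico]; omega)] at this
  simp at this

structure Lk (S : SF) (sd sf sg a c : ℕ) : Prop where
  D : S.Ta sd sf sg
  T : S.Tau sd sg a
  Tc : S.Tau (sf+S.N) (sd+S.N+S.N) (c+S.N)

lemma cenN {t x} : Ce (t+NN) x ↔ Ce t x := by
  unfold cen; have := S.flip t x; omega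

namespace Lk
variable (E : S.Lk sd sf sg a c)
include E

lemma bd : sd ≤ a ∧ a < sg ∧ sf ≤ c ∧ c < sd + NN ∧ sd < sf ∧ sf < sg ∧ sg < sd + NN := by
  have := E.T.aa; have := E.T.ad; have := E.Tc.aa; have := E.Tc.ad
  have := E.D.au; have := E.D.ao; have := E.D.am
  omega

lemma cov (x) : (ps sd x < 10 ∧ 10 ≤ ps sN x ∧ ps sN x < 20) ∨
    (10 ≤ ps sd x ∧ ps sd x < 20 ∧ 20 ≤ ps sN x) ∨ (20 ≤ ps sd x ∧ ps sN x < 10) := by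
  have := E.D.cov x; have := S.flip sf x; omega

lemma CSC {t x y} (hx : ps sN x < 4) (h : sf ≤ t) (ae : t ≤ sd+NN) (cx : Ce t x) (cy : Ce t y) :
    ps sN y < 10 :=
  E.D.rot.CS hx (t := t+NN) om om (cenN.2 cx) (cenN.2 cy)

lemma r2C {t} (h : sf ≤ t) (ae : t < sd+NN) (hl : Le t = 16) : 4 ≤ ps sN (Uu t) := by
  have := E.D.rot.rc (t := t+NN) om om (by have := S.ld t; omega)
  rw [(S.uN t).2] at this; omega

lemma r3C {t} (h : sf ≤ t) (ae : t < sf+NN) (hl : Le t = 12 ∨ Le t = 16) :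
    ¬ ((4 ≤ ps sN (Uu t) ∧ ps sN (Uu t) < 10) ∧
      (4 ≤ ps sN (Vv t) ∧ ps sN (Vv t) < 10)) := by
  have := E.D.rot.rf (t := t+NN) om om (by have := S.ld t; omega)
  rw [(S.uN t).2, (S.uN t).1] at this; exact fun h => this h.symm

lemma LK' {t f} (h : sf ≤ t) (ae : t < sd+NN) (hl : Le t = 16) (hf : Ce t f) (hu : f ≠ Uu t)
    (k : ps sN f < 4) : ps sN (Vv t) < 4 ∧ 4 ≤ ps sN (Uu t) ∧ ps sN (Uu t) < 10 := by
  have := E.D.rot.LK (t := t+NN) (f := f) om om (by have := S.ld t; omega) (cenN.2 hf) (by rwa [(S.uN t).2]) k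
  rwa [(S.uN t).2, (S.uN t).1] at this

lemma Lb {t f} (h : sf ≤ t) (ae : t < sd+NN) (hl : Le t = 16) (hf : Ce t f) (hu : f ≠ Uu t)
    (k : ps sN (Vv t) < 4) : ps sN (Vv t) < ps sN f ∧ ps sN f < 10 := by
  have := E.D.rot.LKu (t := t+NN) (f := f) om om (by have := S.ld t; omega) (cenN.2 hf) (by rwa [(S.uN t).2])
  rw [(S.uN t).1] at this
  exact this k

lemma bR' {t} (h : sf ≤ t) (ae : t < c) (hl : Le t = 12) :
    4 ≤ ps sN (Uu t) ∧ ∀ f, Ce t f → 4 ≤ ps sN f := by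
  have := E.D.rot.bR E.Tc (t := t+NN) om om (by have := S.ld t; omega)
  rw [(S.uN t).2] at this
  exact ⟨this.1, fun f hf => this.2 f (cenN.2 hf)⟩

lemma dq {t} (h : sg ≤ t) (ae : t ≤ c) : ∃ y, ps sN y < 4 ∧ Ce t y := by
  obtain ⟨y, aa, ad⟩ := E.D.rot.bK E.Tc (t := t+NN) om om
  exact ⟨y, aa, cenN.1 ad⟩

lemma bconst' {t y} (h : sf ≤ t) (ae : t ≤ c) (hy : ps sN y < 4) (hc : Ce t y) (x) :
    ps t x ≤ 12 ↔ ps (c+1) x ≤ 12 := by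
  have := E.D.rot.bconst E.Tc (t := t+NN) (x := x) om om hy (cenN.2 hc)
  rw [show c + NN + 1 = c + 1 + NN by omega] at this
  have := S.flip t x; have := S.flip (c+1) x; omega

lemma RXb' {x y t} (hx : ps sN x < 10) (hy : ps sN y < 10) (hne : x ≠ y)
    (rx : ps (c+1) x ≤ 12) (ry : ps (c+1) y ≤ 12) (h : sf ≤ t) (ae : t ≤ c + 1) (cx : Ce t x) (cy : Ce t y) : False := by
  have := S.flip (c+1) x; have := S.flip (c+1) y
  rw [show c + 1 + NN = c + NN + 1 by omega] at *
  exact E.D.rot.RXb E.Tc hx hy hne om om (t := t+NN) om om (cenN.2 cx) (cenN.2 cy)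

lemma LB4' {t} (h : sf ≤ t) (ae : t < c) (hl : Le t = 16) (hu : ps sN (Vv t) < 4)
    (hF : ∀ f, Ce t f → f ≠ Uu t → 4 ≤ ps sN f) : 10 ≤ ps sN (Uu t) := by
  have := E.D.rot.LB4 E.Tc (t := t+NN) om om (by have := S.ld t; omega)
  rw [(S.uN t).2, (S.uN t).1] at this
  exact this hu (fun f hf hv => hF f (cenN.1 hf) hv)

lemma lc : Le c = 14 ∧ ps sN (Vv c) = 0 := by
  have := E.Tc.hl; have := E.Tc.hu; have := S.ld c
  rw [(S.uN c).1] at *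
  omega

lemma hKc {y} (hy : ps sN y < 4) : Ce c y := cenN.1 (E.Tc.hK y hy).1

lemma leftc (x) : ps c x ≤ 12 ↔ ps (c+1) x ≤ 12 := by
  have := E.lc.1
  have eg := S.huv c
  have eb := S.hu c
  have eh := S.hv c
  unfold l at this
  rcases S.bb c x with rfl | rfl | h <;> omega

lemma three : ∃ x y z : Fin 30, x ≠ y ∧ x ≠ z ∧ y ≠ z ∧ ∀ w, w = x ∨ w = y ∨ w = z → ps sN w < 10 ∧ ps (c+1) w ≤ 12 := by
  obtain ⟨n, -, -, -, h, -⟩ := E.D.rot.RX E.Tc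
  refine ⟨El n 13, El n 14, El n 15, el_ne_el om om om, el_ne_el om om om, el_ne_el om om om, ?_⟩
  have aa := h 13 om om; have ad := h 14 om om; have af := h 15 om om
  rw [show c + NN + 1 = c + 1 + NN by omega] at *
  rintro w (rfl | rfl | rfl)
  · have := S.flip (c+1) (El n 13); omega
  · have := S.flip (c+1) (El n 14); omega
  · have := S.flip (c+1) (El n 15); omega

lemma hac : a + 1 ≤ c := by
  by_contra hh
  have := E.bd
  refine fourK (S := S) (sd := sd) (t := c) (a := 10) fun y hy => ?_
  have aa := E.D.NB (t := c) (x := y) om om om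
  have ad := E.D.Ib E.T (t := c) (y := y) om om hy
  refine ⟨aa, ?_⟩
  by_contra af
  have cy : Ce c y := ⟨om, ad⟩
  have ag := E.CSC (t := c) (x := Vv c) (y := y) (by have := E.lc; omega) om om (E.hKc (by have := E.lc; omega)) cy
  have := E.cov y
  omega

lemma noB {t x} (h : a + 1 ≤ t) (ae : t ≤ c) (hx : Ce t x) : ps sd x < 10 ∨ ps sN x < 10 := by
  have := E.bd; have hv := E.cov x
  by_cases ad : t ≤ sf
  · obtain ⟨y, hy, cy⟩ := E.D.aK E.T h ad
    exact .inl (E.D.CS hy om om cy hx)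
  by_cases af : sg ≤ t
  · obtain ⟨y, hy, cy⟩ := E.dq af ae
    exact .inr (E.CSC hy om om cy hx)
  · rcases hv with hv | hv | hv
    · exact .inl hv.1
    · have := E.D.toTT.Bleft (t := t) (x := x) om om hv.1 hv.2.1
      unfold cen at hx; omega
    · exact .inr hv.2

end Lk

noncomputable def pc (S : SF) (sf t : ℕ) : ℕ := (univ.filter fun x => S.pos (sf+S.N) x < 10 ∧ S.pos t x ≤ 12).card

lemma pc_congr {t tb} (h : ∀ x, ps sN x < 10 → (ps t x ≤ 12 ↔ ps tb x ≤ 12)) : S.pc sf t = S.pc sf tb := by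
  unfold pc; congr 1; ext x; simp only [mem_filter, mem_univ, true_and]
  have := h x; tauto

lemma left_same {t} (h : Le t ≠ 12) (x) : ps t x ≤ 12 ↔ ps (t+1) x ≤ 12 := by
  have eg := S.huv t
  have eb := S.hu t
  have eh := S.hv t
  unfold l at h
  rcases S.bb t x with rfl | rfl | h <;> omega

namespace Lk
variable (E : S.Lk sd sf sg a c)
include E

lemma allA {t x} (h : a + 1 ≤ t) (ae : t ≤ sf) (hx : Ce t x) : ps sd x < 10 := by
  have := E.bd
  obtain ⟨y, hy, cy⟩ := E.D.aK E.T h ae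
  exact E.D.CS hy om om cy hx

lemma allC {t x} (h : sg ≤ t) (ae : t ≤ c) (hx : Ce t x) : ps sN x < 10 := by
  have := E.bd
  obtain ⟨y, hy, cy⟩ := E.dq h ae
  exact E.CSC hy om om cy hx

lemma R2A {x y} (hx : ps sd x < 10) (hy : ps sd y < 10) : R2S x y ↔ ps sd x < ps sd y := by
  unfold Ra; simp [hx, hy]
lemma R2C {x y} (hx : ps sN x < 10) : R2S x y ↔ ps sf x < ps sf y := by
  have := E.cov x
  unfold Ra; omega
lemma swapR {t} (h : a + 1 ≤ t) (ae : t < c) (hu : Ce t (Uu t)) (hv : Ce t (Vv t)) :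
    R2S (Uu t) (Vv t) ∧ ¬ R2S (Vv t) (Uu t) := by
  have := E.bd
  by_cases ad : t < sf
  · have aq := E.allA h om hu; have aj := E.allA h om hv
    rw [E.R2A aq aj, E.R2A aj aq]
    exact S.nat_rel om om
  by_cases af : t < sg
  · exact E.D.toTT.R2_uv om af
  · have aq := E.allC om om hu; have aj := E.allC om om hv
    rw [E.R2C aq, E.R2C aj]
    exact S.nat_rel om om

lemma zoneL {t} (h : a + 1 ≤ t) (ae : t < c) (hl : Le t = 12) : sf ≤ t ∧ t < sg := by
  have := E.bd
  constructor
  · by_contra hh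
    obtain ⟨y, hy, cy⟩ := E.D.aK E.T h om
    have := (E.D.aL E.T h om hl).2 y cy
    omega
  · by_contra hh
    obtain ⟨y, hy, cy⟩ := E.dq (t := t) om om
    have := (E.bR' (t := t) om om hl).2 y cy
    omega

lemma bitL {t f} (h : a + 1 ≤ t) (ae : t < c) (hl : Le t = 12) (hf : Ce t f) (hv : f ≠ Vv t) :
    R2S (Uu t) f ∧ ¬ R2S (Vv t) f :=
  E.D.fr2L (E.zoneL h ae hl).1 (E.zoneL h ae hl).2 hl hf hv

lemma tagL {t} (h : a + 1 ≤ t) (ae : t < c) (hl : Le t = 12) :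
    (4 ≤ ps sd (Uu t) ∧ ps sd (Uu t) < 10) ∧ (4 ≤ ps sN (Vv t) ∧ ps sN (Vv t) < 10) ∧
    ∀ f, Ce t f → 4 ≤ ps sd f ∧ 4 ≤ ps sN f := by
  have := E.bd
  obtain ⟨za, zb⟩ := E.zoneL h ae hl
  have hc := cenL hl
  have aq := E.D.aL E.T h zb hl
  have aj := E.bR' za ae hl
  have nb := E.noB (t := t+1) om om hc.2.1
  have nh := E.noB h ae.le hc.1
  have fa := aq.2 _ hc.1
  have fb := aj.2 _ hc.1
  have qb := E.D.rf (t := t) om om (.inl hl)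
  have qa := E.r3C za om (.inl hl)
  have cc := E.cov (Uu t); have cd := E.cov (Vv t)
  have o := E.D.toTT.R2_uv za zb
  have eg := S.flip sf (Uu t); have eb := S.flip sf (Vv t)
  have : ¬ (ps sd (Vv t) < 10 ∧ ps sN (Uu t) < 10) := by
    rintro ⟨p, q⟩
    have := (E.R2C q).1 o.1
    omega
  refine ⟨om, om, fun f hf => ⟨aq.2 f hf, aj.2 f hf⟩⟩

lemma vg {t} (h : a + 1 ≤ t) (ae : t < c) (hl : Le t = 12) : ps (c+1) (Vv t) ≤ 12 := by
  rw [← E.leftc]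
  by_contra hh
  have hc := cenL hl
  obtain ⟨n, nb, nh, nj, nk⟩ := first_exit (P := fun m => ps m (Vv t) ≤ 12) (a := t+1) (b := c) om (by show ps (t+1) (Vv t) ≤ 12; omega) hh
  have n5 : ps n (Vv t) ≤ 12 := nj n nb le_rfl
  replace nk : ¬ ps (n+1) (Vv t) ≤ 12 := nk
  obtain ⟨xe, xd⟩ := left_out (S := S) (t := n) (x := Vv t) om om
  have w := (E.tagL (t := n) om nh xe).1
  have w' := (E.tagL h ae hl).2.1
  rw [← xd] at w
  have := E.cov (Vv t)
  omega

lemma pcL {t} (h : a + 1 ≤ t) (ae : t < c) (hl : Le t = 12) : S.pc sf (t+1) = S.pc sf t + 1 ∧ S.pc sf t ≤ 2 := by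
  have := E.bd
  obtain ⟨za, zb⟩ := E.zoneL h ae hl
  have w := E.tagL h ae hl
  have hc := cenL hl
  have eo : S.pc sf (t+1) = S.pc sf t + 1 := by
    unfold pc
    rw [← card_insert_of_notMem (a := Vv t)]
    · congr 1; ext x; simp only [mem_filter, mem_univ, true_and, mem_insert]
      have eg := S.huv t
      have eb := S.hu t
      have eh := S.hv t
      have cc := E.cov (Uu t)
      unfold l at hl
      rcases S.bb t x with rfl | rfl | h
      · have := S.ud t
        simp only [this, false_or]
        omega
      · simp; omega
      · by_cases hx : x = Vv t
        · subst hx; simp; omega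
        · simp only [hx, false_or]; omega
    · have := hc.1
      unfold cen at this
      simp; omega
  refine ⟨eo, ?_⟩
  have : S.pc sf (t+1) ≤ 3 := by
    unfold pc
    calc _ = (Finset.image (ps (t+1)) (univ.filter fun x => ps sN x < 10 ∧ ps (t+1) x ≤ 12)).card :=
          (card_image_of_injective _ (fun x y e => S.inj _ _ _ e)).symm
      _ ≤ (Finset.Icc 10 12).card := by
          apply card_le_card
          intro i hi
          rw [mem_image] at hi
          obtain ⟨x, hx, rfl⟩ := hi
          rw [mem_filter] at hx
          have := E.D.NB (t := t+1) (x := x) om om (by have := E.cov x; omega)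
          rw [Finset.mem_Icc]; omega
      _ = 3 := by simp
  omega

lemma pc3 {t y} (h : sf ≤ t) (ae : t ≤ c) (hy : ps sN y < 4) (cy : Ce t y) : 3 ≤ S.pc sf t := by
  obtain ⟨x, yc, z, aa, ad, af, ag⟩ := E.three
  have : ({x, yc, z} : Finset (Fin 30)).card = 3 := by
    rw [card_eq_three]; exact ⟨x, yc, z, aa, ad, af, rfl⟩
  rw [← this]
  unfold pc
  apply card_le_card
  intro w hw
  simp only [mem_insert, mem_singleton] at hw
  have := ag w hw
  have := E.bconst' h ae hy cy w
  simp only [mem_filter, mem_univ, true_and]; omega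

lemma pc0 : S.pc sf (a+1) = 0 := by
  have := E.bd
  unfold pc
  rw [card_eq_zero, filter_eq_empty_iff]
  intro x _ hx
  have := E.D.I3 E.T (t := a+1) (x := x) (y := Uu a) le_rfl om (by rw [E.T.hu]; omega) (E.T.hK _ (by rw [E.T.hu]; omega)).2
    (by have := E.cov x; omega)
  omega

lemma bitR {t f} (h : a + 1 ≤ t) (ae : t < c) (hl : Le t = 16) (hf : Ce t f) (hu : f ≠ Uu t) :
    R2S f (Vv t) ∧ ¬ R2S f (Uu t) := by
  have := E.bd
  have hc := cenR hl
  by_cases ad : t < sf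
  · have hK : ∃ y, Ce t y ∧ y ≠ Uu t ∧ ps sd y < 4 := by
      by_contra hno
      push Not at hno
      obtain ⟨y, hy, cy⟩ := E.D.aK E.T h ad.le
      have : y = Uu t := by
        by_contra q; have := hno y cy q; omega
      subst this
      have := (E.D.RA5 E.T h om hl hy hno).1
      omega
    obtain ⟨y, cy, yb, ya⟩ := hK
    have w := E.D.RK om om hl cy yb ya
    have fA := E.allA h ad.le hf
    have r := E.D.frR (t := t) om om hl hf hu
    rw [E.R2A fA om, E.R2A fA om]
    have rb := r.1 om
    have rc := r.2 om
    omega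
  by_cases af : t < sg
  · exact E.D.fr2R om af hl hf hu
  · obtain ⟨y, hy, cy⟩ := E.dq (t := t) om om
    have yu : y ≠ Uu t := by
      rintro rfl; have := E.r2C (t := t) om om hl; omega
    have w := E.LK' (t := t) om om hl cy yu hy
    have fC := E.allC (t := t) om om hf
    have wj := E.Lb (t := t) om om hl hf hu w.1
    have r := E.D.rot.frL (t := t+NN) (f := f) om om (by have := S.ld t; omega) (cenN.2 hf) (by rwa [(S.uN t).2])
    rw [(S.uN t).2] at r
    have rc := r.2 (.inr fC)
    rw [E.R2C fC, E.R2C fC]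
    have := S.flip sf f; have := S.flip sf (Uu t); have := S.flip sf (Vv t)
    omega

lemma tagR {t} (h : a + 1 ≤ t) (ae : t < c) (hl : Le t = 16) :
    (ps sd (Uu t) < 4 ∧ (∀ f, Ce t f → f ≠ Uu t → ps sd (Uu t) < ps sd f ∧ ps sd f < 10) ∧
      (((∃ f, Ce t f ∧ f ≠ Uu t ∧ ps sd f < 4) ∧ 4 ≤ ps sd (Vv t) ∧ ps sd (Vv t) < 10) ∨
       ((∀ f, Ce t f → f ≠ Uu t → 4 ≤ ps sd f) ∧ 4 ≤ ps sN (Vv t) ∧ ps sN (Vv t) < 10))) ∨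
    ((4 ≤ ps sd (Uu t) ∧ ps sd (Uu t) < 10) ∧ (∀ f, Ce t f → f ≠ Uu t → 4 ≤ ps sd f ∧ 4 ≤ ps sN f) ∧
      ps sN (Vv t) < 10 ∧
      (ps (c+1) (Vv t) ≤ 12 → ∀ f, Ce t f → f ≠ Uu t → ps sN f < 10 → ¬ ps (c+1) f ≤ 12) ∧
      (ps sN (Vv t) < 4 → 3 ≤ S.pc sf t ∧ ∀ f, Ce t f → f ≠ Uu t → ps sN f < 10)) ∨
    ((4 ≤ ps sN (Uu t) ∧ ps sN (Uu t) < 10) ∧ ¬ ps (c+1) (Uu t) ≤ 12 ∧ ps sN (Vv t) < 4 ∧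
      3 ≤ S.pc sf t ∧ (∃ f, Ce t f ∧ f ≠ Uu t ∧ ps sN f < 4) ∧
      ∀ f, Ce t f → f ≠ Uu t → ps sN (Vv t) < ps sN f ∧ ps sN f < 10) := by
  have := E.bd
  have hc := cenR hl
  have nb := E.noB h ae.le hc.1
  have nh := E.noB (t := t+1) om om hc.2.1
  have cc := E.cov (Uu t); have cd := E.cov (Vv t)
  have hp : ps sN (Vv t) < 4 → sf ≤ t → 3 ≤ S.pc sf t := by
    intro q hs
    rw [pc_congr (tb := t+1) (fun x _ => left_same om x)]
    exact E.pc3 om om q hc.2.1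
  by_cases hA : ps sd (Uu t) < 10
  · have tf : t < sg := by
      by_contra q; have := E.allC (t := t) om om hc.1; omega
    have qb := E.D.rb (t := t) om tf hl
    by_cases ds : ps sd (Uu t) < 4
    · refine .inl ⟨ds, fun f hf hne => E.D.RKu om tf hl hf hne ds, ?_⟩
      by_cases hK : ∃ f, Ce t f ∧ f ≠ Uu t ∧ ps sd f < 4
      · obtain ⟨f, fa, fb, fc⟩ := hK
        exact .inl ⟨⟨f, fa, fb, fc⟩, (E.D.RK om tf hl fa fb fc).2⟩
      · push Not at hK
        refine .inr ⟨hK, ?_⟩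
        have r := E.D.RA5 E.T h tf hl ds hK
        have rc := r.2 (Vv t)
        have ne : El t 13 ≠ Uu t := by
          rw [← S.eu t, hl]; exact el_ne_el om om om
        have ka := E.D.RKu om tf hl (cen_el om om) ne ds
        have cf := E.cov (El t 13)
        have kg := E.Lb r.1 om hl (cen_el om om) ne
        by_cases hv4 : ps sN (Vv t) < 4
        · have := kg hv4; omega
        · omega
    · refine .inr <| .inl ⟨om, ?_⟩
      have noK : ∀ f, Ce t f → f ≠ Uu t → 4 ≤ ps sd f := by
        intro f fa fb
        by_contra q
        have := E.D.RK om tf hl fa fb om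
        omega
      have td : sf ≤ t := by
        by_contra q
        obtain ⟨y, hy, cy⟩ := E.D.aK E.T h om
        by_cases yu : y = Uu t
        · subst yu; omega
        · have := noK y cy yu; omega
      have q3 := E.D.rf (t := t) om om (.inr hl)
      have vC : ps sN (Vv t) < 10 := om
      refine ⟨fun f fa fb => ⟨noK f fa fb, ?_⟩, vC, fun g f fa fb fc f4 => ?_, fun q => ⟨hp q td, fun f fa fb => (E.Lb td om hl fa fb q).2⟩⟩
      · by_contra q
        have := E.LK' td om hl fa fb om
        omega
      · refine E.RXb' fc vC ?_ f4 g (t := t+1) om om (cenF fa (.inr ⟨hl, fb⟩)) hc.2.1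
        rintro rfl
        have := hc.2.2.1
        unfold cen at fa; omega
  · have uC : ps sN (Uu t) < 10 := om
    have td : sf ≤ t := by
      by_contra q; have := E.allA h om hc.1; omega
    have vC : ps sN (Vv t) < 10 := by
      by_cases tf : t < sg
      · have o := (E.R2C uC).1 (E.D.toTT.R2_uv td tf).1
        have := S.flip sf (Uu t); have := S.flip sf (Vv t)
        omega
      · exact E.allC (t := t+1) om om hc.2.1
    have qa := E.r2C td om hl
    have q3 := E.r3C td om (.inr hl)
    have vc : ps sN (Vv t) < 4 := om
    refine .inr <| .inr ⟨⟨qa, uC⟩, ?_, vc, hp vc td, ?_, fun f fa fb => E.Lb td om hl fa fb vc⟩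
    · have := E.bconst' (t := t+1) om om vc hc.2.1 (Uu t)
      omega
    · by_contra hno
      push Not at hno
      have := E.LB4' td ae hl vc hno
      omega

end Lk

def tg (S : SF) (sd sf c : ℕ) (x : Fin 30) : ℕ :=
  if S.pos sd x < 4 then S.pos sd x else if S.pos sd x < 10 then 4 else
  if S.pos (sf+S.N) x < 4 then 7 + S.pos (sf+S.N) x else if S.pos (c+1) x ≤ 12 then 5 else 6

lemma tg_sp (x) : (ps sd x < 4 ∧ S.tg sd sf c x = ps sd x) ∨ (4 ≤ ps sd x ∧ ps sd x < 10 ∧ S.tg sd sf c x = 4) ∨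
    (10 ≤ ps sd x ∧ ps sN x < 4 ∧ S.tg sd sf c x = 7 + ps sN x) ∨
    (10 ≤ ps sd x ∧ 4 ≤ ps sN x ∧ ps (c+1) x ≤ 12 ∧ S.tg sd sf c x = 5) ∨
    (10 ≤ ps sd x ∧ 4 ≤ ps sN x ∧ ¬ ps (c+1) x ≤ 12 ∧ S.tg sd sf c x = 6) := by
  unfold tg; split_ifs <;> omega

noncomputable def sta (S : SF) (sd sf c t : ℕ) : DP.St :=
  ⟨S.pc sf t, S.tg sd sf c (S.el t 13), S.tg sd sf c (S.el t 14), S.tg sd sf c (S.el t 15), S.tg sd sf c (S.el t 16),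
   S.bt (S.Ra sd sf) t 13 14, S.bt (S.Ra sd sf) t 13 15, S.bt (S.Ra sd sf) t 13 16,
   S.bt (S.Ra sd sf) t 14 15, S.bt (S.Ra sd sf) t 14 16, S.bt (S.Ra sd sf) t 15 16⟩

lemma sta_ok (t) : (S.sta sd sf c t).ok := by
  unfold sta DP.St.ok
  dsimp only
  have h : ∀ x, S.tg sd sf c x < 16 := by intro x; have := S.tg_sp (sd := sd) (sf := sf) (c := c) x; omega
  have ae : ∀ i j, S.bt (R2S) t i j < 2 := by intro i j; have := S.bf (R2S) t i j; omega
  exact ⟨h _, h _, h _, h _, ae _ _, ae _ _, ae _ _, ae _ _, ae _ _, ae _ _⟩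

lemma cen_cases {t f} (h : Ce t f) : f = El t 13 ∨ f = El t 14 ∨ f = El t 15 ∨ f = El t 16 := by
  have : ps t f = 13 ∨ ps t f = 14 ∨ ps t f = 15 ∨ ps t f = 16 := by unfold cen at h; omega
  rcases this with h | h | h | h
  · exact .inl (S.ek h).symm
  · exact .inr <| .inl (S.ek h).symm
  · exact .inr <| .inr <| .inl (S.ek h).symm
  · exact .inr <| .inr <| .inr (S.ek h).symm

namespace Lk
variable (E : S.Lk sd sf sg a c)
include E

lemma noC1 {t} (h : a + 1 ≤ t) (ae : t < c) (hl : Le t = 14) :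
    ps sN (Uu t) ≠ 0 ∧ ps sN (Vv t) ≠ 0 := by
  have := E.bd
  have eg := S.huv t
  have eb := S.hu t
  have eh := S.hv t
  unfold l at hl
  have key : ∀ x, Ce t x → (ps t x = 14 ∨ ps (t+1) x = 14) → ps sN x ≠ 0 := by
    intro x cx hx ak
    by_cases ad : t < sf
    · have := E.allA h ad.le cx
      have := E.cov x
      omega
    have q := E.lc
    have hxe : x = Vv c := S.inj sN _ _ om
    have hp : ps c x = 15 := by rw [hxe, S.huv c]; have := q.1; unfold l at this; omega
    have ma := S.mono0 (sd := sf+NN) ak (t := t+NN) (tb := c+NN) om om om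
    have mc := S.mono0 (sd := sf+NN) ak (t := t+1+NN) (tb := c+NN) om om om
    have := S.flip t x; have := S.flip (t+1) x; have := S.flip c x
    omega
  exact ⟨key _ (by unfold cen; omega) om, key _ (by unfold cen; omega) om⟩

set_option maxHeartbeats 2000000 in
lemma stepS {t} (h : a + 1 ≤ t) (ae : t < c) :
    (S.sta sd sf c (t+1) = S.sta sd sf c t ∧ ¬ S.OQ t ∧ ¬ S.HQ t) ∨
    ∃ e : ℕ, DP.Suc (S.sta sd sf c t) (S.sta sd sf c (t+1)) e ∧
      (e : ℤ) - 1 = (if S.OQ t then 1 else 0) - (if S.HQ t then 1 else 0) := by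
  have hll := S.l_lt t
  have gc := S.eu t; have gb := S.ev t; have gf := S.el_l' t; have ga := S.el_l1' t
  have gn : ∀ i, i ≠ Le t → i ≠ Le t + 1 → i < 30 → El (t+1) i = El t i := fun i aa ad af => S.ez aa ad af
  have hc13 : Ce t (El t 13) := cen_el om om
  have cs : Ce t (El t 14) := cen_el om om
  have cw : Ce t (El t 15) := cen_el om om
  have hc16 : Ce t (El t 16) := cen_el om om
  have hpc : Le t ≠ 12 → S.pc sf (t+1) = S.pc sf t := fun hn => (pc_congr (fun x _ => left_same hn x)).symm
  have bz : ∀ t i j, ¬ R2S (El t i) (El t j) → S.bt (R2S) t i j = 0 := fun t i j => S.bt_zero.2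
  have bo : ∀ t i j, R2S (El t i) (El t j) → S.bt (R2S) t i j = 1 := fun t i j => S.bt_one.2
  have tsp := S.tg_sp (sd := sd) (sf := sf) (c := c)
  by_cases lg : Le t = 12
  · right
    refine ⟨1, .inr <| .inr <| .inr <| .inl ?_, by simp [OQ, HQ, lg]⟩
    rw [lg] at gc gb gf ga gn
    norm_num at gb ga
    have kb := gn 14 om om om
    have ke := gn 15 om om om
    have kd := gn 16 om om om
    have nl : El t 14 ≠ Vv t := by rw [← gb]; exact el_ne_el om om om
    have nx : El t 15 ≠ Vv t := by rw [← gb]; exact el_ne_el om om om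
    have nm : El t 16 ≠ Vv t := by rw [← gb]; exact el_ne_el om om om
    have cz := E.bitL h ae lg cs nl
    have db := E.bitL h ae lg cw nx
    have b16 := E.bitL h ae lg hc16 nm
    have tl := E.tagL h ae lg
    have tv := E.vg h ae lg
    have pl := E.pcL h ae lg
    have q14 := tl.2.2 _ cs; have q15 := tl.2.2 _ cw; have q16 := tl.2.2 _ hc16
    have p14 := tsp (El t 14); have p15 := tsp (El t 15); have p16 := tsp (El t 16)
    have pu := tsp (Uu t); have pv := tsp (Vv t)
    have cv := E.cov (Vv t)
    unfold sta
    dsimp only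
    refine ⟨⟨bz _ _ _ (by rw [gb]; exact cz.2), bz _ _ _ (by rw [gb]; exact db.2), bz _ _ _ (by rw [gb]; exact b16.2)⟩,
      DP.Lok_of ?_, ?_, rfl⟩
    · rw [gb]; omega
    · rw [pl.1, kb, ke, kd, ga, bo (t+1) 13 14 (by rw [ga, kb]; exact cz.1), bo (t+1) 13 15 (by rw [ga, ke]; exact db.1),
        bo (t+1) 13 16 (by rw [ga, kd]; exact b16.1), S.bt_congr kb ke, S.bt_congr kb kd, S.bt_congr ke kd]
      rw [show S.tg sd sf c (Uu t) = 4 by omega]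
  by_cases l13 : Le t = 13
  · right
    refine ⟨2, .inl ?_, by simp [OQ, HQ, l13]⟩
    rw [l13] at gc gb gf ga gn
    norm_num at gb ga
    have ke := gn 15 om om om
    have kd := gn 16 om om om
    have sw := E.swapR h ae (by rw [← gc]; exact hc13) (by rw [← gb]; exact cs)
    rw [← gc] at ga; rw [← gb] at gf
    unfold sta
    dsimp only
    refine ⟨bo _ _ _ (by rw [gc, gb]; exact sw.1), ?_, rfl⟩
    rw [hpc lg, gf, ga, ke, kd, bz (t+1) 13 14 (by rw [gf, ga, gc, gb]; exact sw.2), S.bt_congr gf ke, S.bt_congr gf kd,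
      S.bt_congr ga ke, S.bt_congr ga kd, S.bt_congr ke kd]
  by_cases l14 : Le t = 14
  · right
    refine ⟨0, .inr <| .inl ?_, by simp [OQ, HQ, l14]⟩
    have nc := E.noC1 h ae l14
    rw [l14] at gc gb gf ga gn
    norm_num at gb ga
    have kc := gn 13 om om om
    have kd := gn 16 om om om
    have sw := E.swapR h ae (by rw [← gc]; exact cs) (by rw [← gb]; exact cw)
    rw [← gc] at ga; rw [← gb] at gf
    have pu := tsp (Uu t); have pv := tsp (Vv t)
    unfold sta
    dsimp only
    refine ⟨bo _ _ _ (by rw [gc, gb]; exact sw.1), by rw [gc]; omega, by rw [gb]; omega, ?_, rfl⟩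
    rw [hpc lg, gf, ga, kc, kd, bz (t+1) 14 15 (by rw [gf, ga, gc, gb]; exact sw.2), S.bt_congr kc gf, S.bt_congr kc ga, S.bt_congr kc kd,
      S.bt_congr gf kd, S.bt_congr ga kd]
  by_cases l15 : Le t = 15
  · right
    refine ⟨2, .inr <| .inr <| .inl ?_, by simp [OQ, HQ, l15]⟩
    rw [l15] at gc gb gf ga gn
    norm_num at gb ga
    have kc := gn 13 om om om
    have kb := gn 14 om om om
    have sw := E.swapR h ae (by rw [← gc]; exact cw) (by rw [← gb]; exact hc16)
    rw [← gc] at ga; rw [← gb] at gf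
    unfold sta
    dsimp only
    refine ⟨bo _ _ _ (by rw [gc, gb]; exact sw.1), ?_, rfl⟩
    rw [hpc lg, gf, ga, kc, kb, bz (t+1) 15 16 (by rw [gf, ga, gc, gb]; exact sw.2), S.bt_congr kc gf, S.bt_congr kc ga, S.bt_congr kc kb,
      S.bt_congr kb gf, S.bt_congr kb ga]
  by_cases lk : Le t = 16
  · right
    refine ⟨1, .inr <| .inr <| .inr <| .inr ?_, by simp [OQ, HQ, lk]⟩
    have tr := E.tagR h ae lk
    have hcr := cenR lk
    rw [lk] at gc gb gf ga gn
    norm_num at gb ga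
    have kc := gn 13 om om om
    have kb := gn 14 om om om
    have ke := gn 15 om om om
    have nw : El t 13 ≠ Uu t := by rw [← gc]; exact el_ne_el om om om
    have nl : El t 14 ≠ Uu t := by rw [← gc]; exact el_ne_el om om om
    have nx : El t 15 ≠ Uu t := by rw [← gc]; exact el_ne_el om om om
    have b13 := E.bitR h ae lk hc13 nw
    have cz := E.bitR h ae lk cs nl
    have db := E.bitR h ae lk cw nx
    have pu := tsp (Uu t); have pv := tsp (Vv t)
    have cu := E.cov (Uu t); have cv := E.cov (Vv t)
    have all : ∀ {P : Fin 30 → Prop}, (∀ f, Ce t f → f ≠ Uu t → P f) → P (El t 13) ∧ P (El t 14) ∧ P (El t 15) :=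
      fun H => ⟨H _ hc13 nw, H _ cs nl, H _ cw nx⟩
    have ex : ∀ {P : Fin 30 → Prop}, (∃ f, Ce t f ∧ f ≠ Uu t ∧ P f) → P (El t 13) ∨ P (El t 14) ∨ P (El t 15) := by
      rintro P ⟨f, fa, fb, fc⟩
      rcases cen_cases fa with rfl | rfl | rfl | rfl
      · exact .inl fc
      · exact .inr <| .inl fc
      · exact .inr <| .inr fc
      · exact absurd gc fb
    have main : 4 ≤ S.tg sd sf c (Vv t) ∧ S.tg sd sf c (Vv t) ≤ 10 ∧
        DP.Rok (S.pc sf t) (S.tg sd sf c (El t 13)) (S.tg sd sf c (El t 14)) (S.tg sd sf c (El t 15)) (S.tg sd sf c (Uu t)) (S.tg sd sf c (Vv t)) = true := by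
      clear bz bo b13 cz db kc kb ke gn hpc
      rcases tr with ⟨xe, xd, ⟨xf, xg⟩ | ⟨xf, xg⟩⟩ | ⟨xe, xd, xf, xg, x5⟩ | ⟨xe, xd, xf, xg, x5, x6⟩
      · have ya := all (P := fun f => 4 ≤ S.tg sd sf c f ∨ S.tg sd sf c (Uu t) < S.tg sd sf c f)
          (fun f fa fb => by have := xd f fa fb; have := tsp f; omega)
        have yd := ex (P := fun f => S.tg sd sf c f ≤ 3) (by
          obtain ⟨f, fa, fb, fc⟩ := xf; exact ⟨f, fa, fb, by have := tsp f; omega⟩)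
        exact ⟨om, om, DP.Rok_of (.inl ⟨om, ya.1, ya.2.1, ya.2.2, .inl ⟨yd, om⟩⟩)⟩
      · have ya := all (P := fun f => S.tg sd sf c f = 4)
          (fun f fa fb => by have := xd f fa fb; have := xf f fa fb; have := tsp f; omega)
        exact ⟨om, om, DP.Rok_of (.inl ⟨om, .inl om, .inl om, .inl om,
          .inr ⟨om, om, om, om⟩⟩)⟩
      · have ya := all (P := fun f => 4 ≤ S.tg sd sf c f ∧ S.tg sd sf c f ≤ 6)
          (fun f fa fb => by have := xd f fa fb; have := tsp f; omega)
        have o4 : S.tg sd sf c (Uu t) = 4 := om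
        refine ⟨om, om, DP.Rok_of (.inr <| .inl ⟨o4, ya.1.1, ya.2.1.1, ya.2.2.1, ya.1.2, ya.2.1.2, ya.2.2.2, ?_⟩)⟩
        by_cases vc : ps sN (Vv t) < 4
        · obtain ⟨za, zb⟩ := x5 vc
          have yf := all (P := fun f => 5 ≤ S.tg sd sf c f)
            (fun f fa fb => by have := zb f fa fb; have := tsp f; have := E.cov f; omega)
          exact .inr <| .inr ⟨om, yf.1, yf.2.1, yf.2.2, za⟩
        · by_cases vg : ps (c+1) (Vv t) ≤ 12
          · have y4 := all (P := fun f => S.tg sd sf c f ≠ 5)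
              (fun f fa fb q => by
                have := xg vg f fa fb; have := tsp f; have := E.cov f
                have := E.noB h ae.le fa; omega)
            exact .inr <| .inl ⟨om, y4⟩
          · exact .inl om
      · have yf := ex (P := fun f => 7 ≤ S.tg sd sf c f) (by
          obtain ⟨f, fa, fb, fc⟩ := x5; exact ⟨f, fa, fb, by have := tsp f; have := E.cov f; omega⟩)
        have ye := all (P := fun f => 5 ≤ S.tg sd sf c f ∧ (S.tg sd sf c f ≤ 6 ∨ S.tg sd sf c (Vv t) < S.tg sd sf c f))
          (fun f fa fb => by have := x6 f fa fb; have := tsp f; have := E.cov f; omega)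
        exact ⟨om, om, DP.Rok_of (.inr <| .inr ⟨om, om, ye.1.1, ye.2.1.1, ye.2.2.1, xg, yf, ye.1.2, ye.2.1.2, ye.2.2.2⟩)⟩
    unfold sta
    dsimp only
    rw [gc, gf]
    refine ⟨⟨bz _ _ _ (by rw [gc]; exact b13.2), bz _ _ _ (by rw [gc]; exact cz.2), bz _ _ _ (by rw [gc]; exact db.2)⟩,
      main.2.2, main.1, main.2.1, ?_, rfl⟩
    rw [hpc lg, kc, kb, ke, bo (t+1) 13 16 (by rw [gf, kc]; exact b13.1), bo (t+1) 14 16 (by rw [gf, kb]; exact cz.1),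
        bo (t+1) 15 16 (by rw [gf, ke]; exact db.1), S.bt_congr kc kb, S.bt_congr kc ke, S.bt_congr kb ke]
  · left
    have kc := gn 13 om om om
    have kb := gn 14 om om om
    have ke := gn 15 om om om
    have kd := gn 16 om om om
    refine ⟨?_, by simp only [OQ]; omega, by simp only [HQ]; omega⟩
    unfold sta
    rw [hpc lg, kc, kb, ke, kd, S.bt_congr kc kb, S.bt_congr kc ke, S.bt_congr kc kd, S.bt_congr kb ke, S.bt_congr kb kd, S.bt_congr ke kd]

end Lk

noncomputable def be (S : SF) (s τ : ℕ) : ℕ := if S.pos (τ+1) (S.el s 2) < S.pos (τ+1) (S.el s 3) then 1 else 0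

lemma fourC {s t i} (h : ∀ y, ps s y < 4 → Ce t y) (hi : 13 ≤ i) (hi' : i ≤ 16) : ps s (El t i) < 4 := by
  by_contra hh
  have := pig (S := S) (s := t) (t := s) (a := 13) (b := 17) {0, 1, 2, 3, ps s (El t i)}
    (by intro j hj; simp only [mem_insert, mem_singleton] at hj; have := S.lt s (El t i); omega)
    (by
      intro j hj; simp only [mem_insert, mem_singleton] at hj
      have key : ∀ k, k < 4 → 13 ≤ ps t (El s k) ∧ ps t (El s k) < 17 := by
        intro k hk; have := h (El s k) (by rw [S.pos_el om]; exact hk)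
        unfold cen at this; omega
      rcases hj with rfl | rfl | rfl | rfl | rfl
      · exact key 0 om
      · exact key 1 om
      · exact key 2 om
      · exact key 3 om
      · rw [S.el_pos, S.pos_el om]; omega)
  have ah : ({0, 1, 2, 3, ps s (El t i)} : Finset ℕ).card = 5 := by
    rw [card_insert_of_notMem, card_insert_of_notMem, card_insert_of_notMem, card_insert_of_notMem, Finset.card_singleton]
    all_goals simp only [mem_insert, mem_singleton]; omega
  omega

lemma pos_el_ne {s t i j} (hi : i < 30) (hj : j < 30) (h : i ≠ j) : ps s (El t i) ≠ ps s (El t j) :=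
  S.pos_ne (el_ne_el hi hj h)

lemma ord23 {s t i j} (hij : i < j) (hj : j < 30)
    (h : (ps s (El t i) = 2 ∧ ps s (El t j) = 3) ∨ (ps s (El t i) = 3 ∧ ps s (El t j) = 2)) :
    (ps s (El t i) < ps s (El t j)) ↔ ps t (El s 2) < ps t (El s 3) := by
  have a := S.pos_el (t := t) (i := i) om
  have b := S.pos_el (t := t) (i := j) hj
  rcases h with ⟨aa, ad⟩ | ⟨aa, ad⟩ <;> rw [S.ek aa, S.ek ad, aa, ad, a, b] <;> omega

lemma perm3 {x y z : ℕ} (hx : x < 4) (hy : y < 4) (hz : z < 4) (x0 : x ≠ 0) (y0 : y ≠ 0) (z0 : z ≠ 0) (aa : x ≠ y) (ad : x ≠ z)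
    (af : y ≠ z) : (x = 1 ∨ y = 1 ∨ z = 1) ∧ (x = 1 → (y = 2 ∧ z = 3) ∨ (y = 3 ∧ z = 2)) ∧
    (y = 1 → (x = 2 ∧ z = 3) ∨ (x = 3 ∧ z = 2)) ∧ (z = 1 → (x = 2 ∧ y = 3) ∨ (x = 3 ∧ y = 2)) := by
  interval_cases x <;> interval_cases y <;> interval_cases z <;> simp_all

namespace Lk
variable (E : S.Lk sd sf sg a c)
include E

lemma btA {i j} (hij : i < j) (hj : j < 30)
    (h : (ps sd (El (a+1) i) = 2 ∧ ps sd (El (a+1) j) = 3) ∨ (ps sd (El (a+1) i) = 3 ∧ ps sd (El (a+1) j) = 2)) :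
    S.be sd a = S.bt (R2S) (a+1) i j := by
  have q := (E.R2A (x := El (a+1) i) (y := El (a+1) j) om om).trans (ord23 hij hj h)
  unfold be
  by_cases hR : R2S (El (a+1) i) (El (a+1) j)
  · rw [S.bt_one.2 hR, if_pos (q.1 hR)]
  · rw [S.bt_zero.2 hR, if_neg (fun z => hR (q.2 z))]

lemma btC {i j} (hij : i < j) (hj : j < 30)
    (h : (ps sN (El c i) = 2 ∧ ps sN (El c j) = 3) ∨ (ps sN (El c i) = 3 ∧ ps sN (El c j) = 2)) :
    S.be sN (c+NN) = S.bt (R2S) c i j := by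
  have q := ord23 hij hj h
  have q' : R2S (El c i) (El c j) ↔ ps (c+NN+1) (El sN 2) < ps (c+NN+1) (El sN 3) := by
    rw [E.R2C om, show c + NN + 1 = c + 1 + NN by omega, S.flip_lt]
    have v0 := E.lc.2
    have pb := S.pos_el (t := sf+NN) (i := 2) om
    have p3 := S.pos_el (t := sf+NN) (i := 3) om
    have ne2 : El sN 2 ≠ Vv c := by intro e; rw [← e] at v0; omega
    have ne3 : El sN 3 ≠ Vv c := by intro e; rw [← e] at v0; omega
    rw [S.step_iff c _ _ (fun h => ne2 h.2) (fun h => ne3 h.1)]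
    have := S.flip sf (El c i); have := S.flip sf (El c j)
    have := S.pos_ne (t := c) (x := El sN 2) (y := El sN 3) (fun e => by rw [e] at pb; omega)
    omega
  unfold be
  by_cases hR : R2S (El c i) (El c j)
  · rw [S.bt_one.2 hR, if_pos (q'.1 hR)]
  · rw [S.bt_zero.2 hR, if_neg (fun z => hR (q'.2 z))]

set_option maxHeartbeats 2000000 in
lemma third : 2 + (S.be sN (c+NN) : ℤ) - S.be sd a ≤ (cn S.OQ (a+1) (c+1) : ℤ) - cn S.HQ (a+1) (c+1) := by
  have hac := E.hac
  have tsp := S.tg_sp (sd := sd) (sf := sf) (c := c)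
  have kA : ∀ i, 13 ≤ i → i ≤ 16 → ps sd (El (a+1) i) < 4 := fun i => fourC (fun y hy => (E.T.hK y hy).2)
  have kC : ∀ i, 13 ≤ i → i ≤ 16 → ps sN (El c i) < 4 := fun i => fourC (fun y hy => E.hKc hy)
  have start : DP.init.has (S.sta sd sf c (a+1)).code (S.be sd a) := by
    have e15 : El (a+1) 15 = Uu a := by have := S.el_l1' a; rwa [E.T.hl] at this
    have xb : ps sd (El (a+1) 15) = 0 := by rw [e15, E.T.hu]
    have kc := kA 13 om om; have kb := kA 14 om om; have kd := kA 16 om om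
    have nw : ps (sd) (El (a+1) 13) ≠ 0 := by have := (S.pos_el_ne (s := sd) (t := a+1) (i := 13) (j := 15) om om om); rwa [xb] at this
    have nl : ps (sd) (El (a+1) 14) ≠ 0 := by have := (S.pos_el_ne (s := sd) (t := a+1) (i := 14) (j := 15) om om om); rwa [xb] at this
    have nm : ps (sd) (El (a+1) 16) ≠ 0 := by have := (S.pos_el_ne (s := sd) (t := a+1) (i := 16) (j := 15) om om om); rwa [xb] at this
    have pm := perm3 kc kb kd nw nl nm (S.pos_el_ne (s := sd) (t := a+1) (i := 13) (j := 14) om om om) (S.pos_el_ne (s := sd) (t := a+1) (i := 13) (j := 16) om om om) (S.pos_el_ne (s := sd) (t := a+1) (i := 14) (j := 16) om om om)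
    have tA : ∀ x, ps sd x < 4 → S.tg sd sf c x = ps sd x := by intro x hx; have := tsp x; clear pm; omega
    have t13 := tA _ kc; have t14 := tA _ kb; have t15 := tA (El (a+1) 15) (by rw [xb]; omega); have t16 := tA _ kd
    have b02 := E.R2A (x := El (a+1) 13) (y := El (a+1) 15) (by clear pm; omega) (by rw [xb]; omega)
    have dt := E.R2A (x := El (a+1) 14) (y := El (a+1) 15) (by clear pm; omega) (by rw [xb]; omega)
    have b23 := E.R2A (x := El (a+1) 15) (y := El (a+1) 16) (by rw [xb]; omega) (by clear pm; omega)
    refine DP.init_mem _ (S.sta_ok _) _ ?_ ?_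
    · unfold sta; dsimp only
      rw [xb] at b02 dt b23 t15
      refine ⟨E.pc0, t15, S.bt_zero.2 (by rw [b02]; exact Nat.not_lt_zero _), S.bt_zero.2 (by rw [dt]; exact Nat.not_lt_zero _), S.bt_one.2 (by rw [b23]; exact Nat.pos_of_ne_zero nm)⟩
    · unfold sta; dsimp only
      rw [t13, t14, t16]
      rcases pm.1 with h | h | h
      · exact .inl ⟨h, pm.2.1 h, E.btA om om (pm.2.1 h)⟩
      · exact .inr <| .inl ⟨h, pm.2.2.1 h, E.btA om om (pm.2.2.1 h)⟩
      · exact .inr <| .inr ⟨h, pm.2.2.2 h, E.btA om om (pm.2.2.2 h)⟩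
  obtain ⟨n, v, hv, hfin⟩ := DP.main (S.sta sd sf c) S.sta_ok (fun t => (S.be sd a : ℤ) + cn S.OQ (a+1) t - cn S.HQ (a+1) t) (a+1) c hac
    (S.be sd a) start (by simp [cn_self]) (by
      intro t aa ad
      have o := cn_succ S.OQ aa; have oa := cn_succ S.HQ aa
      rcases E.stepS aa ad with ⟨x, y, z⟩ | ⟨e, x, y⟩
      · refine .inl ⟨x, ?_⟩
        simp only [y, z, if_false] at o oa
        show (S.be sd a : ℤ) + cn S.OQ (a+1) (t+1) - cn S.HQ (a+1) (t+1) = (S.be sd a : ℤ) + cn S.OQ (a+1) t - cn S.HQ (a+1) t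
        omega
      · refine .inr ⟨e, x, ?_⟩
        show (S.be sd a : ℤ) + cn S.OQ (a+1) (t+1) - cn S.HQ (a+1) (t+1) = (S.be sd a : ℤ) + cn S.OQ (a+1) t - cn S.HQ (a+1) t + e - 1
        rw [o, oa]
        push_cast
        omega)
  have lc := E.lc
  have e14 : El c 14 = Uu c := by have := S.eu c; rwa [lc.1] at this
  have e15 : El c 15 = Vv c := by have := S.ev c; rwa [lc.1] at this
  have xb : ps sN (El c 15) = 0 := by rw [e15]; exact lc.2
  have kc := kC 13 om om; have kb := kC 14 om om; have kd := kC 16 om om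
  have nw : ps sN (El (c) 13) ≠ 0 := by have := (S.pos_el_ne (s := sf+NN) (t := c) (i := 13) (j := 15) om om om); rwa [xb] at this
  have nl : ps sN (El (c) 14) ≠ 0 := by have := (S.pos_el_ne (s := sf+NN) (t := c) (i := 14) (j := 15) om om om); rwa [xb] at this
  have nm : ps sN (El (c) 16) ≠ 0 := by have := (S.pos_el_ne (s := sf+NN) (t := c) (i := 16) (j := 15) om om om); rwa [xb] at this
  have pm := perm3 kc kb kd nw nl nm (S.pos_el_ne (s := sf+NN) (t := c) (i := 13) (j := 14) om om om) (S.pos_el_ne (s := sf+NN) (t := c) (i := 13) (j := 16) om om om) (S.pos_el_ne (s := sf+NN) (t := c) (i := 14) (j := 16) om om om)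
  have tC : ∀ x, ps sN x < 4 → S.tg sd sf c x = 7 + ps sN x := by
    intro x hx; have := tsp x; have := E.cov x; clear pm; omega
  have dt := E.R2C (x := El c 14) (y := El c 15) (by clear pm; omega)
  have f14 := S.flip sf (El c 14); have f15 := S.flip sf (El c 15)
  have q13 := tC _ kc; have q14 := tC _ kb; have q16 := tC _ kd; have q15 := tC (El c 15) (by rw [xb]; omega)
  have o := cn_succ S.OQ hac; have oa := cn_succ S.HQ hac
  rw [if_neg (by unfold OQ; clear pm; omega)] at o
  rw [if_pos (by unfold HQ; clear pm; omega)] at oa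
  unfold sta at hfin
  dsimp only at hfin
  have b12' : R2S (El c 14) (El c 15) := by rw [dt]; clear pm; omega
  rw [xb] at q15
  have out := DP.fin_out hfin ⟨q15, S.bt_one.2 b12', by clear pm; omega, by clear pm; omega, by clear pm; omega⟩
  rw [q16, q14] at out
  rcases out with ⟨aa, ad⟩ | ⟨ak, aa, ad⟩ | ⟨ak, aa, ad⟩
  · rw [← E.btC om om (pm.2.2.2 (by clear pm; omega))] at ad; clear pm; omega
  · rw [← E.btC om om (pm.2.2.1 (by clear pm; omega))] at ad; clear pm; omega
  · have e : ps sN (El c 13) = 1 := by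
      rcases pm.1 with h | h | h
      · exact h
      · rw [h] at aa; exact absurd rfl aa
      · rw [h] at ak; exact absurd rfl ak
    rw [← E.btC om om (pm.2.1 e)] at ad; clear pm; omega

end Lk

theorem Ta.slack (D : DT) : ∃ s, cn S.HQ s (s+NN) + 6 ≤ cn S.OQ s (s+NN) := by
  obtain ⟨a, T⟩ := D.exists_tau
  obtain ⟨bj, T1⟩ := D.rot.exists_tau
  obtain ⟨cp, T2⟩ := D.rot.rot.exists_tau
  obtain ⟨b, rfl⟩ : ∃ b, bj = b + NN := ⟨bj - NN, by have := T1.aa; omega⟩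
  obtain ⟨c, rfl⟩ : ∃ c, cp = c + NN + NN := ⟨cp - NN - NN, by have := T2.aa; omega⟩
  have Tb : S.Tau (sd+NN+NN+NN+NN) (sg+NN+NN+NN+NN) (a+NN+NN+NN+NN) := by
    refine ⟨by have := T.aa; omega, by have := T.ad; omega, ?_, ?_, ?_⟩
    · rw [S.ln, S.ln]; exact T.hl
    · rw [S.pos_4N, (S.uv2N _).1, (S.uv2N _).1]; exact T.hu
    · intro y hy
      rw [S.pos_4N] at hy
      have := T.hK y hy
      rw [show a+NN+NN+NN+NN+1 = a+1+NN+NN+NN+NN by omega]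
      simpa only [cenN] using this
  have Ea : S.Lk sd sf sg a b := ⟨D, T, T1⟩
  have Eb : S.Lk _ _ _ (b+NN) (c+NN) := ⟨D.rot, T1, by
    convert T2 using 1⟩
  have Ec : S.Lk _ _ _ (c+NN+NN) (a+NN+NN+NN) := ⟨D.rot.rot, T2, by
    convert Tb using 1 <;> omega⟩
  have tj := Ea.third; have td := Eb.third; have tf := Ec.third
  have aa := Ea.hac; have ad := Eb.hac; have af := Ec.hac
  have be3 : S.be (sd+NN+NN+NN+NN) (a+NN+NN+NN+NN) = S.be sd a := by
    unfold be
    have : ∀ i < 30, El (sd+NN+NN+NN+NN) i = El sd i := fun i hi => S.ek (by rw [S.pos_4N, S.pos_el hi])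
    rw [show a+NN+NN+NN+NN+1 = a+1+NN+NN+NN+NN by omega, S.pos_4N, S.pos_4N, this 2 om, this 3 om]
  have sh : ∀ (P : ℕ → Prop) [DecidablePred P] (hP : ∀ t, P (t+NN) ↔ P t),
      cn P (b+NN+1) (c+NN+1) = cn P (b+1) (c+1) ∧ cn P (c+NN+NN+1) (a+NN+NN+NN+1) = cn P (c+1) (a+1+NN) := by
    intro P _ hP
    constructor
    · rw [show b+NN+1 = b+1+NN by omega, show c+NN+1 = c+1+NN by omega, S.cn_shift hP]
    · rw [show c+NN+NN+1 = c+1+NN+NN by omega, show a+NN+NN+NN+1 = a+1+NN+NN+NN by omega, S.cn_shift hP, S.cn_shift hP]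
  have o := sh S.OQ S.OQ_N; have oa := sh S.HQ S.HQ_N
  rw [o.1, oa.1] at td; rw [o.2, oa.2, be3] at tf
  refine ⟨a+1, ?_⟩
  have xe := cn_add S.OQ (a := a+1) (b := b+1) (c := c+1) om om
  have xd := cn_add S.OQ (a := a+1) (b := c+1) (c := a+1+NN) om om
  have xf := cn_add S.HQ (a := a+1) (b := b+1) (c := c+1) om om
  have xg := cn_add S.HQ (a := a+1) (b := c+1) (c := a+1+NN) om om
  omega

lemma pr_univ (K t) : S.pr univ K t ↔ (Le t < K ∨ 28 < Le t + K) := by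
  unfold pr l
  rw [S.rk_univ (by simp)]
  simp only [mem_univ, true_and, Finset.card_univ, Fintype.card_fin]
  omega

lemma Ef (K) : S.EL univ K = cn (fun t => Le t < K ∨ 28 < Le t + K) 0 NN := by
  unfold EL cn
  congr 1
  apply Finset.filter_congr
  intro t _
  exact pr_univ K t

lemma dv {A B C : ℕ → Prop} [DecidablePred A] [DecidablePred B] [DecidablePred C] (s sk)
    (h : ∀ t, C t ↔ (A t ∨ B t)) (ae : ∀ t, A t → ¬ B t) : cn C s sk = cn A s sk + cn B s sk := by
  unfold cn
  rw [← card_union_of_disjoint, ← Finset.filter_or]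
  · congr 1; apply Finset.filter_congr; intro t _; exact h t
  · rw [Finset.disjoint_filter]; intro t _; exact ae t

lemma sum_l : ∑ t ∈ Ico 0 NN, Le t * (28 - Le t) + ∑ j ∈ range 14, (27 - 2*j) * S.EL univ (j+1) = 196 * NN := by
  have key : ∀ l < 29, l * (28 - l) + ∑ j ∈ range 14, (27 - 2*j) * (if l < j+1 ∨ 28 < l + (j+1) then 1 else 0) = 196 := by decide
  have : ∀ j, S.EL univ (j+1) = ∑ t ∈ Ico 0 NN, if Le t < j+1 ∨ 28 < Le t + (j+1) then 1 else 0 := by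
    intro j; rw [Ef, cn, Finset.card_filter]
  simp only [this, Finset.mul_sum]
  rw [Finset.sum_comm, ← Finset.sum_add_distrib, Finset.sum_congr rfl (fun t _ => key _ (S.l_lt t))]
  simp; ring

set_option maxHeartbeats 2000000 in
theorem sum_bound (hN : NN = 435) : ∑ t ∈ Ico 0 NN, Le t * (28 - Le t) + 9726 ≤ 82215 := by
  have hs := S.sum_l
  rw [hN] at hs ⊢
  suffices h : 12771 ≤ ∑ j ∈ range 14, (27 - 2*j) * S.EL univ (j+1) by omega
  clear hs
  simp only [sum_range_succ, Finset.sum_range_zero]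
  norm_num only
  have cu : (univ : Finset (Fin 30)).card = 30 := by simp
  have T : Tb 1 = 3 ∧ Tb 2 = 9 ∧ Tb 3 = 18 ∧ Tb 4 = 30 ∧ Tb 5 = 45 ∧ Tb 6 = 63 ∧ Tb 7 = 84 ∧ Tb 8 = 108 ∧ Tb 9 = 135 ∧
    Tb 10 = 165 ∧ Tb 11 = 198 ∧ Tb 12 = 234 ∧ Tb 13 = 273 ∧ Tb 14 = 315 := by decide
  obtain ⟨aq, aj, bg, dn, a5, a6, a7, a8, a9, a10, a11, a12, a13, a14⟩ := T
  have eh := S.Ext_ge3 (U := univ) om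
  have b := fun K (h : 2*K+1 ≤ 30) => S.Ee (U := univ) (K := K) om
  rcases Nat.lt_or_ge 3 (S.Ext univ).card with ag | ag
  · have g := fun K (h : 1 ≤ K) (ae : 2*K+1 ≤ 30) => S.EL_ge' (U := univ) (K := K) h om ag
    have := g 1 om om; have := g 2 om om; have := g 3 om om; have := g 4 om om
    have := g 5 om om; have := g 6 om om; have := g 7 om om; have := g 8 om om
    have := g 9 om om; have := g 10 om om; have := g 11 om om; have := g 12 om om
    have := g 13 om om; have := g 14 om om
    omega
  have hE : (S.Ext univ).card = 3 := om
  set U := univ \ S.Ext univ with hU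
  have cc : U.card = 27 := by have := S.card_sdiff_Ext hE; rw [← hU] at this; omega
  have e3' := S.Ext_ge3 (U := U) om
  have C : ∀ K M, 2*K+5 ≤ 30 → M = K+2 → 6*K+9 + S.EL U K + 3*(K+1) ≤ S.EL univ M + 27 ∧ 6*K+9 + S.EL U K ≤ S.EL univ M := by
    rintro K _ h rfl
    have := S.stepC (U := univ) (K := K) hE om
    rw [← hU, cc] at this; exact this
  have bu := b 1 om; have dj := b 2 om
  rcases Nat.lt_or_ge 3 (S.Ext U).card with h4' | h4'
  · have g := fun K (h : 1 ≤ K) (ae : 2*K+1 ≤ 27) => S.EL_ge' (U := U) (K := K) h om h4'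
    have := g 1 om om; have := g 2 om om; have := g 3 om om; have := g 4 om om
    have := g 5 om om; have := g 6 om om; have := g 7 om om; have := g 8 om om
    have := g 9 om om; have := g 10 om om; have := g 11 om om; have := g 12 om om
    have := C 1 3 om rfl; have := C 2 4 om rfl; have := C 3 5 om rfl; have := C 4 6 om rfl
    have := C 5 7 om rfl; have := C 6 8 om rfl; have := C 7 9 om rfl; have := C 8 10 om rfl
    have := C 9 11 om rfl; have := C 10 12 om rfl; have := C 11 13 om rfl; have := C 12 14 om rfl
    omega
  have hE' : (S.Ext U).card = 3 := om
  have cd := S.card_sdiff_Ext hE'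
  have d8 := S.Ee (U := U \ S.Ext U) (K := 8) om
  have C8 := S.stepC (U := U) (K := 8) hE' om
  simp only [Nat.reduceAdd] at C8
  have f9 := S.Ee (U := U) (K := 9) om
  have C9 := C 9 11 om rfl; have C10 := C 10 12 om rfl
  have bv := b 3 om; have b4 := b 4 om; have b5 := b 5 om; have b6 := b 6 om; have b7 := b 7 om
  have b8 := b 8 om; have b9 := b 9 om; have b10 := b 10 om
  have x12 := dv (A := fun t => Le t < 12 ∨ 28 < Le t + 12) (B := S.borQ) (C := fun t => Le t < 13 ∨ 28 < Le t + 13) 0 NN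
    (fun t => by unfold borQ; omega) (fun t => by unfold borQ; omega)
  have x13 := dv (A := fun t => Le t < 13 ∨ 28 < Le t + 13) (B := S.OQ) (C := fun t => Le t < 14 ∨ 28 < Le t + 14) 0 NN
    (fun t => by unfold OQ; omega) (fun t => by unfold OQ; omega)
  have x14 := dv (A := fun t => Le t < 14 ∨ 28 < Le t + 14) (B := S.HQ) (C := fun _ => True) 0 NN
    (fun t => iff_of_true trivial (by unfold HQ; omega)) (fun t => by unfold HQ; omega)
  have xc := dv (A := S.OQ) (B := S.HQ) (C := S.cenQ) 0 NN
    (fun t => by unfold HQ OQ cenQ; omega) (fun t => by unfold OQ HQ; omega)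
  have xt : cn (fun _ => True) 0 NN = 435 := by unfold cn; simp [hN]
  rw [← Ef, ← Ef] at x12 x13; rw [← Ef, xt] at x14
  have yb := S.cen_le 0; have ya := S.H_le 0
  rw [Nat.zero_add] at yb ya
  by_contra hlt
  obtain ⟨y11, yg⟩ := yb; obtain ⟨y21, yh⟩ := ya
  have hb1 : 1 ≤ cn S.borQ 0 NN := by by_contra hh; clear yg yh; omega
  have ho1 : 1 ≤ cn S.OQ 0 NN := by by_contra hh; clear yg yh; omega
  replace yg := yg hb1; replace yh := yh ho1
  obtain ⟨A, B, C', sd, sf, sg, D⟩ := S.exists_DD (by simp) hE om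
  have D' : S.Ta sd sf sg := ⟨D.toTT, by rw [S.cn_window S.borQ_N _ 0, Nat.zero_add]; omega,
    by rw [S.cn_window S.cenQ_N _ 0, Nat.zero_add]; omega⟩
  obtain ⟨s, hs⟩ := D'.slack
  rw [S.cn_window S.HQ_N _ 0, S.cn_window S.OQ_N _ 0, Nat.zero_add] at hs
  omega

end Sq

structure Ix where
  k : Fin 30 → Fin 30 → ℕ
  lt : ∀ x y, x < y → k x y < 435
  inj : ∀ x y xh yc, x < y → xh < yc → k x y = k xh yc → x = xh ∧ y = yc
  surj : ∀ t, t < 435 → ∃ q : Fin 30 × Fin 30, q.1 < q.2 ∧ k q.1 q.2 = t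
  mid : ∀ x y z, x < y → y < z → (k x y < k x z ∧ k x z < k y z) ∨ (k y z < k x z ∧ k x z < k x y)

namespace Ix
variable (I : Ix)

def bef (t : ℕ) (x y : Fin 30) : Prop :=
  (x < y ∧ (t + 434 - I.k x y) / 435 % 2 = 0) ∨ (y < x ∧ (t + 434 - I.k y x) / 435 % 2 = 1)

instance (t x y) : Decidable (I.bef t x y) := by unfold bef; infer_instance

lemma bef_ne {t x y} (h : I.bef t x y) : x ≠ y := by
  rintro rfl; unfold bef at h; simp at h

lemma bef_not {t x y} (h : I.bef t x y) : ¬ I.bef t y x := by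
  unfold bef at *
  rcases h with ⟨a, b⟩ | ⟨a, b⟩ <;> rintro (⟨c, d⟩ | ⟨c, d⟩) <;> first | exact absurd c a.asymm | omega

lemma bef_tot {t x y} (h : x ≠ y) : I.bef t x y ∨ I.bef t y x := by
  unfold bef
  rcases lt_or_gt_of_ne h with a | a
  · rcases Nat.mod_two_eq_zero_or_one ((t + 434 - I.k x y) / 435) with b | b
    · exact .inl (.inl ⟨a, b⟩)
    · exact .inr (.inr ⟨a, b⟩)
  · rcases Nat.mod_two_eq_zero_or_one ((t + 434 - I.k y x) / 435) with b | b
    · exact .inr (.inl ⟨a, b⟩)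
    · exact .inl (.inr ⟨a, b⟩)

lemma par {t k} (h : k < 435) : (t + 434 - k) / 435 = t / 435 + if k < t % 435 then 1 else 0 := by
  split_ifs <;> omega

lemma bef_trans {t x y z} (h : I.bef t x y) (ae : I.bef t y z) : I.bef t x z := by
  by_contra hn
  have hxz : x ≠ z := by rintro rfl; exact I.bef_not h ae
  have cq := (I.bef_tot (t := t) hxz).resolve_left hn
  clear hn
  unfold bef at h ae cq
  have key : ∀ x y z, x < y → y < z → (t + 434 - I.k x y) / 435 % 2 = (t + 434 - I.k y z) / 435 % 2 →
      (t + 434 - I.k x z) / 435 % 2 = (t + 434 - I.k x y) / 435 % 2 := by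
    intro x y z a b
    have m := I.mid x y z a b
    have := I.lt x y a; have := I.lt y z b; have := I.lt x z (a.trans b)
    rw [par ‹I.k x y < 435›, par ‹I.k y z < 435›, par ‹I.k x z < 435›]
    split_ifs <;> omega
  rcases h with ⟨a, b⟩ | ⟨a, b⟩ <;> rcases ae with ⟨bi, bj⟩ | ⟨bi, bj⟩ <;> rcases cq with ⟨bw, b''⟩ | ⟨bw, b''⟩
  · exact absurd (a.trans bi) bw.asymm
  · have := key x y z a bi; omega
  · have := key z x y bw a; omega
  · have := key x z y bw bi; omega
  · have := key y z x bi bw; omega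
  · have := key y x z a bw; omega
  · have := key z y x bi a; omega
  · exact absurd (bi.trans a) bw.asymm

def pos (t : ℕ) (x : Fin 30) : ℕ := (univ.filter fun y => I.bef t y x).card

lemma pos_lt {t x y} (h : I.bef t x y) : I.pos t x < I.pos t y := by
  apply card_lt_card
  refine ⟨fun z hz => ?_, fun hh => ?_⟩
  · simp only [mem_filter, mem_univ, true_and] at *
    exact I.bef_trans hz h
  · have := hh (mem_filter.2 ⟨mem_univ _, h⟩)
    exact I.bef_ne (mem_filter.1 this).2 rfl

lemma pos_iff {t x y} : I.pos t x < I.pos t y ↔ I.bef t x y := by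
  refine ⟨fun h => ?_, I.pos_lt⟩
  have hne : x ≠ y := by rintro rfl; omega
  rcases I.bef_tot (t := t) hne with a | a
  · exact a
  · have := I.pos_lt a; omega

lemma bef_flip {t x y} : I.bef (t+435) x y ↔ I.bef t y x := by
  have key : ∀ x y, x < y → (t + 435 + 434 - I.k x y) / 435 = (t + 434 - I.k x y) / 435 + 1 := by
    intro x y h; have := I.lt x y h; omega
  unfold bef
  constructor
  · rintro (⟨a, b⟩ | ⟨a, b⟩) <;> rw [key _ _ a] at b
    · exact .inr ⟨a, om⟩
    · exact .inl ⟨a, om⟩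
  · rintro (⟨a, b⟩ | ⟨a, b⟩)
    · exact .inr ⟨a, by rw [key _ _ a]; omega⟩
    · exact .inl ⟨a, by rw [key _ _ a]; omega⟩

lemma pos_flip (t x) : I.pos (t+435) x + I.pos t x = 29 := by
  unfold pos
  simp only [bef_flip]
  rw [← card_union_of_disjoint, ← Finset.filter_or]
  · have : (univ.filter fun y => I.bef t x y ∨ I.bef t y x) = univ.erase x := by
      ext y; simp only [mem_filter, mem_univ, true_and, mem_erase, and_true]
      exact ⟨fun h => h.elim (fun h => (I.bef_ne h).symm) I.bef_ne, fun h => I.bef_tot (Ne.symm h)⟩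
    rw [this]; simp
  · rw [Finset.disjoint_filter]; intro y _; exact I.bef_not

noncomputable def q (t : ℕ) : Fin 30 × Fin 30 := (I.surj (t % 435) (Nat.mod_lt _ om)).choose
lemma qc (t) : (I.q t).1 < (I.q t).2 := (I.surj (t % 435) (Nat.mod_lt _ om)).choose_spec.1
lemma qd (t) : I.k (I.q t).1 (I.q t).2 = t % 435 := (I.surj (t % 435) (Nat.mod_lt _ om)).choose_spec.2

noncomputable def u (t : ℕ) : Fin 30 := if t / 435 % 2 = 0 then (I.q t).1 else (I.q t).2
noncomputable def v (t : ℕ) : Fin 30 := if t / 435 % 2 = 0 then (I.q t).2 else (I.q t).1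

lemma uv_bef (t) : I.bef t (I.u t) (I.v t) ∧ I.bef (t+1) (I.v t) (I.u t) := by
  have h := I.qc t; have e := I.qd t
  unfold u v bef
  split_ifs with c
  · exact ⟨.inl ⟨h, by rw [e]; omega⟩, .inr ⟨h, by rw [e]; omega⟩⟩
  · exact ⟨.inr ⟨h, by rw [e]; omega⟩, .inl ⟨h, by rw [e]; omega⟩⟩

lemma bef_step {t x y} (h : ¬ (x = I.u t ∧ y = I.v t)) (ae : ¬ (x = I.v t ∧ y = I.u t)) :
    I.bef (t+1) x y ↔ I.bef t x y := by
  have hq : ∀ x y, x < y → ¬ (x = (I.q t).1 ∧ y = (I.q t).2) → (t + 1 + 434 - I.k x y) / 435 = (t + 434 - I.k x y) / 435 := by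
    intro x y a b
    have : I.k x y ≠ t % 435 := fun e => b (I.inj _ _ _ _ a (I.qc t) (by rw [I.qd, e]))
    have := I.lt x y a; omega
  have aa : ¬ (x = (I.q t).1 ∧ y = (I.q t).2) := by
    unfold u v at h ae; split_ifs at h ae <;> assumption
  have ad : ¬ (y = (I.q t).1 ∧ x = (I.q t).2) := by
    unfold u v at h ae; split_ifs at h ae <;> (rw [and_comm]; assumption)
  unfold bef
  constructor <;> rintro (⟨a, b⟩ | ⟨a, b⟩)
  · exact .inl ⟨a, by rw [hq _ _ a aa] at b; exact b⟩
  · exact .inr ⟨a, by rw [hq _ _ a ad] at b; exact b⟩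
  · exact .inl ⟨a, by rw [hq _ _ a aa]; exact b⟩
  · exact .inr ⟨a, by rw [hq _ _ a ad]; exact b⟩

lemma adj {t y} (aa : y ≠ I.u t) (ad : y ≠ I.v t) : I.bef t y (I.v t) ↔ I.bef t y (I.u t) := by
  have ⟨a, b⟩ := I.uv_bef t
  refine ⟨fun h => ?_, fun h => I.bef_trans h a⟩
  rcases I.bef_tot (t := t) aa with c | c
  · exact c
  · exact absurd b (I.bef_not (I.bef_trans ((I.bef_step (fun e => ad e.2) (fun e => aa e.2)).2 c)
      ((I.bef_step (fun e => aa e.1) (fun e => ad e.1)).2 h)))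

noncomputable def toSq : SF where
  N := 435
  pos := I.pos
  u := I.u
  v := I.v
  inj t x y h := by
    by_contra hn
    rcases I.bef_tot (t := t) hn with a | a <;> have := I.pos_lt a <;> omega
  lt t x := by have := I.pos_flip t x; omega
  huv t := by
    have ⟨a, b⟩ := I.uv_bef t
    unfold pos
    rw [← card_insert_of_notMem (s := univ.filter fun y => I.bef t y (I.u t)) (a := I.u t)
      (fun h => I.bef_ne (mem_filter.1 h).2 rfl)]
    congr 1; ext y
    simp only [mem_filter, mem_univ, true_and, mem_insert]
    by_cases aa : y = I.u t
    · subst aa; simp [a]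
    · by_cases ad : y = I.v t
      · subst ad; simp only [aa, false_or]
        exact ⟨fun h => absurd rfl (I.bef_ne h), fun h => absurd h (I.bef_not a)⟩
      · simp only [aa, false_or]; exact I.adj aa ad
  hu t := by
    have ⟨a, b⟩ := I.uv_bef t
    unfold pos
    rw [← card_insert_of_notMem (s := univ.filter fun y => I.bef t y (I.u t)) (a := I.v t)
      (fun h => I.bef_not a (mem_filter.1 h).2)]
    congr 1; ext y
    simp only [mem_filter, mem_univ, true_and, mem_insert]
    by_cases ad : y = I.v t
    · rw [ad]; simp [b]
    · simp only [ad, false_or]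
      exact I.bef_step (fun e => I.bef_ne a e.2) (fun e => ad e.1)
  hv t := by
    have ⟨a, b⟩ := I.uv_bef t
    unfold pos
    congr 1; ext y
    simp only [mem_filter, mem_univ, true_and]
    by_cases aa : y = I.u t
    · rw [aa]
      exact ⟨fun h => absurd b (I.bef_not h), fun h => absurd rfl (I.bef_ne h)⟩
    · by_cases ad : y = I.v t
      · rw [ad]
        exact ⟨fun h => absurd rfl (I.bef_ne h), fun h => absurd h (I.bef_not a)⟩
      · rw [← I.adj aa ad]
        exact I.bef_step (fun e => aa e.1) (fun e => ad e.1)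
  hx t x aa ad := by
    unfold pos
    congr 1; ext y
    simp only [mem_filter, mem_univ, true_and]
    exact I.bef_step (fun e => ad e.2) (fun e => aa e.2)
  flip := I.pos_flip
  btw s r sk x y aa ad af := by
    simp only [pos_iff]
    unfold bef
    rintro (⟨a, b⟩ | ⟨a, b⟩) (⟨bi, bj⟩ | ⟨bi, bj⟩)
    · left; have := I.lt _ _ a; exact ⟨a, om⟩
    · exact absurd a bi.asymm
    · exact absurd a bi.asymm
    · right; have := I.lt _ _ a; exact ⟨a, om⟩

end Ix

namespace Geo
variable {fx fy : Fin 30 → ℝ}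

def A (fx fy : Fin 30 → ℝ) (x y z : Fin 30) : ℝ := (fx y - fx x) * (fy z - fy x) - (fy y - fy x) * (fx z - fx x)

noncomputable def key (fx fy : Fin 30 → ℝ) (q : Fin 30 × Fin 30) : ℝ ×ₗ (Fin 30 ×ₗ Fin 30) :=
  toLex ((fy q.2 - fy q.1) / (fx q.2 - fx q.1), toLex q)

def Q : Finset (Fin 30 × Fin 30) := univ.filter fun q => q.1 < q.2

lemma Q_card : Q.card = 435 := by decide +kernel

noncomputable def k (fx fy : Fin 30 → ℝ) (q : Fin 30 × Fin 30) : ℕ := (Q.filter fun r => key fx fy r < key fx fy q).card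

lemma k_lt {q r} (hq : q ∈ Q) (h : key fx fy q < key fx fy r) : k fx fy q < k fx fy r := by
  apply card_lt_card
  refine ⟨fun z hz => ?_, fun hh => ?_⟩
  · simp only [mem_filter] at *; exact ⟨hz.1, hz.2.trans h⟩
  · have := hh (mem_filter.2 ⟨hq, h⟩)
    exact absurd (mem_filter.1 this).2 (lt_irrefl _)

lemma key_inj {q r} (h : key fx fy q = key fx fy r) : q = r := by
  unfold key at h; simpa using (congrArg (fun z => ofLex (ofLex z).2) h)

lemma k_inj {q r} (hq : q ∈ Q) (hr : r ∈ Q) (h : k fx fy q = k fx fy r) : q = r := by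
  rcases lt_trichotomy (key fx fy q) (key fx fy r) with a | a | a
  · have := k_lt hq a; omega
  · exact key_inj a
  · have := k_lt hr a; omega

lemma kh {q} (hq : q ∈ Q) : k fx fy q < 435 := by
  rw [← Q_card]
  apply card_lt_card
  refine ⟨filter_subset _ _, fun hh => ?_⟩
  exact absurd (mem_filter.1 (hh hq)).2 (lt_irrefl _)

lemma ki {q r} (hq : q ∈ Q) (h : (fy q.2 - fy q.1) / (fx q.2 - fx q.1) < (fy r.2 - fy r.1) / (fx r.2 - fx r.1)) :
    k fx fy q < k fx fy r := k_lt hq (by unfold key; rw [Prod.Lex.toLex_lt_toLex]; exact .inl h)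

lemma mQ {x y : Fin 30} (h : x < y) : (x, y) ∈ Q := by simp [Q, h]

variable (hf : StrictMono fx)
include hf

lemma mid_pos {x y z} (h : x < y) (ae : y < z) (hA : 0 < A fx fy x y z) :
    k fx fy (x, y) < k fx fy (x, z) ∧ k fx fy (x, z) < k fx fy (y, z) := by
  have a := hf h; have b := hf ae
  unfold A at hA
  constructor
  · apply ki (mQ h); dsimp only; rw [div_lt_div_iff₀ (by linarith) (by linarith)]; nlinarith
  · apply ki (mQ (h.trans ae)); dsimp only; rw [div_lt_div_iff₀ (by linarith) (by linarith)]; nlinarith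

lemma mid_neg {x y z} (h : x < y) (ae : y < z) (hA : A fx fy x y z < 0) :
    k fx fy (y, z) < k fx fy (x, z) ∧ k fx fy (x, z) < k fx fy (x, y) := by
  have a := hf h; have b := hf ae
  unfold A at hA
  constructor
  · apply ki (mQ ae); dsimp only; rw [div_lt_div_iff₀ (by linarith) (by linarith)]; nlinarith
  · apply ki (mQ (h.trans ae)); dsimp only; rw [div_lt_div_iff₀ (by linarith) (by linarith)]; nlinarith

variable (hA : ∀ x y z, x ≠ y → x ≠ z → y ≠ z → A fx fy x y z ≠ 0)
include hA

noncomputable def ix : Ix where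
  k x y := k fx fy (x, y)
  lt x y h := kh (mQ h)
  inj x y xh yc h ae e := by simpa using k_inj (mQ h) (mQ ae) e
  surj t ht := by
    have : Q.image (k fx fy) = range 435 := by
      apply eq_of_subset_of_card_le
      · intro i hi; obtain ⟨q, hq, rfl⟩ := mem_image.1 hi; exact mem_range.2 (kh hq)
      · rw [card_image_of_injOn (fun q hq r hr => k_inj hq hr), Q_card, card_range]
    obtain ⟨q, hq, e⟩ := mem_image.1 (this ▸ mem_range.2 ht : t ∈ Q.image (k fx fy))
    exact ⟨q, (mem_filter.1 hq).2, e⟩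
  mid x y z h ae := by
    rcases lt_or_gt_of_ne (hA x y z h.ne (h.trans ae).ne ae.ne) with a | a
    · exact .inr (mid_neg hf h ae a)
    · exact .inl (mid_pos hf h ae a)

lemma bef_A {x y z : Fin 30} (h : x < y) (hx : z ≠ x) (hy : z ≠ y) :
    (ix hf hA).bef (k fx fy (x, y)) z x ↔ A fx fy x y z < 0 := by
  have eg : A fx fy z x y = A fx fy x y z := by unfold A; ring
  have eb : A fx fy x z y = - A fx fy x y z := by unfold A; ring
  have hne := hA x y z h.ne hx.symm hy.symm
  have ka := kh (fx := fx) (fy := fy) (mQ h)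
  unfold Ix.bef
  show (z < x ∧ (k fx fy (x, y) + 434 - k fx fy (z, x)) / 435 % 2 = 0) ∨ (x < z ∧ (k fx fy (x, y) + 434 - k fx fy (x, z)) / 435 % 2 = 1) ↔ _
  rcases lt_or_gt_of_ne hx with a | a
  · have kg := kh (fx := fx) (fy := fy) (mQ a)
    simp only [a, a.asymm, true_and, false_and, or_false]
    rcases lt_or_gt_of_ne hne with s | s
    · have := mid_neg hf a h (eg ▸ s)
      exact iff_of_true om s
    · have := mid_pos hf a h (eg.symm ▸ s)
      exact iff_of_false om s.asymm
  · have kg := kh (fx := fx) (fy := fy) (mQ a)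
    simp only [gt_iff_lt.1 a, a.asymm, true_and, false_and, false_or]
    rcases lt_or_gt_of_ne hy with b | b
    · rcases lt_or_gt_of_ne hne with s | s
      · have := mid_pos hf a b (by linarith)
        exact iff_of_true om s
      · have := mid_neg hf a b (by linarith)
        exact iff_of_false om s.asymm
    · rcases lt_or_gt_of_ne hne with s | s
      · have := mid_neg hf h b s
        exact iff_of_true om s
      · have := mid_pos hf h b s
        exact iff_of_false om s.asymm

lemma card_pair {x y : Fin 30} (h : x < y) :
    (univ.filter fun z => A fx fy x y z < 0).card = (ix hf hA).toSq.l (k fx fy (x, y)) ∧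
    (univ.filter fun z => 0 < A fx fy x y z).card = 28 - (ix hf hA).toSq.l (k fx fy (x, y)) := by
  set I := ix hf hA with hI
  set t := k fx fy (x, y) with ht
  have tl : t < 435 := kh (mQ h)
  have qb : I.q t = (x, y) := by
    have := I.inj _ _ x y (I.qc t) h (by rw [I.qd, Nat.mod_eq_of_lt tl]; rfl)
    exact Prod.ext this.1 this.2
  have hu : I.u t = x := by unfold Ix.u; rw [if_pos om, qb]
  have za : A fx fy x y x = 0 := by unfold A; ring
  have zb : A fx fy x y y = 0 := by unfold A; ring
  have aa : (univ.filter fun z => A fx fy x y z < 0).card = I.toSq.l t := by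
    show _ = I.pos t (I.u t)
    rw [hu]; unfold Ix.pos
    congr 1; ext z
    simp only [mem_filter, mem_univ, true_and]
    by_cases hx : z = x
    · subst hx; rw [za]; exact iff_of_false (lt_irrefl _) (fun h => I.bef_ne h rfl)
    by_cases hy : z = y
    · have := (I.uv_bef t).1
      rw [hu, show I.v t = y by unfold Ix.v; rw [if_pos om, qb]] at this
      rw [hy, zb]; exact iff_of_false (lt_irrefl _) (I.bef_not this)
    exact (bef_A hf hA h hx hy).symm
  refine ⟨aa, ?_⟩
  have af : (univ.filter fun z => A fx fy x y z = 0) = {x, y} := by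
    ext z
    simp only [mem_filter, mem_univ, true_and, mem_insert, mem_singleton]
    constructor
    · intro e; by_contra hn; push Not at hn
      exact hA x y z h.ne hn.1.symm hn.2.symm e
    · rintro (rfl | rfl) <;> assumption
  have ag : (univ : Finset (Fin 30)) = (univ.filter fun z => A fx fy x y z < 0) ∪ (univ.filter fun z => 0 < A fx fy x y z) ∪
      (univ.filter fun z => A fx fy x y z = 0) := by
    ext z; simp only [mem_union, mem_filter, mem_univ, true_and, true_iff]
    rcases lt_trichotomy (A fx fy x y z) 0 with a | a | a
    · exact .inl (.inl a)
    · exact .inr a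
    · exact .inl (.inr a)
  have ah := congrArg Finset.card ag
  rw [card_union_of_disjoint, card_union_of_disjoint, af, aa, Finset.card_pair h.ne] at ah
  · simp only [Finset.card_univ, Fintype.card_fin] at ah; omega
  · rw [Finset.disjoint_filter]; intro z _ a b; linarith
  · rw [Finset.disjoint_union_left, Finset.disjoint_filter, Finset.disjoint_filter]
    exact ⟨fun z _ a b => by linarith, fun z _ a b => by linarith⟩

open Classical in
lemma quads : (univ.filter fun r : (Fin 30 × Fin 30) × (Fin 30 × Fin 30) =>
    r.1.1 < r.1.2 ∧ A fx fy r.1.1 r.1.2 r.2.1 < 0 ∧ 0 < A fx fy r.1.1 r.1.2 r.2.2).card + 9726 ≤ 82215 := by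
  refine le_trans (Nat.add_le_add_right (le_of_eq ?_) _) ((ix hf hA).toSq.sum_bound rfl)
  have e : (univ.filter fun r : (Fin 30 × Fin 30) × (Fin 30 × Fin 30) =>
      r.1.1 < r.1.2 ∧ A fx fy r.1.1 r.1.2 r.2.1 < 0 ∧ 0 < A fx fy r.1.1 r.1.2 r.2.2) =
      Q.biUnion fun q => ({q} : Finset (Fin 30 × Fin 30)) ×ˢ ((univ.filter fun z => A fx fy q.1 q.2 z < 0) ×ˢ (univ.filter fun z => 0 < A fx fy q.1 q.2 z)) := by
    ext ⟨q, z, w⟩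
    simp only [mem_filter, mem_univ, true_and, Finset.mem_biUnion, mem_product, mem_singleton, Q]
    constructor
    · rintro ⟨a, b⟩; exact ⟨q, a, rfl, b⟩
    · rintro ⟨_, a, rfl, b⟩; exact ⟨a, b⟩
  rw [e, Finset.card_biUnion]
  · symm
    refine Finset.sum_bij' (fun t _ => (ix hf hA).q t) (fun q _ => k fx fy q) ?_ ?_ ?_ ?_ ?_
    · intro t _; exact mQ ((ix hf hA).qc t)
    · intro q hq; exact mem_Ico.2 ⟨Nat.zero_le _, kh hq⟩
    · intro t ht
      have := (mem_Ico.1 ht).2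
      exact ((ix hf hA).qd t).trans (Nat.mod_eq_of_lt this)
    · intro q hq
      have := (ix hf hA).qd (k fx fy q)
      rw [Nat.mod_eq_of_lt (kh hq)] at this
      exact k_inj (mQ ((ix hf hA).qc _)) hq this
    · intro t ht
      have c := card_pair hf hA ((ix hf hA).qc t)
      have e : k fx fy ((ix hf hA).q t) = t := ((ix hf hA).qd t).trans (Nat.mod_eq_of_lt (mem_Ico.1 ht).2)
      rw [Finset.card_product, Finset.card_product, Finset.card_singleton, one_mul, c.1, c.2, Prod.mk.eta, e]
  · intro q _ r _ hqr
    rw [Function.onFun, Finset.disjoint_left]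
    rintro ⟨a, b⟩ aa ad
    simp only [mem_product, mem_singleton] at aa ad
    exact hqr (aa.1.symm.trans ad.1)

end Geo

namespace Geo
variable {fx fy : Fin 30 → ℝ}

open Classical in
noncomputable def X (fx fy : Fin 30 → ℝ) : Finset ((Fin 30 × Fin 30) × (Fin 30 × Fin 30)) := univ.filter fun r =>
    r.1.1 < r.1.2 ∧ A fx fy r.1.1 r.1.2 r.2.1 < 0 ∧ 0 < A fx fy r.1.1 r.1.2 r.2.2

lemma X_card (hf : StrictMono fx) (hA : ∀ x y z, x ≠ y → x ≠ z → y ≠ z → A fx fy x y z ≠ 0) : (X fx fy).card + 9726 ≤ 82215 := quads hf hA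

lemma X_iff {r : (Fin 30 × Fin 30) × (Fin 30 × Fin 30)} : r ∈ X fx fy ↔ r.1.1 < r.1.2 ∧ A fx fy r.1.1 r.1.2 r.2.1 < 0 ∧ 0 < A fx fy r.1.1 r.1.2 r.2.2 := by
  unfold X; simp only [mem_filter, mem_univ, true_and]

attribute [irreducible] X

def ph (r : (Fin 30 × Fin 30) × (Fin 30 × Fin 30)) : Finset (Fin 30) := {r.1.1, r.1.2, r.2.1, r.2.2}

def Sp (fx fy : Fin 30 → ℝ) (s : Finset (Fin 30)) (i j : Fin 30) : Prop :=
  ∃ r, (r ∈ X fx fy ∧ ph r = s) ∧ ({r.1.1, r.1.2} : Finset (Fin 30)) = {i, j}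

lemma Sa {i j k l} (hij : i ≠ j) (h : A fx fy i j k * A fx fy i j l < 0) : Sp fx fy {i, j, k, l} i j := by
  have key : ∀ i j k l, i < j → A fx fy i j k < 0 → 0 < A fx fy i j l → Sp fx fy {i, j, k, l} i j := by
    intro i j k l aa ad af
    exact ⟨((i, j), (k, l)), ⟨X_iff.2 ⟨aa, ad, af⟩, rfl⟩, rfl⟩
  have sw : ∀ k, A fx fy j i k = - A fx fy i j k := by intro k; unfold A; ring
  have eg : ({i, j, l, k} : Finset (Fin 30)) = {i, j, k, l} := by ext z; simp only [mem_insert, mem_singleton]; tauto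
  have eb : ({j, i, k, l} : Finset (Fin 30)) = {i, j, k, l} := by ext z; simp only [mem_insert, mem_singleton]; tauto
  have eh : ({j, i, l, k} : Finset (Fin 30)) = {i, j, k, l} := by ext z; simp only [mem_insert, mem_singleton]; tauto
  have pc : ∀ s, Sp fx fy s j i → Sp fx fy s i j := by
    rintro s ⟨r, a, b⟩; exact ⟨r, a, by rw [b, Finset.pair_comm]⟩
  rcases mul_neg_iff.1 h with ⟨a, b⟩ | ⟨a, b⟩ <;> rcases lt_or_gt_of_ne hij with c | c
  · rw [← eg]; exact key _ _ _ _ c b a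
  · rw [← eb]; exact pc _ (key _ _ _ _ c (by rw [sw]; linarith) (by rw [sw]; linarith))
  · exact key _ _ _ _ c a b
  · rw [← eh]; exact pc _ (key _ _ _ _ c (by rw [sw]; linarith) (by rw [sw]; linarith))

lemma pne {i j ij ja : Fin 30} (aa : j ≠ ij) (ad : j ≠ ja) : ({i, j} : Finset (Fin 30)) ≠ {ij, ja} := by
  intro e
  have : j ∈ ({ij, ja} : Finset (Fin 30)) := e ▸ (by simp)
  simp [aa, ad] at this

lemma two {s i j ij ja} (h : Sp fx fy s i j) (ae : Sp fx fy s ij ja) (aa : j ≠ ij) (ad : j ≠ ja) :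
    2 ≤ ((X fx fy).filter fun r => ph r = s).card := by
  obtain ⟨r, a, b⟩ := h; obtain ⟨r', bi, bj⟩ := ae
  exact Finset.one_lt_card.2 ⟨r, mem_filter.2 a, r', mem_filter.2 bi, fun e => pne (i := i) aa ad (by rw [← b, ← bj, e])⟩

lemma two' {s i j ij ja} (h : Sp fx fy s i j) (ae : Sp fx fy s ij ja) (aa : i ≠ ij) (ad : i ≠ ja) :
    2 ≤ ((X fx fy).filter fun r => ph r = s).card := by
  obtain ⟨r, a, b⟩ := h
  exact two ⟨r, a, by rw [b, Finset.pair_comm]⟩ ae aa ad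

lemma signs {a b c d : ℝ} (ha : a ≠ 0) (hb : b ≠ 0) (hc : c ≠ 0) (hd : d ≠ 0) :
    (a*b < 0 ∧ (0 < a*c ∨ 0 < b*d ∨ c*d < 0)) ∨ (0 < a*c ∧ (a*d < 0 ∨ 0 < b*d)) ∨ (b*c < 0 ∧ (a*d < 0 ∨ c*d < 0)) := by
  rcases lt_or_gt_of_ne ha with aa | aa <;> rcases lt_or_gt_of_ne hb with ad | ad <;> rcases lt_or_gt_of_ne hc with af | af <;>
    rcases lt_or_gt_of_ne hd with ag | ag <;>
    simp [mul_neg_iff, mul_pos_iff, aa, ad, af, ag, aa.not_gt, ad.not_gt, af.not_gt, ag.not_gt]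

lemma ins4 (i j k l : Fin 30) : ({i, k, j, l} : Finset (Fin 30)) = {i, j, k, l} ∧ ({j, l, i, k} : Finset (Fin 30)) = {i, j, k, l} ∧
    ({k, l, i, j} : Finset (Fin 30)) = {i, j, k, l} ∧ ({i, l, j, k} : Finset (Fin 30)) = {i, j, k, l} ∧ ({j, k, i, l} : Finset (Fin 30)) = {i, j, k, l} := by
  refine ⟨?_, ?_, ?_, ?_, ?_⟩ <;> ext z <;> simp only [mem_insert, mem_singleton] <;> tauto

variable (hA : ∀ x y z, x ≠ y → x ≠ z → y ≠ z → A fx fy x y z ≠ 0)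
include hA

lemma fib2 {s : Finset (Fin 30)} (hs : s.card = 4) : 2 ≤ ((X fx fy).filter fun r => ph r = s).card := by
  obtain ⟨i, t, hi, rfl, ht⟩ := Finset.card_eq_succ.1 hs
  obtain ⟨j, k, l, hjk, hjl, hkl, rfl⟩ := card_eq_three.1 ht
  simp only [mem_insert, mem_singleton, not_or] at hi
  obtain ⟨hij, hik, hil⟩ := hi
  obtain ⟨eg, eb, eh, ej, ep⟩ := ins4 i j k l
  have pij := Sa (fx := fx) (fy := fy) (k := k) (l := l) hij
  have pik := Sa (fx := fx) (fy := fy) (k := j) (l := l) hik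
  have pil := Sa (fx := fx) (fy := fy) (k := j) (l := k) hil
  have pjk := Sa (fx := fx) (fy := fy) (k := i) (l := l) hjk
  have pjl := Sa (fx := fx) (fy := fy) (k := i) (l := k) hjl
  have pkl := Sa (fx := fx) (fy := fy) (k := i) (l := j) hkl
  rw [eg, show A fx fy i k j = - A fx fy i j k by unfold A; ring] at pik
  rw [ej, show A fx fy i l j = - A fx fy i j l by unfold A; ring, show A fx fy i l k = - A fx fy i k l by unfold A; ring] at pil
  rw [ep, show A fx fy j k i = A fx fy i j k by unfold A; ring] at pjk
  rw [eb, show A fx fy j l i = A fx fy i j l by unfold A; ring, show A fx fy j l k = - A fx fy j k l by unfold A; ring] at pjl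
  rw [eh, show A fx fy k l i = A fx fy i k l by unfold A; ring, show A fx fy k l j = A fx fy j k l by unfold A; ring] at pkl
  rcases signs (hA i j k hij hik hjk) (hA i j l hij hil hjl) (hA i k l hik hil hkl) (hA j k l hjk hjl hkl) with
    ⟨a, b | b | b⟩ | ⟨a, b | b⟩ | ⟨a, b | b⟩
  · exact two (pij a) (pik (by linarith)) (Ne.symm hij) hjk
  · exact two (pjl (by linarith)) (pij a) (Ne.symm hil) hjl.symm
  · exact two (pij a) (pkl b) hjk hjl
  · exact two' (pjk b) (pik (by linarith)) (Ne.symm hij) hjk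
  · exact two (pik (by linarith)) (pjl (by linarith)) hjk.symm hkl
  · exact two (pil (by linarith)) (pjk b) hjl.symm hkl.symm
  · exact two' (pil (by linarith)) (pkl b) hik hil

end Geo

namespace Geo
variable {fx fy : Fin 30 → ℝ}
lemma fib3 (hA : ∀ x y z, x ≠ y → x ≠ z → y ≠ z → A fx fy x y z ≠ 0)
    {i a b c : Fin 30} (hia : i ≠ a) (hib : i ≠ b) (hic : i ≠ c) (hab : a ≠ b) (hac : a ≠ c) (hbc : b ≠ c)
    {α β γ : ℝ} (ak : 0 ≤ α) (aa : 0 ≤ β) (ad : 0 ≤ γ) (hs : α + β + γ = 1) (ex : fx i = α * fx a + β * fx b + γ * fx c)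
    (ey : fy i = α * fy a + β * fy b + γ * fy c) : 3 ≤ ((X fx fy).filter fun r => ph r = {i, a, b, c}).card := by
  obtain rfl : α = 1 - β - γ := by linarith
  have ab : A fx fy i a b = γ * A fx fy a b c := by unfold A; rw [ex, ey]; ring
  have ac : A fx fy i a c = - (β * A fx fy a b c) := by unfold A; rw [ex, ey]; ring
  have bc : A fx fy i b c = (1 - β - γ) * A fx fy a b c := by unfold A; rw [ex, ey]; ring
  have ba : A fx fy i b a = - (γ * A fx fy a b c) := by rw [← ab]; unfold A; ring
  have ca : A fx fy i c a = β * A fx fy a b c := by rw [← neg_neg (β * _), ← ac]; unfold A; ring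
  have cb : A fx fy i c b = - ((1 - β - γ) * A fx fy a b c) := by rw [← bc]; unfold A; ring
  have n0 := hA a b c hab hac hbc
  have nb : γ ≠ 0 := fun e => hA i a b hia hib hab (by rw [ab, e, zero_mul])
  have nh : β ≠ 0 := fun e => hA i a c hia hic hac (by rw [ac, e, zero_mul, neg_zero])
  have nj : 1 - β - γ ≠ 0 := fun e => hA i b c hib hic hbc (by rw [bc, e, zero_mul])
  have q : 0 < A fx fy a b c * A fx fy a b c := mul_self_pos.2 n0
  have p1 := lt_of_le_of_ne ad nb.symm; have pb := lt_of_le_of_ne aa nh.symm; have p3 := lt_of_le_of_ne ak nj.symm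
  have sa := Sa (fx := fx) (fy := fy) (k := b) (l := c) hia (by rw [ab, ac]; nlinarith [mul_pos (mul_pos p1 pb) q])
  have sb := Sa (fx := fx) (fy := fy) (k := a) (l := c) hib (by rw [ba, bc]; nlinarith [mul_pos (mul_pos p1 p3) q])
  have sc := Sa (fx := fx) (fy := fy) (k := a) (l := b) hic (by rw [ca, cb]; nlinarith [mul_pos (mul_pos pb p3) q])
  rw [(ins4 i a b c).1] at sb; rw [(ins4 i a b c).2.2.2.1] at sc
  obtain ⟨rb, ma, xe⟩ := sa; obtain ⟨rc, mc, xd⟩ := sb; obtain ⟨rf, md, xf⟩ := sc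
  exact Finset.two_lt_card.2 ⟨rb, mem_filter.2 ma, rc, mem_filter.2 mc, rf, mem_filter.2 md, fun e => pne (i := i) hia.symm hab (by rw [← xe, ← xd, e]),
    fun e => pne (i := i) hia.symm hac (by rw [← xe, ← xf, e]), fun e => pne (i := i) hib.symm hbc (by rw [← xd, ← xf, e])⟩

lemma X_mem {r} (h : r ∈ X fx fy) : ph r ∈ (univ : Finset (Fin 30)).powersetCard 4 := by
  obtain ⟨⟨x, y⟩, z, w⟩ := r
  obtain ⟨aa, ad, af⟩ := X_iff.1 h
  have za : A fx fy x y x = 0 := by unfold A; ring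
  have zb : A fx fy x y y = 0 := by unfold A; ring
  have aq : x ≠ z := by rintro rfl; linarith
  have aj : y ≠ z := by rintro rfl; linarith
  have bg : x ≠ w := by rintro rfl; linarith
  have dn : y ≠ w := by rintro rfl; linarith
  have a5 : z ≠ w := by rintro rfl; linarith
  rw [mem_powersetCard]
  refine ⟨Finset.subset_univ _, ?_⟩
  simp [ph, aa.ne, aq, aj, bg, dn, a5]

open Classical in
lemma count (hf : StrictMono fx) (hA : ∀ x y z, x ≠ y → x ≠ z → y ≠ z → A fx fy x y z ≠ 0) (Cv : Finset (Fin 30) → Prop)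
    (hC : ∀ s, s.card = 4 → ¬ Cv s → 3 ≤ ((X fx fy).filter fun r => ph r = s).card) :
    9726 ≤ (((univ : Finset (Fin 30)).powersetCard 4).filter Cv).card := by
  have e := Finset.card_eq_sum_card_fiberwise (f := ph) (s := X fx fy) (t := (univ : Finset (Fin 30)).powersetCard 4) (fun r hr => X_mem hr)
  have q : (X fx fy).card + 9726 ≤ 82215 := X_card hf hA
  have cm : ((univ : Finset (Fin 30)).powersetCard 4).card = 27405 := by
    rw [Finset.card_powersetCard]; simp; decide
  have : ∑ s ∈ (univ : Finset (Fin 30)).powersetCard 4, 3 ≤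
      ∑ s ∈ (univ : Finset (Fin 30)).powersetCard 4, (((X fx fy).filter fun r => ph r = s).card + if Cv s then 1 else 0) := by
    apply sum_le_sum
    intro s hs
    have hs := (mem_powersetCard.1 hs).2
    split_ifs with hc
    · have := fib2 hA hs; omega
    · have := hC s hs hc; omega
  rw [Finset.sum_add_distrib, ← e, ← Finset.card_filter, Finset.sum_const, cm, smul_eq_mul] at this
  have t : 27405 * 3 ≤ (X fx fy).card + (((univ : Finset (Fin 30)).powersetCard 4).filter Cv).card := this
  clear this
  linarith

lemma exists_param (P : Finset (ℝ × ℝ)) (hcard : P.card = 30) : ∃ (ε : ℝ) (p : Fin 30 → ℝ × ℝ), (∀ i, p i ∈ P) ∧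
    StrictMono fun i => (p i).1 + ε * (p i).2 := by
  obtain ⟨ε, hε⟩ := Infinite.exists_notMem_finset ((P ×ˢ P).image fun q => - (q.1.1 - q.2.1) / (q.1.2 - q.2.2))
  set f : ℝ × ℝ → ℝ := fun q => q.1 + ε * q.2 with hf
  have inj : Set.InjOn f P := by
    intro a ha b hb e
    simp only [hf] at e
    by_cases h : a.2 - b.2 = 0
    · have ad : a.2 = b.2 := by linarith
      rw [ad] at e; exact Prod.ext (by linarith) ad
    · exfalso; apply hε
      refine mem_image.2 ⟨(a, b), mem_product.2 ⟨ha, hb⟩, ?_⟩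
      dsimp only; rw [div_eq_iff h]; linarith
  have hc : (P.image f).card = 30 := by rw [card_image_of_injOn inj, hcard]
  have := fun i => mem_image.1 (Finset.orderEmbOfFin_mem (P.image f) hc i)
  choose p hp hp' using this
  refine ⟨ε, p, hp, fun i j hij => ?_⟩
  show f (p i) < f (p j)
  rw [hp', hp']; exact ((P.image f).orderEmbOfFin hc).strictMono hij

end Geo

theorem crossing_lower_bound_K30 (P : Finset (ℝ × ℝ)) (hcard : P.card = 30)
    (hgp : GenPos P) : 9726 ≤ crNum P := by
  classical
  obtain ⟨ε, p, hp, hf⟩ := Geo.exists_param P hcard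
  set fx : Fin 30 → ℝ := fun i => (p i).1 + ε * (p i).2 with hfx
  set fy : Fin 30 → ℝ := fun i => (p i).2 with hfy
  have pinj : Function.Injective p := fun i j e => hf.injective (by simp only [hfx, e])
  have hA : ∀ x y z, x ≠ y → x ≠ z → y ≠ z → Geo.A fx fy x y z ≠ 0 := by
    intro x y z hxy hxz hyz ak
    refine hgp (p x) (hp x) (p y) (hp y) (p z) (hp z) (pinj.ne hxy) (pinj.ne hxz) (pinj.ne hyz) ?_
    have hne : fx y - fx x ≠ 0 := sub_ne_zero.2 (hf.injective.ne hxy.symm)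
    rw [collinear_iff_of_mem (p₀ := p x) (by simp)]
    refine ⟨p y - p x, ?_⟩
    have eb : (p z).2 = (fx z - fx x) / (fx y - fx x) * ((p y).2 - (p x).2) + (p x).2 := by
      unfold Geo.A at ak; rw [div_mul_eq_mul_div, ← sub_eq_iff_eq_add, eq_div_iff hne]; simp only [hfy] at ak; linarith
    have eg : fx z = (fx z - fx x) / (fx y - fx x) * (fx y - fx x) + fx x := by rw [div_mul_cancel₀ _ hne]; ring
    generalize (fx z - fx x) / (fx y - fx x) = s at eg eb
    intro q hq
    simp only [Set.mem_insert_iff, Set.mem_singleton_iff] at hq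
    rcases hq with rfl | rfl | rfl
    · exact ⟨0, by simp⟩
    · exact ⟨1, by simp⟩
    · refine ⟨s, Prod.ext ?_ ?_⟩
      · simp only [vadd_eq_add, Prod.fst_add, Prod.smul_fst, Prod.fst_sub, smul_eq_mul]
        simp only [hfx] at eg
        linear_combination eg - ε * eb
      · simp only [vadd_eq_add, Prod.snd_add, Prod.smul_snd, Prod.snd_sub, smul_eq_mul]; exact eb
  have main := Geo.count hf hA (fun s => ConvexPosition (s.image p)) (by
    intro s hs hc
    unfold ConvexPosition at hc
    push Not at hc
    obtain ⟨x, hx, hh⟩ := hc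
    obtain ⟨i, hi, rfl⟩ := mem_image.1 hx
    rw [← Finset.image_erase pinj] at hh
    have af : (s.erase i).card = 3 := by rw [card_erase_of_mem hi, hs]
    have hni := Finset.notMem_erase i s
    rw [← Finset.insert_erase hi]
    obtain ⟨a, b, c, hab, hac, hbc, e⟩ := card_eq_three.1 af
    rw [e] at hh hni ⊢
    simp only [mem_insert, mem_singleton, not_or] at hni
    obtain ⟨w, w0, w1, wj⟩ := Finset.mem_convexHull'.1 hh
    rw [Finset.sum_image pinj.injOn, Finset.sum_insert (by simp [hab, hac]), Finset.sum_pair hbc] at w1 wj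
    have g : ∀ x ∈ ({a, b, c} : Finset (Fin 30)), 0 ≤ w (p x) := fun x hx => w0 _ (Finset.mem_image_of_mem _ hx)
    have eg := congrArg Prod.fst wj; have eb := congrArg Prod.snd wj
    simp only [Prod.fst_add, Prod.smul_fst, Prod.snd_add, Prod.smul_snd, smul_eq_mul] at eg eb
    exact Geo.fib3 hA hni.1 hni.2.1 hni.2.2 hab hac hbc (g a (by simp)) (g b (by simp)) (g c (by simp)) (by linarith)
      (by simp only [hfx]; rw [← eg, ← eb]; ring) (by simp only [hfy]; rw [← eb]; ring))
  refine main.trans ?_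
  rw [← card_image_of_injective _ (Finset.image_injective pinj), ← Set.ncard_coe_finset]
  unfold crNum
  apply Set.ncard_le_ncard
  · intro s hs
    obtain ⟨t, ht, rfl⟩ := mem_image.1 (Finset.mem_coe.1 hs)
    obtain ⟨dk, ht2⟩ := mem_filter.1 ht
    refine ⟨?_, ?_, ht2⟩
    · intro x hx; obtain ⟨i, _, rfl⟩ := mem_image.1 hx; exact hp i
    · rw [card_image_of_injective _ pinj]; exact (mem_powersetCard.1 dk).2
  · exact (P.powerset.finite_toSet).subset fun s hs => Finset.mem_coe.2 (Finset.mem_powerset.2 hs.1)
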